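/- Let K be an algebraically closed field, A a finite dimensional K-algebra, and θ an integer-valued stability function (lattice point) on mod A. Then the following conditions are equivalent: (i) T_θ is compact; (ii) T_θ is bicompact; (iii) T_θ is functorially finite; (iv) T_θ is cocompact; (v) \bar T_θ is compact; (vi) \bar T_θ is cocompact; (vii) \bar T_θ is bicompact; (viii) \bar T_θ is functorially finite. -/

import Mathlib

namespace TorsPaper

variable (A : Type) [Ring A]

/-- `N` is (isomorphic to) a factor module of `M`. -/
def IsQuotientOf (N M : ModuleCat.{0} A) : Prop :=
  ∃ f : M →ₗ[A] N, Function.Surjective f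

/-- `L` is (isomorphic to) a submodule of `M`. -/
def IsSubmoduleOf (L M : ModuleCat.{0} A) : Prop :=
  ∃ f : L →ₗ[A] M, Function.Injective f

/-- `M` is a nonzero module. -/
def Nonzero (M : ModuleCat.{0} A) : Prop := ∃ x : M, x ≠ 0

/-- A torsion class in `mod A`: a class of finitely generated modules, containing the zero
modules, closed under isomorphisms (which follows from `quot`), factor modules and
extensions. -/
structure IsTorsionClass (T : ModuleCat.{0} A → Prop) : Prop where
  fin : ∀ M, T M → Module.Finite A M
  zero : ∀ M : ModuleCat.{0} A, (∀ x : M, x = 0) → T M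
  quot : ∀ M N : ModuleCat.{0} A, T M → Module.Finite A N → IsQuotientOf A N M → T N
  ext : ∀ M : ModuleCat.{0} A, Module.Finite A M → ∀ N : Submodule A M,
    T (ModuleCat.of A N) → T (ModuleCat.of A (M ⧸ N)) → T M

/-- A torsion-free class in `mod A`. -/
structure IsTorsionFreeClass (F : ModuleCat.{0} A → Prop) : Prop where
  fin : ∀ M, F M → Module.Finite A M
  zero : ∀ M : ModuleCat.{0} A, (∀ x : M, x = 0) → F M
  sub : ∀ M N : ModuleCat.{0} A, F M → Module.Finite A N → IsSubmoduleOf A N M → F N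
  ext : ∀ M : ModuleCat.{0} A, Module.Finite A M → ∀ N : Submodule A M,
    F (ModuleCat.of A N) → F (ModuleCat.of A (M ⧸ N)) → F M

/-- The right Hom-perpendicular class `T^⊥` inside `mod A`. -/
def rightPerp (T : ModuleCat.{0} A → Prop) : ModuleCat.{0} A → Prop :=
  fun X => Module.Finite A X ∧ ∀ M : ModuleCat.{0} A, T M → ∀ f : M →ₗ[A] X, f = 0

/-- The smallest torsion class containing a class `S` of modules. -/
def torsClosure (S : ModuleCat.{0} A → Prop) : ModuleCat.{0} A → Prop :=
  fun X => ∀ T : ModuleCat.{0} A → Prop, IsTorsionClass A T → (∀ Y, S Y → T Y) → T X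

/-- The smallest torsion-free class containing a class `S` of modules. -/
def torfClosure (S : ModuleCat.{0} A → Prop) : ModuleCat.{0} A → Prop :=
  fun X => ∀ F : ModuleCat.{0} A → Prop, IsTorsionFreeClass A F → (∀ Y, S Y → F Y) → F X

/-- A torsion class is compact if it is the smallest torsion class containing a single
module `M`. -/
def IsCompactTors (T : ModuleCat.{0} A → Prop) : Prop :=
  ∃ M : ModuleCat.{0} A, Module.Finite A M ∧ T = torsClosure A (fun X => X = M)

/-- A torsion class is cocompact if `T^⊥` is the smallest torsion-free class containing a
single module `N`. -/
def IsCocompactTors (T : ModuleCat.{0} A → Prop) : Prop :=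
  ∃ N : ModuleCat.{0} A, Module.Finite A N ∧ rightPerp A T = torfClosure A (fun X => X = N)

/-- A torsion class is bicompact if it is both compact and cocompact. -/
def IsBicompactTors (T : ModuleCat.{0} A → Prop) : Prop :=
  IsCompactTors A T ∧ IsCocompactTors A T

/-- A class `C` of modules is functorially finite in `mod A` if every finitely generated
module has a left `C`-approximation and a right `C`-approximation. -/
def FunctoriallyFinite (C : ModuleCat.{0} A → Prop) : Prop :=
  (∀ M : ModuleCat.{0} A, Module.Finite A M →
    ∃ (X : ModuleCat.{0} A) (f : M →ₗ[A] X), C X ∧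
      ∀ Y : ModuleCat.{0} A, C Y → ∀ g : M →ₗ[A] Y, ∃ h : X →ₗ[A] Y, h.comp f = g) ∧
  (∀ M : ModuleCat.{0} A, Module.Finite A M →
    ∃ (X : ModuleCat.{0} A) (f : X →ₗ[A] M), C X ∧
      ∀ Y : ModuleCat.{0} A, C Y → ∀ g : Y →ₗ[A] M, ∃ h : Y →ₗ[A] X, f.comp h = g)

/-- A stability function: a real-valued function on `mod A` which is additive on short
exact sequences. -/
def IsStability (θ : ModuleCat.{0} A → ℝ) : Prop :=
  ∀ L M N : ModuleCat.{0} A, Module.Finite A L → Module.Finite A M → Module.Finite A N →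
    ∀ (f : L →ₗ[A] M) (g : M →ₗ[A] N), Function.Injective f → Function.Surjective g →
      LinearMap.range f = LinearMap.ker g → θ M = θ L + θ N

/-- The semistable torsion class `T_θ`. -/
def tTheta (θ : ModuleCat.{0} A → ℝ) : ModuleCat.{0} A → Prop :=
  fun M => Module.Finite A M ∧ ∀ N : ModuleCat.{0} A, Module.Finite A N →
    IsQuotientOf A N M → Nonzero A N → 0 < θ N

/-- The semistable torsion class `\bar T_θ`. -/
def tThetaBar (θ : ModuleCat.{0} A → ℝ) : ModuleCat.{0} A → Prop :=
  fun M => Module.Finite A M ∧ ∀ N : ModuleCat.{0} A, Module.Finite A N →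
    IsQuotientOf A N M → 0 ≤ θ N

/-- The semistable torsion-free class `F_θ`. -/
def fTheta (θ : ModuleCat.{0} A → ℝ) : ModuleCat.{0} A → Prop :=
  fun M => Module.Finite A M ∧ ∀ L : ModuleCat.{0} A, Module.Finite A L →
    IsSubmoduleOf A L M → Nonzero A L → θ L < 0

/-- The semistable torsion-free class `\bar F_θ`. -/
def fThetaBar (θ : ModuleCat.{0} A → ℝ) : ModuleCat.{0} A → Prop :=
  fun M => Module.Finite A M ∧ ∀ L : ModuleCat.{0} A, Module.Finite A L →
    IsSubmoduleOf A L M → θ L ≤ 0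

/-- An integer-valued function on `mod A` additive on short exact sequences; these are
exactly the group homomorphisms `K0(mod A) → ℤ`. -/
def IsAdditiveZ (φ : ModuleCat.{0} A → ℤ) : Prop :=
  ∀ L M N : ModuleCat.{0} A, Module.Finite A L → Module.Finite A M → Module.Finite A N →
    ∀ (f : L →ₗ[A] M) (g : M →ₗ[A] N), Function.Injective f → Function.Surjective g →
      LinearMap.range f = LinearMap.ker g → φ M = φ L + φ N

/-- `[X] = [Y]` in the Grothendieck group `K0(mod A)`: since `K0(mod A)` is free abelian
on the simple modules, this holds iff all additive `ℤ`-valued functions agree on `X`, `Y`. -/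
def SameK0Class (X Y : ModuleCat.{0} A) : Prop :=
  ∀ φ : ModuleCat.{0} A → ℤ, IsAdditiveZ A φ → φ X = φ Y

/-- Two classes of modules are numerically disjoint if they contain no nonzero `X`, `Y`
with `[X] = [Y] ≠ 0` in `K0(mod A)`. -/
def NumericallyDisjoint (C D : ModuleCat.{0} A → Prop) : Prop :=
  ¬ ∃ X Y : ModuleCat.{0} A, C X ∧ D Y ∧ Nonzero A X ∧ Nonzero A Y ∧ SameK0Class A X Y

/-- A brick: a finitely generated module whose endomorphism algebra is a division algebra,
i.e. `M` is nonzero and every nonzero endomorphism is invertible. -/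
def IsBrick (M : ModuleCat.{0} A) : Prop :=
  Module.Finite A M ∧ Nonzero A M ∧ ∀ f : M →ₗ[A] M, f ≠ 0 → Function.Bijective f

/-- A semibrick: a set of pairwise Hom-orthogonal bricks. -/
def IsSemibrick (S : Set (ModuleCat.{0} A)) : Prop :=
  (∀ M ∈ S, IsBrick A M) ∧
    ∀ M ∈ S, ∀ N ∈ S, M ≠ N → ∀ f : M →ₗ[A] N, f = 0


end TorsPaper
namespace TorsPaper
section NCreg
open Matrix Module

lemma exists_minor_field {F : Type*} [Field F] {m n : Type*} [Fintype m] [Fintype n]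
    (A : Matrix m n F) : ∃ (r : Fin A.rank → m) (c : Fin A.rank → n), (A.submatrix r c).det ≠ 0 := by
  classical
  have h0 := Submodule.exists_fun_fin_finrank_span_eq F (Set.range A.col)
  rw [← Matrix.rank_eq_finrank_span_cols] at h0
  obtain ⟨f, hf, -, hli⟩ := h0
  choose c hc using hf
  have e1 : (A.submatrix id c).rank = A.rank := by
    have : LinearIndependent F (A.submatrix id c)ᵀ.row := by
      have e : (A.submatrix id c)ᵀ.row = f := by
        ext i j
        rw [← hc]; rfl
      rw [e]; exact hli
    have := this.rank_matrix
    rw [rank_transpose] at this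
    simpa using this
  set B := (A.submatrix id c)ᵀ with hB
  have hB' : B.rank = A.rank := by rw [hB, rank_transpose, e1]
  have h0 := Submodule.exists_fun_fin_finrank_span_eq F (Set.range B.col)
  rw [← Matrix.rank_eq_finrank_span_cols, hB'] at h0
  obtain ⟨f, hf, -, hli⟩ := h0
  choose r hr using hf
  refine ⟨r, c, ?_⟩
  have : LinearIndependent F (A.submatrix r c).row := by
    have e : (A.submatrix r c).row = f := by
      ext i j
      rw [← hr]; rfl
    rw [e]; exact hli
  rw [linearIndependent_rows_iff_isUnit, isUnit_iff_isUnit_det] at this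
  exact this.ne_zero

lemma le_rank_of_minor {D : Type*} [CommRing D] [IsDomain D] {m n : Type*} [Fintype m] [Fintype n]
    (A : Matrix m n D) {k : ℕ} (r : Fin k → m) (c : Fin k → n) (h : (A.submatrix r c).det ≠ 0) :
    k ≤ A.rank := by
  have h1 := rank_of_det_ne_zero h
  have h2 := A.rank_submatrix_le r c
  rw [h1] at h2
  simpa using h2

lemma rank_map_frac {D : Type*} [CommRing D] [IsDomain D] {m n : Type*} [Fintype m] [Fintype n]
    (A : Matrix m n D) : (A.map (algebraMap D (FractionRing D))).rank = A.rank := by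
  classical
  set L := FractionRing D
  apply le_antisymm
  · obtain ⟨r, c, h⟩ := exists_minor_field (A.map (algebraMap D L))
    apply le_rank_of_minor A r c
    intro h0
    apply h
    have : (A.map (algebraMap D L)).submatrix r c = (algebraMap D L).mapMatrix (A.submatrix r c) := rfl
    rw [this, ← RingHom.map_det, h0, map_zero]
  · obtain ⟨s, hs, hli⟩ := exists_finset_linearIndependent_of_le_finrank
      (R := D) (M := LinearMap.range A.mulVecLin) (n := A.rank) le_rfl
    let g : (m → D) →ₗ[D] (m → L) :=
      LinearMap.pi fun i => (Algebra.linearMap D L).comp (LinearMap.proj i)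
    have hg : Function.Injective g := by
      intro x y h
      ext i
      have := congrFun h i
      exact IsFractionRing.injective D L this
    have h1 : LinearIndependent D (fun x : s => g (x : LinearMap.range A.mulVecLin).1) := by
      have := hli.map' (g.comp (Submodule.subtype _)) ?_
      · exact this
      · rw [LinearMap.ker_eq_bot]
        exact hg.comp Subtype.val_injective
    rw [LinearIndependent.iff_fractionRing (R := D) (K := L)] at h1
    have h2 : ∀ x : s, g (x : LinearMap.range A.mulVecLin).1 ∈
        LinearMap.range (A.map (algebraMap D L)).mulVecLin := by
      intro x
      obtain ⟨v, hv⟩ := x.1.2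
      rw [← hv]
      refine ⟨fun j => algebraMap D L (v j), ?_⟩
      ext i
      simp [g, mulVec, dotProduct, Matrix.map]
    have h3 : LinearIndependent L (fun x : s => (⟨_, h2 x⟩ : LinearMap.range (A.map (algebraMap D L)).mulVecLin)) := by
      apply LinearIndependent.of_comp (Submodule.subtype _)
      exact h1
    have := h3.fintype_card_le_finrank
    rw [Fintype.card_coe, hs] at this
    exact this

lemma exists_minor {D : Type*} [CommRing D] [IsDomain D] {m n : Type*} [Fintype m] [Fintype n]
    (A : Matrix m n D) : ∃ (r : Fin A.rank → m) (c : Fin A.rank → n), (A.submatrix r c).det ≠ 0 := by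
  have := exists_minor_field (A.map (algebraMap D (FractionRing D)))
  rw [rank_map_frac] at this
  obtain ⟨r, c, h⟩ := this
  refine ⟨r, c, fun h0 => h ?_⟩
  have : (A.map (algebraMap D (FractionRing D))).submatrix r c =
    (algebraMap D (FractionRing D)).mapMatrix (A.submatrix r c) := rfl
  rw [this, ← RingHom.map_det, h0, map_zero]

lemma rank_map_le {D E : Type*} [CommRing D] [IsDomain D] [CommRing E] [IsDomain E]
    {m n : Type*} [Fintype m] [Fintype n] (f : D →+* E)
    (A : Matrix m n D) : (A.map f).rank ≤ A.rank := by
  obtain ⟨r, c, h⟩ := exists_minor (A.map f)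
  apply le_rank_of_minor A r c
  intro h0
  apply h
  have : (A.map f).submatrix r c = f.mapMatrix (A.submatrix r c) := rfl
  rw [this, ← RingHom.map_det, h0, map_zero]

lemma rank_map_inj {D E : Type*} [CommRing D] [IsDomain D] [CommRing E] [IsDomain E]
    {m n : Type*} [Fintype m] [Fintype n] (f : D →+* E) (hf : Function.Injective f)
    (A : Matrix m n D) : (A.map f).rank = A.rank := by
  apply le_antisymm (rank_map_le f A)
  obtain ⟨r, c, h⟩ := exists_minor A
  apply le_rank_of_minor (A.map f) r c
  have : (A.map f).submatrix r c = f.mapMatrix (A.submatrix r c) := rfl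
  rw [this, ← RingHom.map_det]
  exact fun h0 => h (hf (by rw [h0, map_zero]))

lemma exists_eval_rank {K σ : Type*} [Field K] [Infinite K]
    {m n : Type*} [Fintype m] [Fintype n] (A : Matrix m n (MvPolynomial σ K)) :
    ∃ y : σ → K, A.rank ≤ (A.map (MvPolynomial.eval y)).rank := by
  obtain ⟨r, c, h⟩ := exists_minor A
  have : ∃ y, MvPolynomial.eval y (A.submatrix r c).det ≠ 0 := by
    by_contra! h0
    exact h (MvPolynomial.funext (by simpa using h0))
  obtain ⟨y, hy⟩ := this
  refine ⟨y, le_rank_of_minor _ r c ?_⟩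
  have : (A.map (MvPolynomial.eval y)).submatrix r c = (MvPolynomial.eval y).mapMatrix (A.submatrix r c) := rfl
  rwa [this, ← RingHom.map_det]

lemma rank_add_ker {D : Type*} [CommRing D] [IsDomain D] {m n : Type*} [Fintype m] [Fintype n]
    (A : Matrix m n D) : A.rank + finrank D (LinearMap.ker A.mulVecLin) = Fintype.card n := by
  rw [Matrix.rank, ← A.mulVecLin.quotKerEquivRange.finrank_eq,
    Submodule.finrank_quotient_add_finrank, finrank_fintype_fun_eq_card]

end NCreg
end TorsPaper

namespace TorsPaper
section NCreg2
open Matrix Module Polynomial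

/-- part of `p` with exponents congruent to `c`. -/
noncomputable def homPart {L : Type*} [Field L] (m : ℕ) (c : ZMod m) : L[X] →ₗ[L] L[X] :=
  Polynomial.lsum (fun e => if (e : ZMod m) = c then Polynomial.monomial e else 0)

lemma coeff_homPart {L : Type*} [Field L] (m : ℕ) (c : ZMod m) (p : L[X]) (e : ℕ) :
    (homPart m c p).coeff e = if (e : ZMod m) = c then p.coeff e else 0 := by
  induction p using Polynomial.induction_on' with
  | add p q hp hq => rw [map_add, coeff_add, hp, hq]; split_ifs <;> simp
  | monomial k a =>
    have : homPart m c (monomial k a) = if (k : ZMod m) = c then monomial k a else 0 := by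
      simp only [homPart, lsum_apply]
      rw [sum_monomial_index]
      · split_ifs <;> simp
      · simp
    rw [this]
    by_cases h : k = e
    · subst h; split_ifs <;> simp
    · split_ifs <;> simp [coeff_monomial, h]

lemma homPart_mul {L : Type*} [Field L] (m : ℕ) (c d : ZMod m) (p : L[X]) (a : L) (e : ℕ)
    (he : (e : ZMod m) = d) :
    homPart m (c + d) (C a * X ^ e * p) = C a * X ^ e * homPart m c p := by
  ext k
  rw [coeff_homPart, mul_assoc, mul_assoc, coeff_C_mul, coeff_C_mul]
  rw [coeff_X_pow_mul', coeff_X_pow_mul']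
  by_cases h : e ≤ k
  · rw [if_pos h, if_pos h, coeff_homPart]
    obtain ⟨l, rfl⟩ := Nat.exists_eq_add_of_le h
    have : ((e + l : ℕ) : ZMod m) = c + d ↔ (l : ZMod m) = c := by
      push_cast; rw [he, add_comm, add_left_inj]
    simp only [this, Nat.add_sub_cancel_left]
    split_ifs <;> simp
  · simp [h]

lemma finrank_spec {L N : Type*} [Field L] [Fintype N] (M : Submodule L[X] (N → L[X]))
    (hM : ∀ v : N → L[X], (X : L[X]) • v ∈ M → v ∈ M) (S : Submodule L (N → L))
    (hS : ∀ u, u ∈ S ↔ ∃ v ∈ M, ∀ j, (v j).coeff 0 = u j) :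
    finrank L S = finrank L[X] M := by
  classical
  obtain ⟨k, ⟨b⟩⟩ := Submodule.nonempty_basis_of_pid (Pi.basisFun L[X] N) M
  rw [finrank_eq_card_basis b, Fintype.card_fin]
  let ev : (N → L[X]) →ₗ[L] (N → L) := LinearMap.pi fun j => (Polynomial.lcoeff L 0).comp (LinearMap.proj j)
  have hev : ∀ v j, ev v j = (v j).coeff 0 := fun v j => rfl
  have hmem : ∀ i, ev (b i) ∈ S := fun i => (hS _).2 ⟨b i, (b i).2, fun j => (hev _ _).symm⟩
  have hli : LinearIndependent L (fun i => (⟨ev (b i), hmem i⟩ : S)) := by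
    apply LinearIndependent.of_comp S.subtype
    rw [Fintype.linearIndependent_iff]
    intro c hc
    have h1 : ev (∑ i, c i • (b i : N → L[X])) = 0 := by
      rw [map_sum]; simpa using hc
    obtain ⟨w, hw⟩ : ∃ w : N → L[X], ∑ i, c i • (b i : N → L[X]) = (X : L[X]) • w := by
      have : ∀ j, ∃ q, (∑ i, c i • (b i : N → L[X])) j = X * q := by
        intro j
        have := congrFun h1 j
        rw [hev] at this
        exact (X_dvd_iff.2 this)
      choose w hw using this
      exact ⟨w, funext hw⟩
    have hw' : w ∈ M := by
      apply hM
      rw [← hw]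
      exact Submodule.sum_mem _ fun i _ => by
        have := M.smul_mem (C (c i)) (b i).2
        rwa [← algebraMap_eq, algebraMap_smul] at this
    have h2 : ∑ i, C (c i) • b i = (X : L[X]) • (⟨w, hw'⟩ : M) := by
      ext1
      simp only [Submodule.coe_sum, Submodule.coe_smul]
      rw [← hw]
      refine Finset.sum_congr rfl fun i _ => ?_
      rw [← algebraMap_eq, algebraMap_smul]
    intro i
    have h3 := congrArg (fun z => b.repr z i) h2
    simp only [b.repr_sum_self, map_smul, Finsupp.smul_apply, smul_eq_mul] at h3
    have := congrArg (fun z => coeff z 0) h3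
    simpa using this
  have hsp : ⊤ ≤ Submodule.span L (Set.range (fun i => (⟨ev (b i), hmem i⟩ : S))) := by
    rintro ⟨u, hu⟩ -
    obtain ⟨v, hv, hvu⟩ := (hS u).1 hu
    have h1 : v = ∑ i, (b.repr ⟨v, hv⟩ i) • (b i : N → L[X]) := by
      have := congrArg Subtype.val (b.sum_repr ⟨v, hv⟩)
      rw [Submodule.coe_sum] at this
      exact this.symm
    have h2 : (⟨u, hu⟩ : S) = ∑ i, (b.repr ⟨v, hv⟩ i).coeff 0 • (⟨ev (b i), hmem i⟩ : S) := by
      ext j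
      change u j = _
      rw [← hvu j]
      generalize b.repr ⟨v, hv⟩ = r at h1
      rw [h1]
      simp [hev, mul_coeff_zero]
    rw [h2]
    exact Submodule.sum_mem _ fun i _ => Submodule.smul_mem _ _ (Submodule.subset_span ⟨i, rfl⟩)
  have := finrank_eq_card_basis (Basis.mk hli hsp)
  simpa using this

lemma dvd_ker {L : Type*} [Field L] (σ : L ≃+* L) (m : ℕ) [NeZero m] {p n : Type*}
    [Fintype p] [Fintype n]
    (g : Matrix (ZMod m × p) (ZMod m × n) L)
    (hg : ∀ i a j b, σ (g (i,a) (j,b)) = g (i+1,a) (j+1,b)) :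
    m ∣ finrank L[X] (LinearMap.ker (Matrix.mulVecLin
      (Matrix.of fun (x : ZMod m × p) (y : ZMod m × n) => C (g x y) * (X : L[X]) ^ (x.1 - y.1).val))) := by
  classical
  set G : Matrix (ZMod m × p) (ZMod m × n) L[X] :=
    (Matrix.of fun (x : ZMod m × p) (y : ZMod m × n) => C (g x y) * (X : L[X]) ^ (x.1 - y.1).val) with hG
  set M := LinearMap.ker G.mulVecLin with hMdef
  have hM : ∀ v, v ∈ M ↔ ∀ x, ∑ y, C (g x y) * (X : L[X]) ^ (x.1 - y.1).val * v y = 0 := by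
    intro v
    rw [hMdef, LinearMap.mem_ker, funext_iff]
    rfl
  let ev : (ZMod m × n → L[X]) →ₗ[L] (ZMod m × n → L) :=
    LinearMap.pi fun j => (Polynomial.lcoeff L 0).comp (LinearMap.proj j)
  have hev : ∀ v j, ev v j = (v j).coeff 0 := fun v j => rfl
  let S : Submodule L (ZMod m × n → L) := (M.restrictScalars L).map ev
  have hS : ∀ u, u ∈ S ↔ ∃ v ∈ M, ∀ j, (v j).coeff 0 = u j := by
    intro u
    simp only [S, Submodule.mem_map, Submodule.restrictScalars_mem, funext_iff, hev]
  have hsat : ∀ v : ZMod m × n → L[X], (X : L[X]) • v ∈ M → v ∈ M := by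
    intro v hv
    rw [hMdef, LinearMap.mem_ker, map_smul] at hv
    exact (smul_eq_zero.1 hv).resolve_left X_ne_zero
  rw [← finrank_spec M hsat S hS]
  -- components
  let inc : ZMod m → ((n → L) →ₗ[L] (ZMod m × n → L)) := fun i =>
    LinearMap.pi fun y => if y.1 = i then LinearMap.proj y.2 else 0
  have hinc : ∀ i u y, inc i u y = if y.1 = i then u y.2 else 0 := by
    intro i u y
    simp only [inc, LinearMap.pi_apply]
    split_ifs <;> simp
  let T : ZMod m → Submodule L (n → L) := fun i => S.comap (inc i)
  have hhom : ∀ u ∈ S, ∀ i, (fun b => u (i, b)) ∈ T i := by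
    intro u hu i
    obtain ⟨v, hv, hvu⟩ := (hS u).1 hu
    refine (hS _).2 ⟨fun y => homPart m (y.1 - i) (v y), ?_, ?_⟩
    · rw [hM] at hv ⊢
      intro x
      have := congrArg (homPart m (x.1 - i)) (hv x)
      rw [map_zero, map_sum] at this
      rw [← this]
      refine Finset.sum_congr rfl fun y _ => ?_
      rw [← homPart_mul m (y.1 - i) (x.1 - y.1) _ _ _ (by simp)]
      congr 2
      ring
    · intro y
      rw [coeff_homPart, hinc, hvu]
      simp only [Nat.cast_zero]
      have : (0 = y.1 - i) ↔ y.1 = i := by rw [eq_comm, sub_eq_zero]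
      simp only [this]
      split_ifs with h
      · rw [← h]
      · rfl
  have hshift : ∀ i, ∀ u ∈ T i, (fun b => σ (u b)) ∈ T (i+1) := by
    intro i u hu
    obtain ⟨v, hv, hvu⟩ := (hS _).1 hu
    refine (hS _).2 ⟨fun y => (v (y.1 - 1, y.2)).map (σ : L →+* L), ?_, ?_⟩
    · rw [hM] at hv ⊢
      intro x
      have := congrArg (Polynomial.map (σ : L →+* L)) (hv (x.1 - 1, x.2))
      rw [Polynomial.map_zero, Polynomial.map_sum] at this
      rw [← this]
      refine Fintype.sum_equiv ((Equiv.subRight (1 : ZMod m)).prodCongr (Equiv.refl n)) _ _ ?_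
      rintro ⟨j, b⟩
      simp [hg]
    · intro y
      rw [coeff_map, hvu, hinc, hinc]
      simp only [sub_eq_iff_eq_add]
      split_ifs <;> simp
  have hle : ∀ i, finrank L (T i) ≤ finrank L (T (i+1)) := by
    intro i
    have hb := (finBasis L (T i)).linearIndependent
    let j : T i →+ T (i+1) :=
      { toFun := fun u => ⟨fun b => σ (u.1 b), hshift i u.1 u.2⟩
        map_zero' := by ext; simp
        map_add' := by intros; ext; simp }
    have := hb.map_of_injective_injective σ.symm j (by simp) (by
      intro u hu
      ext b
      have := congrFun (congrArg Subtype.val hu) b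
      simpa [j] using this) (by
      intro r u
      ext b
      simp [j])
    simpa using this.fintype_card_le_finrank
  have heq : ∀ i, finrank L (T i) = finrank L (T 0) := by
    obtain ⟨d, hd⟩ : ∃ d : ZMod m → ℕ, ∀ i, finrank L (T i) = d i := ⟨_, fun _ => rfl⟩
    simp only [hd] at hle ⊢
    have h1 : ∀ (k : ℕ) i, d i ≤ d (i + k) := by
      intro k
      induction k with
      | zero => intro i; simp
      | succ k ih => intro i; refine (ih i).trans ((hle _).trans (le_of_eq ?_)); push_cast; rw [add_assoc]
    intro i
    apply le_antisymm
    · have := h1 (-i).val i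
      simpa using this
    · have := h1 i.val 0
      simpa using this
  let e : S ≃ₗ[L] (∀ i, T i) :=
    { toFun := fun u i => ⟨fun b => u.1 (i, b), hhom u.1 u.2 i⟩
      map_add' := by intros; rfl
      map_smul' := by intros; rfl
      invFun := fun t => ⟨∑ i, inc i (t i).1, Submodule.sum_mem _ fun i _ => (t i).2⟩
      left_inv := by
        intro u; ext y
        simp [hinc]
      right_inv := by
        intro t; ext i b
        simp [hinc] }
  rw [e.finrank_eq, finrank_pi_fintype]
  simp [heq, ZMod.card]

end NCreg2
end TorsPaper

namespace TorsPaper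
section NCreg3
open Matrix Module Polynomial

/-- generic linear combination of the blow-up -/
noncomputable def blowMat {K R : Type*} [Field K] [CommRing R] [Algebra K R] {κ p n ι : Type*} [Fintype κ]
    (A : κ → Matrix p n K) (y : ι × ι × κ → R) : Matrix (ι × p) (ι × n) R :=
  Matrix.of fun x z => ∑ k, y (x.1, z.1, k) * algebraMap K R (A k x.2 z.2)

lemma blowMat_map {K R S : Type*} [Field K] [CommRing R] [Algebra K R] [CommRing S] [Algebra K S]
    {κ p n ι : Type*} [Fintype κ]
    (A : κ → Matrix p n K) (y : ι × ι × κ → R) (f : R →ₐ[K] S) :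
    (blowMat A y).map (f : R →+* S) = blowMat A (fun z => f (y z)) := by
  ext x z
  simp [blowMat]

theorem blow_regular {K : Type*} [Field K] [Infinite K] (m : ℕ) [NeZero m] {κ p n : Type*} [Fintype κ]
    [Fintype p] [Fintype n] (A : κ → Matrix p n K) :
    ∃ k0 : ℕ, (∃ y : ZMod m × ZMod m × κ → K,
        finrank K (LinearMap.ker (blowMat A y).mulVecLin) = m * k0) ∧
      ∀ y : ZMod m × ZMod m × κ → K, m * k0 ≤ finrank K (LinearMap.ker (blowMat A y).mulVecLin) := by
  classical
  let Rr := MvPolynomial (ZMod m × ZMod m × κ) K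
  let G : Matrix (ZMod m × p) (ZMod m × n) Rr := blowMat A (fun z => MvPolynomial.X z)
  have h1 : ∀ y : ZMod m × ZMod m × κ → K, (blowMat A y).rank ≤ G.rank := by
    intro y
    have : blowMat A y = G.map (MvPolynomial.aeval y : Rr →ₐ[K] K) := by
      have := blowMat_map A (fun z => (MvPolynomial.X z : Rr)) (MvPolynomial.aeval y : Rr →ₐ[K] K)
      simp only [MvPolynomial.aeval_X] at this
      exact this.symm
    rw [this]
    exact rank_map_le (MvPolynomial.aeval y : Rr →ₐ[K] K).toRingHom G
  obtain ⟨y, hy⟩ := exists_eval_rank G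
  have e2 : G.map (MvPolynomial.eval y) = blowMat A y := by
    have := blowMat_map A (fun z => (MvPolynomial.X z : Rr)) (MvPolynomial.aeval y : Rr →ₐ[K] K)
    simp only [MvPolynomial.aeval_X] at this
    rw [← this]
    ext a b
    simp [G]
  rw [e2] at hy
  -- divisibility
  let L := FractionRing Rr
  let ren : ZMod m × ZMod m × κ ≃ ZMod m × ZMod m × κ :=
    (Equiv.addRight 1).prodCongr ((Equiv.addRight 1).prodCongr (Equiv.refl κ))
  let σ0 : Rr ≃ₐ[K] Rr := MvPolynomial.renameEquiv K ren
  let σ : L ≃+* L := IsFractionRing.ringEquivOfRingEquiv σ0.toRingEquiv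
  have hσ : ∀ r : Rr, σ (algebraMap Rr L r) = algebraMap Rr L (σ0 r) := by
    intro r
    exact IsFractionRing.ringEquivOfRingEquiv_algebraMap _ _
  let g : Matrix (ZMod m × p) (ZMod m × n) L := G.map (algebraMap Rr L)
  have hg : ∀ i a j b, σ (g (i,a) (j,b)) = g (i+1,a) (j+1,b) := by
    intro i a j b
    simp only [g, Matrix.map_apply]
    rw [hσ]
    congr 1
    have hX : ∀ z, σ0 (MvPolynomial.X z) = MvPolynomial.X (ren z) := fun z => MvPolynomial.rename_X _ _
    simp only [G, blowMat, Matrix.of_apply, map_sum, map_mul, AlgEquiv.commutes, hX]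
    rfl
  have hd := dvd_ker σ m g hg
  let φ : Rr →ₐ[K] L[X] := MvPolynomial.aeval (fun z => C (algebraMap Rr L (MvPolynomial.X z)) * X ^ (z.1 - z.2.1).val)
  have hφX : ∀ z, φ (MvPolynomial.X z) = C (algebraMap Rr L (MvPolynomial.X z)) * X ^ (z.1 - z.2.1).val :=
    fun z => MvPolynomial.aeval_X _ _
  have hφ : Function.Injective φ := by
    have : ∀ r, (φ r).eval 1 = algebraMap Rr L r := by
      intro r
      induction r using MvPolynomial.induction_on with
      | C a =>
        have h : (MvPolynomial.C a : Rr) = algebraMap K Rr a := rfl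
        rw [h, AlgHom.commutes, ← IsScalarTower.algebraMap_apply, IsScalarTower.algebraMap_apply K L L[X]]
        simp
      | add p q hp hq => simp [hp, hq]
      | mul_X p z hp => rw [map_mul, eval_mul, hp, map_mul, hφX]; simp
    intro a b hab
    apply IsFractionRing.injective Rr L
    rw [← this, ← this, hab]
  have h3 : G.map φ = Matrix.of fun (x : ZMod m × p) (y : ZMod m × n) => C (g x y) * (X : L[X]) ^ (x.1 - y.1).val := by
    ext1 x z
    simp only [Matrix.map_apply, G, blowMat, Matrix.of_apply, g, map_sum, map_mul, AlgHom.commutes, hφX]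
    rw [Finset.sum_mul]
    refine Finset.sum_congr rfl fun k _ => ?_
    rw [IsScalarTower.algebraMap_apply K L L[X], ← IsScalarTower.algebraMap_apply K Rr L, algebraMap_eq]
    ring
  rw [← h3] at hd
  have h4 := rank_map_inj φ.toRingHom hφ G
  have h5 := rank_add_ker (G.map φ)
  have h6 : (G.map φ).rank = G.rank := h4
  obtain ⟨k0, hk0⟩ := hd
  have h7 := rank_add_ker (blowMat A y)
  have h8 := le_antisymm hy (h1 y)
  refine ⟨k0, ⟨y, by omega⟩, fun y' => ?_⟩
  have h9 := rank_add_ker (blowMat A y')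
  have h10 := h1 y'
  omega

end NCreg3
end TorsPaper

namespace TorsPaper
section NCthm
open Matrix Module

variable {K : Type} [Field K]

/-- block map -/
noncomputable def blowMap {V W : Type} [AddCommGroup V] [Module K V] [AddCommGroup W] [Module K W]
    {ι : Type} [Fintype ι] (Y : ι → ι → (V →ₗ[K] W)) : (ι → V) →ₗ[K] (ι → W) :=
  LinearMap.pi fun i => ∑ j, (Y i j).comp (LinearMap.proj j)

lemma blowMap_apply {V W : Type} [AddCommGroup V] [Module K V] [AddCommGroup W] [Module K W]
    {ι : Type} [Fintype ι] (Y : ι → ι → (V →ₗ[K] W)) (v : ι → V) (i : ι) :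
    blowMap Y v i = ∑ j, Y i j (v j) := by
  simp [blowMap]

def Blow {V W : Type} [AddCommGroup V] [Module K V] [AddCommGroup W] [Module K W]
    (ι : Type) [Fintype ι] (𝒜 : Submodule K (V →ₗ[K] W)) : Submodule K ((ι → V) →ₗ[K] (ι → W)) where
  carrier := {X | ∃ Y : ι → ι → (V →ₗ[K] W), (∀ i j, Y i j ∈ 𝒜) ∧ X = blowMap Y}
  zero_mem' := ⟨fun _ _ => 0, fun _ _ => 𝒜.zero_mem, by ext; simp [blowMap_apply]⟩
  add_mem' := by
    rintro _ _ ⟨Y, hY, rfl⟩ ⟨Z, hZ, rfl⟩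
    refine ⟨fun i j => Y i j + Z i j, fun i j => 𝒜.add_mem (hY i j) (hZ i j), ?_⟩
    refine LinearMap.ext fun v => funext fun i => ?_
    simp [blowMap_apply, Finset.sum_add_distrib]
  smul_mem' := by
    rintro c _ ⟨Y, hY, rfl⟩
    refine ⟨fun i j => c • Y i j, fun i j => 𝒜.smul_mem c (hY i j), ?_⟩
    refine LinearMap.ext fun v => funext fun i => ?_
    simp [blowMap_apply, Finset.smul_sum]

lemma finrank_ker_le {V W V' W' : Type} [AddCommGroup V] [Module K V] [AddCommGroup W] [Module K W]
    [AddCommGroup V'] [Module K V'] [AddCommGroup W'] [Module K W'] [FiniteDimensional K V']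
    (f : V →ₗ[K] W) (f' : V' →ₗ[K] W') (e : V →ₗ[K] V')
    (he : ∀ v, f v = 0 → e v = 0 → v = 0)
    (h : ∀ v, f v = 0 → f' (e v) = 0) :
    finrank K (LinearMap.ker f) ≤ finrank K (LinearMap.ker f') := by
  refine LinearMap.finrank_le_finrank_of_injective
    (f := (e.comp (LinearMap.ker f).subtype).codRestrict (LinearMap.ker f') (fun v => h v.1 v.2)) ?_
  rw [← LinearMap.ker_eq_bot, LinearMap.ker_eq_bot']
  intro a ha
  have := congrArg Subtype.val ha
  exact Subtype.ext (he a.1 a.2 this)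

def Tight {V W : Type} [AddCommGroup V] [Module K V] [AddCommGroup W] [Module K W]
    (𝒜 : Submodule K (V →ₗ[K] W)) (X : V →ₗ[K] W) : Prop :=
  X ∈ 𝒜 ∧ ∀ (ι : Type) [Fintype ι] (Y : ι → ι → (V →ₗ[K] W)), (∀ i j, Y i j ∈ 𝒜) →
    Fintype.card ι * finrank K (LinearMap.ker X) ≤ finrank K (LinearMap.ker (blowMap Y))

lemma blow_uncurry {V W : Type} [AddCommGroup V] [Module K V] [AddCommGroup W] [Module K W]
    [FiniteDimensional K V] (𝒜 : Submodule K (V →ₗ[K] W)) (ι κ : Type) [Fintype ι] [Fintype κ]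
    (Z : ι → ι → ((κ → V) →ₗ[K] (κ → W))) (hZ : ∀ i j, Z i j ∈ Blow κ 𝒜) :
    ∃ Y : ι × κ → ι × κ → (V →ₗ[K] W), (∀ i j, Y i j ∈ 𝒜) ∧
      finrank K (LinearMap.ker (blowMap Y)) ≤ finrank K (LinearMap.ker (blowMap Z)) := by
  choose Y hY hYZ using hZ
  refine ⟨fun x y => Y x.1 y.1 x.2 y.2, fun x y => hY _ _ _ _, ?_⟩
  refine finrank_ker_le _ _ (LinearEquiv.curry K V ι κ).toLinearMap
    (fun v _ h => (LinearEquiv.map_eq_zero_iff _).1 h) ?_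
  intro v hv
  ext i a
  have := congrFun hv (i, a)
  rw [blowMap_apply] at this ⊢
  simp only [hYZ, Finset.sum_apply, blowMap_apply]
  refine Eq.trans ?_ this
  rw [Fintype.sum_prod_type]
  rfl

lemma tight_step {V W : Type} [AddCommGroup V] [Module K V] [AddCommGroup W] [Module K W]
    [FiniteDimensional K V] {𝒜 : Submodule K (V →ₗ[K] W)} {X : V →ₗ[K] W} (hX : Tight 𝒜 X)
    {Y : V →ₗ[K] W} (hY : Y ∈ 𝒜) :
    (∀ v, X v = 0 → Y v ∈ LinearMap.range X) ∧ Tight (Blow (Fin 2) 𝒜) (blowMap ![![X, 0], ![Y, X]]) := by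
  set X' : (Fin 2 → V) →ₗ[K] (Fin 2 → W) := blowMap ![![X, 0], ![Y, X]] with hX'
  have hmem : ∀ i j : Fin 2, ![![X, 0], ![Y, X]] i j ∈ 𝒜 := by
    intro i j
    fin_cases i <;> fin_cases j <;> simp [hX.1, hY]
  have hker : ∀ v, X' v = 0 ↔ X (v 0) = 0 ∧ Y (v 0) + X (v 1) = 0 := by
    intro v
    rw [funext_iff, Fin.forall_fin_two]
    simp [hX', blowMap_apply]
  have h2 : 2 * finrank K (LinearMap.ker X) ≤ finrank K (LinearMap.ker X') := by
    have := hX.2 (Fin 2) _ hmem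
    rwa [Fintype.card_fin] at this
  let p : LinearMap.ker X' →ₗ[K] V := (LinearMap.proj 0).comp (LinearMap.ker X').subtype
  have h3 := LinearMap.finrank_range_add_finrank_ker p
  have h4 : finrank K (LinearMap.ker p) ≤ finrank K (LinearMap.ker X) := by
    refine finrank_ker_le p X ((LinearMap.proj 1).comp (LinearMap.ker X').subtype) ?_ ?_
    · intro v h0 h1
      ext i
      fin_cases i
      · exact h0
      · exact h1
    · intro v h0
      have := ((hker v.1).1 v.2).2
      have h0' : v.1 0 = 0 := h0
      rw [h0', map_zero, zero_add] at this
      exact this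
  have h5 : LinearMap.range p ≤ LinearMap.ker X ⊓ (LinearMap.range X).comap Y := by
    rintro _ ⟨v, rfl⟩
    have := (hker v.1).1 v.2
    refine ⟨this.1, ?_⟩
    change Y _ ∈ LinearMap.range X
    refine ⟨- v.1 1, ?_⟩
    rw [map_neg]
    exact (eq_neg_of_add_eq_zero_left this.2).symm
  have h6 : finrank K (LinearMap.range p) ≤ finrank K (LinearMap.ker X) :=
    Submodule.finrank_mono (h5.trans inf_le_left)
  have h7 : LinearMap.range p = LinearMap.ker X :=
    Submodule.eq_of_le_of_finrank_le (h5.trans inf_le_left) (by omega)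
  refine ⟨fun v hv => ?_, ⟨_, hmem, rfl⟩, ?_⟩
  · have : v ∈ LinearMap.range p := by rw [h7]; exact hv
    exact (h5 this).2
  · intro ι _ Z hZ
    obtain ⟨Y', hY', hle⟩ := blow_uncurry 𝒜 ι (Fin 2) Z hZ
    refine le_trans ?_ hle
    refine le_trans ?_ (hX.2 _ Y' hY')
    rw [Fintype.card_prod, Fintype.card_fin, mul_assoc]
    exact Nat.mul_le_mul_left _ (by omega)

def ChainF {V W : Type} [AddCommGroup V] [Module K V] [AddCommGroup W] [Module K W]
    (𝒜 : Submodule K (V →ₗ[K] W)) (X : V →ₗ[K] W) (a : V) : ℕ → V → Prop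
  | 0, z => z = a
  | n+1, z => ∃ Y ∈ 𝒜, ∃ z', ChainF 𝒜 X a n z' ∧ X z = Y z'

lemma chain_peel {V W : Type} [AddCommGroup V] [Module K V] [AddCommGroup W] [Module K W]
    {𝒜 : Submodule K (V →ₗ[K] W)} {X : V →ₗ[K] W} {a : V} (n : ℕ) : ∀ z, ChainF 𝒜 X a (n+1) z →
    ∃ Y ∈ 𝒜, ∃ z1, X z1 = Y a ∧ ChainF 𝒜 X z1 n z := by
  induction n with
  | zero =>
    rintro z ⟨Y, hY, z', rfl, h⟩
    exact ⟨Y, hY, z, h, rfl⟩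
  | succ n ih =>
    rintro z ⟨Y, hY, z', h', h⟩
    obtain ⟨Y0, hY0, z1, hz1, hc⟩ := ih z' h'
    exact ⟨Y0, hY0, z1, hz1, Y, hY, z', hc, h⟩

lemma chain_lemma (n : ℕ) : ∀ {V W : Type} [AddCommGroup V] [Module K V] [AddCommGroup W] [Module K W]
    [FiniteDimensional K V] {𝒜 : Submodule K (V →ₗ[K] W)} {X : V →ₗ[K] W} (_ : Tight 𝒜 X)
    {a z : V} (_ : X a = 0) (_ : ChainF 𝒜 X a n z) {Y : V →ₗ[K] W} (_ : Y ∈ 𝒜), Y z ∈ LinearMap.range X := by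
  induction n with
  | zero =>
    intro V W _ _ _ _ _ 𝒜 X hX a z ha hz Y hY
    obtain rfl : z = a := hz
    exact (tight_step hX hY).1 _ ha
  | succ n ih =>
    intro V W _ _ _ _ _ 𝒜 X hX a z ha hz Y hY
    obtain ⟨Y0, hY0, z1, hz1, hc⟩ := chain_peel n z hz
    have ht := (tight_step hX (𝒜.neg_mem hY0)).2
    have hX' : ∀ v, blowMap ![![X, 0], ![-Y0, X]] v = ![X (v 0), -Y0 (v 0) + X (v 1)] := by
      intro v
      ext i
      fin_cases i <;> simp [blowMap_apply]
    have hY' : ∀ (Y : V →ₗ[K] W) v, blowMap ![![0, 0], ![0, Y]] v = ![0, Y (v 1)] := by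
      intro Y v
      ext i
      fin_cases i <;> simp [blowMap_apply]
    have hYm : ∀ Y ∈ 𝒜, blowMap ![![0, 0], ![0, Y]] ∈ Blow (Fin 2) 𝒜 := by
      intro Y hY
      refine ⟨_, ?_, rfl⟩
      intro i j
      fin_cases i <;> fin_cases j <;> simp [hY]
    have hlift : ∀ k z, ChainF 𝒜 X z1 k z → ∃ u, ChainF (Blow (Fin 2) 𝒜) (blowMap ![![X, 0], ![-Y0, X]])
        ![a, z1] k ![u, z] := by
      intro k
      induction k with
      | zero => rintro z rfl; exact ⟨a, rfl⟩
      | succ k ihk =>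
        rintro z ⟨Y, hY, z', hz', h⟩
        obtain ⟨u', hu'⟩ := ihk z' hz'
        refine ⟨0, blowMap ![![0, 0], ![0, Y]], hYm Y hY, _, hu', ?_⟩
        rw [hX', hY']
        simp [h]
    obtain ⟨u, hu⟩ := hlift n z hc
    obtain ⟨q, hq⟩ := ih ht (by rw [hX']; simp [ha, hz1]) hu (hYm Y hY)
    rw [hX', hY'] at hq
    have h0 : X (q 0) = 0 := by simpa using congrFun hq 0
    have h1 : -Y0 (q 0) + X (q 1) = Y z := by simpa using congrFun hq 1
    rw [← h1]
    exact (LinearMap.range X).add_mem ((LinearMap.range X).neg_mem ((tight_step hX hY0).1 _ h0)) ⟨_, rfl⟩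

def act {V W : Type} [AddCommGroup V] [Module K V] [AddCommGroup W] [Module K W]
    (𝒜 : Submodule K (V →ₗ[K] W)) (U : Submodule K V) : Submodule K W :=
  Submodule.span K {w | ∃ Y ∈ 𝒜, ∃ u ∈ U, w = Y u}

lemma tight_inj {V W : Type} [AddCommGroup V] [Module K V] [AddCommGroup W] [Module K W]
    [FiniteDimensional K V] [FiniteDimensional K W]
    {𝒜 : Submodule K (V →ₗ[K] W)} {X : V →ₗ[K] W} (hX : Tight 𝒜 X)
    (h : ∀ U : Submodule K V, finrank K U ≤ finrank K (act 𝒜 U)) : Function.Injective X := by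
  let Z : Submodule K V := Submodule.span K {z | ∃ a n, X a = 0 ∧ ChainF 𝒜 X a n z}
  have hk : LinearMap.ker X ≤ Z := fun a ha => Submodule.subset_span ⟨a, 0, ha, rfl⟩
  have h1 : act 𝒜 Z ≤ Z.map X := by
    rw [act, Submodule.span_le]
    rintro w ⟨Y, hY, u, hu, rfl⟩
    have : Z ≤ (Z.map X).comap Y := by
      rw [Submodule.span_le]
      rintro z ⟨a, n, ha, hz⟩
      obtain ⟨x, hx⟩ := chain_lemma n hX ha hz hY
      exact ⟨x, Submodule.subset_span ⟨a, n+1, ha, Y, hY, z, hz, hx⟩, hx⟩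
    exact this hu
  have h2 := Submodule.finrank_mono h1
  have h3 := LinearMap.finrank_range_add_finrank_ker (X.domRestrict Z)
  rw [LinearMap.range_domRestrict] at h3
  have h4 : finrank K (LinearMap.ker X) ≤ finrank K (LinearMap.ker (X.domRestrict Z)) := by
    refine LinearMap.finrank_le_finrank_of_injective
      (f := ((Submodule.inclusion hk).codRestrict _ (fun v => v.2))) ?_
    intro x y hxy
    have := congrArg (fun t => (t.1 : V)) hxy
    exact Subtype.ext this
  have h5 := h Z
  rw [← LinearMap.ker_eq_bot, ← Submodule.finrank_eq_zero]
  omega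

lemma blow_hyp {V W : Type} [AddCommGroup V] [Module K V] [AddCommGroup W] [Module K W]
    [FiniteDimensional K V] [FiniteDimensional K W]
    {𝒜 : Submodule K (V →ₗ[K] W)} 
    (h : ∀ U : Submodule K V, finrank K U ≤ finrank K (act 𝒜 U)) (ι : Type) [Fintype ι]
    (U : Submodule K (ι → V)) : finrank K U ≤ finrank K (act (Blow ι 𝒜) U) := by
  classical
  let V' : Submodule K V := ⨆ i, U.map (LinearMap.proj i)
  have h1 : finrank K U ≤ Fintype.card ι * finrank K V' := by
    have : finrank K (ι → V') = Fintype.card ι * finrank K V' := by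
      rw [finrank_pi_fintype]; simp
    rw [← this]
    have hm : ∀ u : U, ∀ i, u.1 i ∈ V' := fun u i =>
      Submodule.mem_iSup_of_mem i ⟨u.1, u.2, rfl⟩
    refine LinearMap.finrank_le_finrank_of_injective
      (f := LinearMap.pi fun i => ((LinearMap.proj i).comp U.subtype).codRestrict V' (fun u => hm u i)) ?_
    intro x y hxy
    ext i
    exact congrArg Subtype.val (congrFun hxy i)
  have h2 : Fintype.card ι * finrank K (act 𝒜 V') ≤ finrank K (act (Blow ι 𝒜) U) := by
    have : finrank K (ι → act 𝒜 V') = Fintype.card ι * finrank K (act 𝒜 V') := by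
      rw [finrank_pi_fintype]; simp
    rw [← this]
    have hs : ∀ i, ∀ w ∈ act 𝒜 V', Pi.single i w ∈ act (Blow ι 𝒜) U := by
      intro i
      have : act 𝒜 V' ≤ (act (Blow ι 𝒜) U).comap (LinearMap.single K (fun _ => W) i) := by
        rw [act, Submodule.span_le]
        rintro _ ⟨Y, hY, v, hv, rfl⟩
        have : V' ≤ ((act (Blow ι 𝒜) U).comap (LinearMap.single K (fun _ => W) i)).comap Y := by
          apply iSup_le
          rintro j _ ⟨u, hu, rfl⟩
          refine Submodule.subset_span ⟨blowMap (fun i' j' => if i' = i ∧ j' = j then Y else 0),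
            ⟨_, ?_, rfl⟩, u, hu, ?_⟩
          · intro i' j'; split_ifs
            · exact hY
            · exact 𝒜.zero_mem
          · ext i'
            rw [blowMap_apply]
            by_cases hi : i' = i
            · subst hi
              rw [Finset.sum_eq_single j]
              · simp
              · intro b _ hb; simp [hb]
              · simp
            · simp [hi]
        exact this hv
      exact this
    have hm : ∀ w : ι → act 𝒜 V', (fun i => (w i : W)) ∈ act (Blow ι 𝒜) U := by
      intro w
      rw [← Finset.univ_sum_single (fun i => (w i : W))]
      exact Submodule.sum_mem _ fun i _ => hs i _ (w i).2
    refine LinearMap.finrank_le_finrank_of_injective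
      (f := (LinearMap.pi fun i => (Submodule.subtype _).comp (LinearMap.proj i)).codRestrict
        (act (Blow ι 𝒜) U) hm) ?_
    intro x y hxy
    ext i
    exact congrFun (congrArg Subtype.val hxy) i
  exact h1.trans ((Nat.mul_le_mul_left _ (h V')).trans h2)

lemma regular' {V W : Type} [AddCommGroup V] [Module K V] [AddCommGroup W] [Module K W]
    [FiniteDimensional K V] [FiniteDimensional K W] [Infinite K]
    (𝒜 : Submodule K (V →ₗ[K] W)) (m : ℕ) [NeZero m] :
    ∃ k0 : ℕ, (∃ Y : ZMod m → ZMod m → (V →ₗ[K] W), (∀ i j, Y i j ∈ 𝒜) ∧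
        finrank K (LinearMap.ker (blowMap Y)) ≤ m * k0) ∧
      ∀ Y : ZMod m → ZMod m → (V →ₗ[K] W), (∀ i j, Y i j ∈ 𝒜) →
        m * k0 ≤ finrank K (LinearMap.ker (blowMap Y)) := by
  classical
  let bV := finBasis K V
  let bW := finBasis K W
  let bA := finBasis K 𝒜
  obtain ⟨k0, ⟨y, hy⟩, hk⟩ := blow_regular (K := K) m (fun k => LinearMap.toMatrix bV bW (bA k).1)
  let e : (ZMod m → V) ≃ₗ[K] (ZMod m × Fin (finrank K V) → K) :=
    (LinearEquiv.piCongrRight fun _ => bV.equivFun).trans (LinearEquiv.curry K K _ _).symm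
  have he : ∀ v i b, e v (i, b) = bV.repr (v i) b := fun _ _ _ => rfl
  have key : ∀ (y : ZMod m × ZMod m × _ → K) (v : ZMod m → V) i a,
      (blowMat (fun k => LinearMap.toMatrix bV bW (bA k).1) y).mulVecLin (e v) (i, a) =
        bW.repr (blowMap (fun i j => ∑ k, y (i, j, k) • (bA k).1) v i) a := by
    intro y v i a
    have hAm : ∀ k u, bW.repr ((bA k).1 u) a =
        ∑ b, LinearMap.toMatrix bV bW (bA k).1 a b * bV.repr u b := by
      intro k u
      have := congrFun (LinearMap.toMatrix_mulVec_repr bV bW (bA k).1 u) a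
      rw [← this]; rfl
    rw [blowMap_apply, map_sum, Finset.sum_apply', mulVecLin_apply, mulVec, dotProduct, Fintype.sum_prod_type]
    refine Finset.sum_congr rfl fun j _ => ?_
    simp only [LinearMap.sum_apply, LinearMap.smul_apply, map_sum, map_smul, Finsupp.coe_finsetSum,
      Finset.sum_apply, Finsupp.smul_apply, hAm, he, blowMat, Matrix.of_apply, smul_eq_mul,
      Algebra.algebraMap_self, RingHom.id_apply, Finset.mul_sum, Finset.sum_mul]
    rw [Finset.sum_comm]
    refine Finset.sum_congr rfl fun k _ => Finset.sum_congr rfl fun b _ => ?_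
    ring
  have hker : ∀ (y : ZMod m × ZMod m × _ → K) (v : ZMod m → V),
      (blowMat (fun k => LinearMap.toMatrix bV bW (bA k).1) y).mulVecLin (e v) = 0 ↔
        (blowMap (fun i j => ∑ k, y (i, j, k) • (bA k).1) v) = 0 := by
    intro y v
    constructor
    · intro h
      ext i
      apply bW.repr.injective
      ext a
      rw [← key, h]; simp
    · intro h
      ext ⟨i, a⟩
      rw [key, h]; simp
  refine ⟨k0, ⟨fun i j => ∑ k, y (i, j, k) • (bA k).1, ?_, ?_⟩, ?_⟩
  · intro i j
    exact Submodule.sum_mem _ fun k _ => 𝒜.smul_mem _ (bA k).2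
  · rw [← hy]
    exact finrank_ker_le _ _ e.toLinearMap (fun v _ h => by simpa using h) (fun v hv => (hker y v).2 hv)
  · intro Y hY
    obtain ⟨y', rfl⟩ : ∃ y' : ZMod m × ZMod m × Fin (finrank K 𝒜) → K,
        Y = fun i j => ∑ k, y' (i, j, k) • (bA k).1 := by
      refine ⟨fun z => bA.repr ⟨Y z.1 z.2.1, hY _ _⟩ z.2.2, ?_⟩
      funext i j
      have := congrArg Subtype.val (bA.sum_repr ⟨Y i j, hY i j⟩)
      rw [Submodule.coe_sum] at this
      exact this.symm
    refine (hk y').trans ?_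
    refine finrank_ker_le _ _ e.symm.toLinearMap (fun v _ h => (LinearEquiv.map_eq_zero_iff _).1 h)
      (fun v hv => ?_)
    refine (hker y' _).1 ?_
    rw [LinearEquiv.coe_coe, LinearEquiv.apply_symm_apply]
    exact hv

lemma exists_tight {V W : Type} [AddCommGroup V] [Module K V] [AddCommGroup W] [Module K W]
    [FiniteDimensional K V] [FiniteDimensional K W] [Infinite K]
    (𝒜 : Submodule K (V →ₗ[K] W)) : ∃ (m : ℕ) (_ : NeZero m), ∃ X, Tight (Blow (ZMod m) 𝒜) X := by
  classical
  have hreg : ∀ m : ℕ, ∃ k0 : ℕ, m ≠ 0 → ∀ [NeZero m], (∃ Y : ZMod m → ZMod m → (V →ₗ[K] W), (∀ i j, Y i j ∈ 𝒜) ∧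
        finrank K (LinearMap.ker (blowMap Y)) ≤ m * k0) ∧
      ∀ Y : ZMod m → ZMod m → (V →ₗ[K] W), (∀ i j, Y i j ∈ 𝒜) →
        m * k0 ≤ finrank K (LinearMap.ker (blowMap Y)) := by
    intro m
    by_cases hm : m = 0
    · exact ⟨0, fun h => absurd hm h⟩
    · have : NeZero m := ⟨hm⟩
      obtain ⟨k0, hk0⟩ := regular' 𝒜 m
      exact ⟨k0, fun _ _ => hk0⟩
  choose d hd using hreg
  obtain ⟨m, hm, hmin⟩ : ∃ m, m ≠ 0 ∧ ∀ m', m' ≠ 0 → d m ≤ d m' := by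
    have hne : ∃ k, ∃ m, m ≠ 0 ∧ d m = k := ⟨_, 1, one_ne_zero, rfl⟩
    obtain ⟨m, hm, h⟩ := Nat.find_spec hne
    exact ⟨m, hm, fun m' hm' => h ▸ Nat.find_min' hne ⟨m', hm', rfl⟩⟩
  have : NeZero m := ⟨hm⟩
  obtain ⟨⟨Y, hY, hle⟩, -⟩ := hd m hm
  refine ⟨m, inferInstance, blowMap Y, ⟨Y, hY, rfl⟩, ?_⟩
  intro ι _ Z hZ
  obtain ⟨Y', hY', hle'⟩ := blow_uncurry 𝒜 ι (ZMod m) Z hZ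
  refine le_trans ?_ hle'
  by_cases hι : Fintype.card ι = 0
  · simp [hι]
  have hN : Fintype.card ι * m ≠ 0 := mul_ne_zero hι hm
  have : NeZero (Fintype.card ι * m) := ⟨hN⟩
  have e : ZMod (Fintype.card ι * m) ≃ ι × ZMod m := Fintype.equivOfCardEq (by simp [ZMod.card])
  have h1 := (hd _ hN).2 (fun i j => Y' (e i) (e j)) (fun i j => hY' _ _)
  have h2 : finrank K (LinearMap.ker (blowMap (fun i j => Y' (e i) (e j)))) ≤
      finrank K (LinearMap.ker (blowMap Y')) := by
    refine finrank_ker_le _ _ (LinearEquiv.funCongrLeft K V e.symm).toLinearMap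
      (fun v _ h => (LinearEquiv.map_eq_zero_iff _).1 h) (fun v hv => ?_)
    ext i
    have := congrFun hv (e.symm i)
    rw [blowMap_apply] at this ⊢
    refine Eq.trans ?_ this
    refine Fintype.sum_equiv e.symm _ _ fun j => ?_
    simp [LinearEquiv.funCongrLeft]
  refine le_trans ?_ (h1.trans h2)
  rw [mul_assoc]
  exact Nat.mul_le_mul_left _ (hle.trans (Nat.mul_le_mul_left _ (hmin _ hN)))

theorem nc_theorem {V W : Type} [AddCommGroup V] [Module K V] [AddCommGroup W] [Module K W]
    [FiniteDimensional K V] [FiniteDimensional K W] [Infinite K]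
    (𝒜 : Submodule K (V →ₗ[K] W))
    (h : ∀ U : Submodule K V, finrank K U ≤ finrank K (act 𝒜 U)) :
    ∃ (ℓ : Type) (_ : Fintype ℓ) (_ : Nonempty ℓ) (Y : ℓ → ℓ → (V →ₗ[K] W)),
      (∀ i j, Y i j ∈ 𝒜) ∧ Function.Injective (blowMap Y) := by
  obtain ⟨m, hm, X, hX⟩ := exists_tight 𝒜
  obtain ⟨Y, hY, rfl⟩ := hX.1
  exact ⟨ZMod m, inferInstance, inferInstance, Y, hY, tight_inj hX (blow_hyp h _)⟩

end NCthm
end TorsPaper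

namespace TorsPaper
section Idem
open Module

lemma exists_pi (K A : Type) [Field K] [IsAlgClosed K] [Ring A] [Algebra K A] [FiniteDimensional K A] :
    ∃ (n : ℕ) (d : Fin n → ℕ) (_ : ∀ i, NeZero (d i))
      (π : A →ₐ[K] (Π i, Matrix (Fin (d i)) (Fin (d i)) K)),
      Function.Surjective π ∧ ∀ a, π a = 0 ↔ a ∈ Ring.jacobson A := by
  have : IsArtinianRing A := IsArtinianRing.of_finite K A
  have : IsSemisimpleRing (A ⧸ Ring.jacobson A) := inferInstance
  have : FiniteDimensional K (A ⧸ Ring.jacobson A) := inferInstance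
  obtain ⟨n, d, hd, ⟨e⟩⟩ := IsSemisimpleRing.exists_algEquiv_pi_matrix_of_isAlgClosed K (A ⧸ Ring.jacobson A)
  refine ⟨n, d, hd, e.toAlgHom.comp (Ideal.Quotient.mkₐ K (Ring.jacobson A)), ?_, ?_⟩
  · exact e.surjective.comp Ideal.Quotient.mk_surjective
  · intro a
    simp [Ideal.Quotient.eq_zero_iff_mem]

variable (K : Type) {A : Type} [Field K] [Ring A] [Algebra K A] 

/-- `e M` as a `K`-subspace. -/
def eP (e : A) (M : Type) [AddCommGroup M] [Module A M] [Module K M] [IsScalarTower K A M] :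
    Submodule K M := LinearMap.range (Algebra.lsmul K K M e)

lemma mem_eP {e : A} (he : IsIdempotentElem e) {M : Type} [AddCommGroup M] [Module A M] [Module K M]
    [IsScalarTower K A M] (x : M) : x ∈ eP K e M ↔ e • x = x := by
  constructor
  · rintro ⟨y, rfl⟩
    simp [smul_smul, he.eq]
  · intro h
    exact ⟨x, h⟩

lemma finrank_eP_add {e : A} (he : IsIdempotentElem e) {M : Type} [AddCommGroup M] [Module A M] [Module K M]
    [IsScalarTower K A M] [FiniteDimensional K M] (N : Submodule A M) :
    finrank K (eP K e M) = finrank K (eP K e N) + finrank K (eP K e (M ⧸ N)) := by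
  let f : eP K e M →ₗ[K] M ⧸ N := (N.mkQ.restrictScalars K).comp (eP K e M).subtype
  have h := LinearMap.finrank_range_add_finrank_ker f
  have h1 : LinearMap.range f = eP K e (M ⧸ N) := by
    ext y
    constructor
    · rintro ⟨x, rfl⟩
      rw [mem_eP K he]
      have := (mem_eP K he _).1 x.2
      simp only [f, LinearMap.comp_apply, LinearMap.restrictScalars_apply, Submodule.subtype_apply]
      rw [← map_smul, this]
    · rintro ⟨y, rfl⟩
      obtain ⟨x, rfl⟩ := N.mkQ_surjective y
      exact ⟨⟨e • x, ⟨x, rfl⟩⟩, by simp [f]⟩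
  have h2 : finrank K (LinearMap.ker f) = finrank K (eP K e N) := by
    have hN : ∀ x : eP K e M, f x = 0 ↔ (x : M) ∈ N := fun x => by
      simp [f, Submodule.Quotient.mk_eq_zero]
    have hfd : FiniteDimensional K N := FiniteDimensional.finiteDimensional_submodule (N.restrictScalars K)
    apply le_antisymm
    · refine LinearMap.finrank_le_finrank_of_injective (f :=
        { toFun := fun x => ⟨⟨x.1.1, (hN x.1).1 x.2⟩, (mem_eP K he _).2 (Subtype.ext ((mem_eP K he _).1 x.1.2))⟩
          map_add' := fun _ _ => rfl
          map_smul' := fun _ _ => rfl }) ?_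
      intro x y hxy
      have := congrArg (fun t => (t.1.1 : M)) hxy
      exact Subtype.ext (Subtype.ext this)
    · refine LinearMap.finrank_le_finrank_of_injective (f :=
        { toFun := fun x => ⟨⟨x.1.1, (mem_eP K he _).2 (congrArg Subtype.val ((mem_eP K he _).1 x.2))⟩,
            (hN _).2 x.1.2⟩
          map_add' := fun _ _ => rfl
          map_smul' := fun _ _ => rfl }) ?_
      intro x y hxy
      have := congrArg (fun t => (t.1.1 : M)) hxy
      exact Subtype.ext (Subtype.ext this)
  rw [h1, h2] at h
  omega

variable [IsAlgClosed K] [FiniteDimensional K A]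

/-- structure of simple modules -/
lemma exists_idem (K A : Type) [Field K] [IsAlgClosed K] [Ring A] [Algebra K A] [FiniteDimensional K A] :
    ∃ (n : ℕ) (e : Fin n → A) (c : Fin n → A → K), (∀ i, IsIdempotentElem (e i)) ∧
      (∀ (M : Type) [AddCommGroup M] [Module A M] [Module K M] [IsScalarTower K A M] [IsSimpleModule A M],
        (∃ i, ∃ x : M, e i • x = x ∧ x ≠ 0) ∧
        (∀ i j (a : A) (x : M), i ≠ j → e j • a • e i • x = 0) ∧
        (∀ i (a : A) (x : M), e i • a • e i • x = c i a • e i • x)) := by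
  classical
  obtain ⟨n, d, hd, π, hπ, hker⟩ := exists_pi K A
  have : IsArtinianRing A := IsArtinianRing.of_finite K A
  have hnil : ∀ x ∈ RingHom.ker (π : A →+* (Π i, Matrix (Fin (d i)) (Fin (d i)) K)), IsNilpotent x := by
    intro x hx
    have hx' : x ∈ Ring.jacobson A := (hker x).1 hx
    obtain ⟨k, hk⟩ := IsSemiprimaryRing.isNilpotent (R := A)
    refine ⟨k, ?_⟩
    have := Ideal.pow_mem_pow hx' k
    rw [hk] at this
    simpa using this
  let E : (i : Fin n) → (k l : Fin (d i)) → (Π i, Matrix (Fin (d i)) (Fin (d i)) K) :=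
    fun i k l => Pi.single i (Matrix.single k l 1)
  have hE : ∀ i k l m, E i k l * E i l m = E i k m := by
    intro i k l m
    simp only [E, ← Pi.single_mul, Matrix.single_mul_single_same, one_mul]
  have hlift : ∀ i, ∃ e : A, IsIdempotentElem e ∧ π e = E i 0 0 := by
    intro i
    refine exists_isIdempotentElem_eq_of_ker_isNilpotent
      (π : A →+* (Π i, Matrix (Fin (d i)) (Fin (d i)) K)) hnil (E i 0 0) ?_ (hE i 0 0 0)
    obtain ⟨a, ha⟩ := hπ (E i 0 0)
    exact ⟨a, ha⟩
  choose e he heπ using hlift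
  refine ⟨n, e, fun i a => π a i 0 0, he, ?_⟩
  intro M _ _ _ _ _
  have hJ : ∀ a : A, π a = 0 → ∀ x : M, a • x = 0 := by
    intro a ha x
    have := IsSemisimpleModule.jacobson_le_annihilator A M ((hker a).1 ha)
    exact Module.mem_annihilator.1 this x
  have hJ2 : ∀ a b : A, π a = π b → ∀ x : M, a • x = b • x := by
    intro a b hab x
    rw [← sub_eq_zero, ← sub_smul]
    exact hJ _ (by rw [map_sub, hab, sub_self]) x
  refine ⟨?_, ?_, ?_⟩
  · choose s hs using hπ
    have h1 : π (∑ i, ∑ k, s (E i k 0) * e i * s (E i 0 k)) = 1 := by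
      simp only [map_sum, map_mul, hs, heπ, hE]
      have : ∀ i, ∑ k, E i k k = Pi.single i (1 : Matrix (Fin (d i)) (Fin (d i)) K) := by
        intro i
        have h := map_sum (AddMonoidHom.single (fun i => Matrix (Fin (d i)) (Fin (d i)) K) i)
          (fun k => Matrix.single k k (1 : K)) Finset.univ
        simp only [AddMonoidHom.single_apply] at h
        simp only [E]
        rw [← h, Matrix.sum_single_one]
      simp only [this]
      exact Finset.univ_sum_single (1 : Π i, Matrix (Fin (d i)) (Fin (d i)) K)
    have := IsSimpleModule.nontrivial A M
    obtain ⟨x, hx⟩ := exists_ne (0 : M) 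
    by_contra! hcon
    apply hx
    have h2 := hJ2 _ 1 (by rw [h1, map_one]) x
    rw [one_smul] at h2
    rw [← h2, Finset.sum_smul]
    refine Finset.sum_eq_zero fun i _ => ?_
    rw [Finset.sum_smul]
    refine Finset.sum_eq_zero fun k _ => ?_
    rw [mul_smul, mul_smul, hcon i (e i • s (E i 0 k) • x) (by rw [smul_smul, (he i).eq]), smul_zero]
  · intro i j a x hij
    rw [smul_smul, smul_smul]
    apply hJ
    rw [map_mul, map_mul, heπ, heπ]
    funext k
    by_cases hk : k = i
    · subst hk
      simp [E, Pi.single_eq_of_ne hij]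
    · simp [E, Pi.single_eq_of_ne hk]
  · intro i a x
    rw [smul_smul, smul_smul, ← algebraMap_smul A, smul_smul]
    apply hJ2
    simp only [map_mul, heπ, AlgHom.commutes]
    funext k
    by_cases hk : k = i
    · subst hk
      simp only [E, Pi.mul_apply, Pi.single_eq_same, Pi.algebraMap_apply]
      ext r s
      simp [Algebra.algebraMap_eq_smul_one, Matrix.single_apply]
    · simp [E, Pi.single_eq_of_ne hk]

end Idem
end TorsPaper

namespace TorsPaper
section ThetaRep
open Module

lemma theta_zero {A : Type} [Ring A] {θ : ModuleCat.{0} A → ℝ} (hθ : IsStability A θ)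
    (Z : ModuleCat.{0} A) (hZ : ∀ x : Z, x = 0) : θ Z = 0 := by
  have hs : Subsingleton Z := ⟨fun a b => by rw [hZ a, hZ b]⟩
  have hf : Module.Finite A Z := inferInstance
  have := hθ Z Z Z hf hf hf LinearMap.id LinearMap.id Function.injective_id Function.surjective_id
    (by ext x; simp [hZ x])
  linarith

lemma theta_iso {A : Type} [Ring A] {θ : ModuleCat.{0} A → ℝ} (hθ : IsStability A θ)
    (M N : ModuleCat.{0} A) [hM : Module.Finite A M] (e : M ≃ₗ[A] N) : θ M = θ N := by
  have hN : Module.Finite A N := Module.Finite.equiv e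
  have h0 := theta_zero hθ (ModuleCat.of A PUnit) (fun x => rfl)
  have := hθ M N (ModuleCat.of A PUnit) hM hN (inferInstanceAs (Module.Finite A PUnit)) e.toLinearMap
    (0 : N →ₗ[A] PUnit) e.injective (fun x => ⟨0, rfl⟩) (by ext x; simpa using e.surjective x)
  linarith

lemma theta_sub {A : Type} [Ring A] {θ : ModuleCat.{0} A → ℝ} (hθ : IsStability A θ)
    (M : Type) [AddCommGroup M] [Module A M] [Module.Finite A M] (N : Submodule A M) [Module.Finite A N] :
    θ (ModuleCat.of A M) = θ (ModuleCat.of A N) + θ (ModuleCat.of A (M ⧸ N)) := by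
  refine hθ (ModuleCat.of A N) (ModuleCat.of A M) (ModuleCat.of A (M ⧸ N)) (inferInstanceAs (Module.Finite A N))
    (inferInstanceAs (Module.Finite A M)) (inferInstanceAs (Module.Finite A (M ⧸ N))) N.subtype N.mkQ
    N.injective_subtype N.mkQ_surjective ?_
  simp

lemma simple_exists_smul {A M : Type} [Ring A] [AddCommGroup M] [Module A M] [IsSimpleModule A M]
    {x : M} (hx : x ≠ 0) (y : M) : ∃ a : A, a • x = y := by
  have := IsSimpleModule.span_singleton_eq_top A hx
  exact Submodule.mem_span_singleton.1 (this ▸ Submodule.mem_top : y ∈ Submodule.span A {x})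

lemma theta_rep (K A : Type) [Field K] [IsAlgClosed K] [Ring A] [Algebra K A] [FiniteDimensional K A]
    (θ : ModuleCat.{0} A → ℝ) (hθ : IsStability A θ)
    (hint : ∀ M : ModuleCat.{0} A, Module.Finite A M → ∃ k : ℤ, θ M = (k : ℝ)) :
    ∃ (n : ℕ) (e : Fin n → A) (c : Fin n → ℤ), (∀ i, IsIdempotentElem (e i)) ∧
      ∀ (M : Type) [AddCommGroup M] [Module A M] [Module K M] [IsScalarTower K A M] [Module.Finite A M],
        θ (ModuleCat.of A M) = ∑ i, (c i : ℝ) * finrank K (eP K (e i) M) := by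
  classical
  have hArt : IsArtinianRing A := IsArtinianRing.of_finite K A
  obtain ⟨n, e, γ, he, hsimp⟩ := exists_idem K A
  have key : ∀ i, ∃ c : ℤ, ∀ S : ModuleCat.{0} A, IsSimpleModule A S → (∃ x : S, e i • x = x ∧ x ≠ 0) →
      θ S = c := by
    intro i
    by_cases h : ∃ S : ModuleCat.{0} A, IsSimpleModule A S ∧ ∃ x : S, e i • x = x ∧ x ≠ 0
    · obtain ⟨S, hS, x, hx, hx0⟩ := h
      obtain ⟨c, hc⟩ := hint S inferInstance
      refine ⟨c, ?_⟩
      intro S' hS' ⟨x', hx', hx0'⟩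
      have ann : ∀ (M : ModuleCat.{0} A) (hM : IsSimpleModule A M) (x : M) (hx : e i • x = x) (hx0 : x ≠ 0) (a : A),
          a • x = 0 ↔ ∀ b, γ i (b * a) = 0 := by
        intro M hM x hx hx0 a
        let _ : Module K M := Module.compHom M (algebraMap K A)
        have : IsScalarTower K A M := ⟨fun k a m => by
          rw [Algebra.smul_def, mul_smul]; rfl⟩
        have h3 := (hsimp M).2.2 i
        constructor
        · intro ha b
          have := h3 (b * a) x
          rw [hx, mul_smul, ha, smul_zero, smul_zero] at this
          exact (smul_eq_zero.1 this.symm).resolve_right hx0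
        · intro hb
          by_contra ha
          obtain ⟨b, hb'⟩ := simple_exists_smul (A := A) ha x
          have := h3 (b * a) x
          rw [hx, mul_smul, hb', hb, zero_smul, hx] at this
          exact hx0 this
      rw [← hc]
      have e1 := LinearMap.quotKerEquivOfSurjective (LinearMap.toSpanSingleton A S x)
        (fun y => simple_exists_smul (A := A) hx0 y)
      have e2 := LinearMap.quotKerEquivOfSurjective (LinearMap.toSpanSingleton A S' x')
        (fun y => simple_exists_smul (A := A) hx0' y)
      have e3 : LinearMap.ker (LinearMap.toSpanSingleton A S' x') = LinearMap.ker (LinearMap.toSpanSingleton A S x) := by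
        ext a
        simp only [LinearMap.mem_ker, LinearMap.toSpanSingleton_apply]
        rw [ann S hS x hx hx0, ann S' hS' x' hx' hx0']
      exact theta_iso hθ S' S (e2.symm.trans ((Submodule.quotEquivOfEq _ _ e3).trans e1))
    · exact ⟨0, fun S hS hx => absurd ⟨S, hS, hx⟩ h⟩
  choose c hc using key
  refine ⟨n, e, c, he, ?_⟩
  have simple_case : ∀ (M : Type) [AddCommGroup M] [Module A M] [Module K M] [IsScalarTower K A M]
      [IsSimpleModule A M], θ (ModuleCat.of A M) = ∑ i, (c i : ℝ) * finrank K (eP K (e i) M) := by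
    intro M _ _ _ _ hM
    obtain ⟨⟨i, x, hx, hx0⟩, h2, h3⟩ := hsimp M
    rw [Finset.sum_eq_single i]
    · have h1 : finrank K (eP K (e i) M) = 1 := by
        refine finrank_eq_one ⟨x, (mem_eP K (he i) x).2 hx⟩ (fun h => hx0 (congrArg Subtype.val h)) ?_
        rintro ⟨y, hy⟩
        rw [mem_eP K (he i)] at hy
        obtain ⟨a, rfl⟩ := simple_exists_smul (A := A) hx0 y
        refine ⟨γ i a, Subtype.ext ?_⟩
        have := h3 i a x
        rw [hx] at this
        exact (this.symm.trans hy)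
      rw [h1, hc i (ModuleCat.of A M) hM ⟨x, hx, hx0⟩]
      simp
    · intro j _ hji
      have h1 : eP K (e j) M = ⊥ := by
        rw [eq_bot_iff]
        intro y hy
        rw [mem_eP K (he j)] at hy
        obtain ⟨a, rfl⟩ := simple_exists_smul (A := A) hx0 y
        have := h2 i j a x (Ne.symm hji)
        rw [hx, hy] at this
        simpa using this
      rw [h1]; simp
    · simp
  have main : ∀ (d : ℕ) (M : Type) [AddCommGroup M] [Module A M] [Module K M] [IsScalarTower K A M]
      [Module.Finite A M], finrank K M = d → 
      θ (ModuleCat.of A M) = ∑ i, (c i : ℝ) * finrank K (eP K (e i) M) := by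
    intro d
    induction d using Nat.strong_induction_on with
    | _ d ih =>
      intro M _ _ _ _ _ hd
      have hfd : FiniteDimensional K M := Module.Finite.trans A M
      rcases subsingleton_or_nontrivial M with hs | hs
      · rw [theta_zero hθ _ (fun x => Subsingleton.elim (α := M) x 0)]
        symm
        refine Finset.sum_eq_zero fun i _ => ?_
        rw [finrank_zero_of_subsingleton]; simp
      · obtain ⟨N, hN, -⟩ := (eq_bot_or_exists_atom_le (⊤ : Submodule A M)).resolve_left top_ne_bot
        have hNs : IsSimpleModule A N := isSimpleModule_iff_isAtom.2 hN
        have hlt : finrank K (M ⧸ N) < d := by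
          have h1 : finrank K (M ⧸ N.restrictScalars K) + finrank K (N.restrictScalars K) = finrank K M :=
            Submodule.finrank_quotient_add_finrank _
          have h2 : 0 < finrank K (N.restrictScalars K) := by
            have := IsSimpleModule.nontrivial A N
            have : Nontrivial (N.restrictScalars K) := this
            exact finrank_pos
          have h3 : finrank K (M ⧸ N) = finrank K (M ⧸ N.restrictScalars K) := rfl
          omega
        rw [theta_sub hθ M N, simple_case N, ih _ hlt (M ⧸ N) rfl, ← Finset.sum_add_distrib]
        refine Finset.sum_congr rfl fun i _ => ?_
        rw [finrank_eP_add K (he i) N]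
        push_cast
        ring
  intro M _ _ _ _ _
  exact main _ M rfl

lemma theta_rep' (K A : Type) [Field K] [IsAlgClosed K] [Ring A] [Algebra K A] [FiniteDimensional K A]
    (θ : ModuleCat.{0} A → ℝ) (hθ : IsStability A θ)
    (hint : ∀ M : ModuleCat.{0} A, Module.Finite A M → ∃ k : ℤ, θ M = (k : ℝ)) :
    ∃ (I0 I1 : Type) (_ : Fintype I0) (_ : Fintype I1) (ε0 : I0 → A) (ε1 : I1 → A),
      (∀ j, IsIdempotentElem (ε0 j)) ∧ (∀ i, IsIdempotentElem (ε1 i)) ∧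
      ∀ (M : Type) [AddCommGroup M] [Module A M] [Module K M] [IsScalarTower K A M] [Module.Finite A M],
        θ (ModuleCat.of A M) = (∑ j, finrank K (eP K (ε0 j) M) : ℕ) - (∑ i, finrank K (eP K (ε1 i) M) : ℕ) := by
  obtain ⟨n, e, c, he, h⟩ := theta_rep K A θ hθ hint
  refine ⟨Σ i, Fin (c i).toNat, Σ i, Fin (-c i).toNat, inferInstance, inferInstance, fun j => e j.1,
    fun j => e j.1, fun j => he _, fun j => he _, ?_⟩
  intro M _ _ _ _ _
  have aux : ∀ (m : Fin n → ℕ) (g : Fin n → ℕ),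
      (∑ j : (Σ i, Fin (m i)), g j.1) = ∑ i, m i * g i := by
    intro m g
    rw [Fintype.sum_sigma]
    simp
  rw [h M, aux _ (fun i => finrank K (eP K (e i) M)), aux _ (fun i => finrank K (eP K (e i) M))]
  push_cast
  rw [← Finset.sum_sub_distrib]
  refine Finset.sum_congr rfl fun i _ => ?_
  rw [← sub_mul]
  congr 1
  have := Int.toNat_sub_toNat_neg (c i)
  exact_mod_cast this.symm

end ThetaRep
end TorsPaper

namespace TorsPaper
section Pres
open Module

/-- the `K`-linear map induced by a matrix over `A`. -/
noncomputable def phi (K : Type) {A : Type} [Field K] [Ring A] [Algebra K A] {J0 J1 : Type} [Fintype J0]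
    (ε0 : J0 → A) (ε1 : J1 → A) (f : J1 → J0 → A)
    (M : Type) [AddCommGroup M] [Module A M] [Module K M] [IsScalarTower K A M] :
    (Π j, eP K (ε0 j) M) →ₗ[K] (Π i, eP K (ε1 i) M) where
  toFun v i := ⟨ε1 i • ∑ j, f i j • (v j : M), ⟨_, rfl⟩⟩
  map_add' v w := by
    ext i
    simp [Finset.sum_add_distrib, smul_add]
  map_smul' c v := by
    ext i
    simp only [Pi.smul_apply, Submodule.coe_smul, RingHom.id_apply]
    have : ∀ (a : A) (x : M), a • c • x = c • a • x := fun a x => ((Algebra.lsmul K K M a).map_smul c x)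
    simp only [this, ← Finset.smul_sum]

lemma phi_apply (K : Type) {A : Type} [Field K] [Ring A] [Algebra K A] {J0 J1 : Type} [Fintype J0]
    (ε0 : J0 → A) (ε1 : J1 → A) (f : J1 → J0 → A)
    (M : Type) [AddCommGroup M] [Module A M] [Module K M] [IsScalarTower K A M] (v) (i) :
    (phi K ε0 ε1 f M v i : M) = ε1 i • ∑ j, f i j • (v j : M) := rfl

lemma smul_comm_KA {K A : Type} [Field K] [Ring A] [Algebra K A]
    {M : Type} [AddCommGroup M] [Module A M] [Module K M] [IsScalarTower K A M] (c : K) (a : A) (x : M) :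
    a • c • x = c • a • x := ((Algebra.lsmul K K M a).map_smul c x)

/-- phi is linear in the matrix -/
noncomputable def phiL (K : Type) {A : Type} [Field K] [Ring A] [Algebra K A] {J0 J1 : Type} [Fintype J0]
    (ε0 : J0 → A) (ε1 : J1 → A)
    (M : Type) [AddCommGroup M] [Module A M] [Module K M] [IsScalarTower K A M] :
    (J1 → J0 → A) →ₗ[K] ((Π j, eP K (ε0 j) M) →ₗ[K] (Π i, eP K (ε1 i) M)) where
  toFun f := phi K ε0 ε1 f M
  map_add' f g := by
    ext v i
    simp [phi_apply, add_smul, Finset.sum_add_distrib, smul_add]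
  map_smul' c f := by
    ext v i
    simp only [phi_apply, Pi.smul_apply, smul_assoc, ← Finset.smul_sum, smul_comm_KA, RingHom.id_apply,
      LinearMap.smul_apply, Submodule.coe_smul]

lemma phi_single (K : Type) {A : Type} [Field K] [Ring A] [Algebra K A] {J0 J1 : Type} [Fintype J0]
    [DecidableEq J0] [DecidableEq J1]
    (ε0 : J0 → A) (ε1 : J1 → A)
    (M : Type) [AddCommGroup M] [Module A M] [Module K M] [IsScalarTower K A M] (i : J1) (j : J0) (a : A) (v) :
    phi K ε0 ε1 (Pi.single i (Pi.single j a)) M v = Pi.single i ⟨ε1 i • a • (v j : M), ⟨_, rfl⟩⟩ := by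
  ext k
  rw [phi_apply]
  by_cases hk : k = i
  · subst hk
    simp only [Pi.single_eq_same]
    rw [Finset.sum_eq_single j]
    · simp
    · intro l _ hl
      simp [Pi.single_eq_of_ne hl]
    · simp
  · simp [Pi.single_eq_of_ne hk]

/-- reindexing -/
lemma exists_size_inj (K : Type) {A : Type} [Field K] [Ring A] [Algebra K A] {I0 I1 : Type} [Fintype I0] [Fintype I1]
    [DecidableEq I0] [DecidableEq I1] [Infinite K]
    (ε0 : I0 → A) (ε1 : I1 → A) (h0 : ∀ j, IsIdempotentElem (ε0 j)) (h1 : ∀ i, IsIdempotentElem (ε1 i))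
    (N : Type) [AddCommGroup N] [Module A N] [Module K N] [IsScalarTower K A N] [FiniteDimensional K N]
    (h : ∀ L : Submodule A N, ∑ j, finrank K (eP K (ε0 j) L) ≤ ∑ i, finrank K (eP K (ε1 i) L)) :
    ∃ (ℓ : Type) (_ : Fintype ℓ) (_ : Nonempty ℓ) (f : I1 × ℓ → I0 × ℓ → A),
      Function.Injective (phi K (fun j : I0 × ℓ => ε0 j.1) (fun i : I1 × ℓ => ε1 i.1) f N) := by
  have hN : ∀ L : Submodule A N, FiniteDimensional K L := fun L =>
    FiniteDimensional.finiteDimensional_submodule (L.restrictScalars K)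
  obtain ⟨ℓ, i1, i2, Y, hY, hinj⟩ := nc_theorem (LinearMap.range (phiL K ε0 ε1 N)) (by
    intro U
    let L : Submodule A N := Submodule.span A {x | ∃ u ∈ U, ∃ j, x = (u j : N)}
    have hL : ∀ x ∈ L, ∀ (i : I1) (a : A), (Pi.single i ⟨ε1 i • a • x, ⟨_, rfl⟩⟩ : Π i, eP K (ε1 i) N) ∈
        act (LinearMap.range (phiL K ε0 ε1 N)) U := by
      intro x hx i
      induction hx using Submodule.span_induction with
      | mem x hx =>
        intro a
        obtain ⟨u, hu, j, rfl⟩ := hx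
        rw [← phi_single K ε0 ε1 N i j a u]
        exact Submodule.subset_span ⟨_, ⟨_, rfl⟩, u, hu, rfl⟩
      | zero => 
        intro a
        convert Submodule.zero_mem _
        ext k
        by_cases hk : k = i
        · subst hk; simp
        · simp [Pi.single_eq_of_ne hk]
      | add x y _ _ hx hy =>
        intro a
        convert Submodule.add_mem _ (hx a) (hy a) using 1
        rw [← Pi.single_add]
        congr 1
        ext
        simp
      | smul b x _ hx =>
        intro a
        convert hx (a * b) using 3
        rw [smul_smul a b]
    let g0 : U →ₗ[K] (Π j, eP K (ε0 j) L) :=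
      { toFun := fun u j => ⟨⟨u.1 j, Submodule.subset_span ⟨u.1, u.2, j, rfl⟩⟩,
          (mem_eP K (h0 j) _).2 (Subtype.ext ((mem_eP K (h0 j) _).1 (u.1 j).2))⟩
        map_add' := fun _ _ => rfl
        map_smul' := fun _ _ => rfl }
    have hg0 : Function.Injective g0 := by
      intro x y hxy
      ext j
      have := congrFun hxy j
      exact congrArg (fun t => (t.1.1 : N)) this
    let g1 : (Π i, eP K (ε1 i) L) →ₗ[K] act (LinearMap.range (phiL K ε0 ε1 N)) U :=
      { toFun := fun w => ⟨fun i => ⟨(w i).1.1, (mem_eP K (h1 i) _).2 (congrArg Subtype.val ((mem_eP K (h1 i) _).1 (w i).2))⟩, by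
          have : ∀ z : Π i, eP K (ε1 i) N, (∀ i, (Pi.single i (z i) : Π i, eP K (ε1 i) N) ∈ 
            act (LinearMap.range (phiL K ε0 ε1 N)) U) → z ∈ act (LinearMap.range (phiL K ε0 ε1 N)) U := by
            intro z hz
            rw [← Finset.univ_sum_single z]
            exact Submodule.sum_mem _ fun i _ => hz i
          apply this
          intro i
          convert hL (w i).1.1 (w i).1.2 i 1 using 3
          rw [one_smul]
          exact Subtype.ext (congrArg Subtype.val ((mem_eP K (h1 i) _).1 (w i).2)).symm⟩
        map_add' := fun _ _ => rfl
        map_smul' := fun _ _ => rfl }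
    have hg1 : Function.Injective g1 := by
      intro x y hxy
      ext i
      have := congrFun (congrArg Subtype.val hxy) i
      exact congrArg (fun t => (t.1 : N)) this
    have e0 := LinearMap.finrank_le_finrank_of_injective hg0
    have e1 := LinearMap.finrank_le_finrank_of_injective hg1
    rw [finrank_pi_fintype] at e0 e1
    exact e0.trans ((h L).trans e1))
  choose f hf using hY
  refine ⟨ℓ, i1, i2, fun x y => f x.2 y.2 x.1 y.1, ?_⟩
  rw [← LinearMap.ker_eq_bot, LinearMap.ker_eq_bot'] at hinj ⊢
  intro v hv
  have := hinj (fun k j => v (j, k)) (by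
    ext k i
    have := congrArg Subtype.val (congrFun hv (i, k))
    rw [phi_apply] at this
    rw [blowMap_apply]
    simp only [← hf, Finset.sum_apply, AddSubmonoidClass.coe_finsetSum]
    simp only [phiL, LinearMap.coe_mk, AddHom.coe_mk, phi_apply]
    rw [← Finset.smul_sum]
    rw [Fintype.sum_prod_type, Finset.sum_comm] at this
    exact this)
  ext ⟨j, k⟩
  exact congrArg Subtype.val (congrFun (congrFun this k) j)

lemma exists_size_surj (K : Type) {A : Type} [Field K] [Ring A] [Algebra K A] {I0 I1 : Type} [Fintype I0] [Fintype I1]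
    [DecidableEq I0] [DecidableEq I1] [Infinite K]
    (ε0 : I0 → A) (ε1 : I1 → A) (h0 : ∀ j, IsIdempotentElem (ε0 j)) (h1 : ∀ i, IsIdempotentElem (ε1 i))
    (N : Type) [AddCommGroup N] [Module A N] [Module K N] [IsScalarTower K A N] [FiniteDimensional K N]
    (h : ∀ L : Submodule A N, ∑ i, finrank K (eP K (ε1 i) (N ⧸ L)) ≤ ∑ j, finrank K (eP K (ε0 j) (N ⧸ L))) :
    ∃ (ℓ : Type) (_ : Fintype ℓ) (_ : Nonempty ℓ) (f : I1 × ℓ → I0 × ℓ → A),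
      Function.Surjective (phi K (fun j : I0 × ℓ => ε0 j.1) (fun i : I1 × ℓ => ε1 i.1) f N) := by
  have hN : ∀ L : Submodule A N, FiniteDimensional K L := fun L =>
    FiniteDimensional.finiteDimensional_submodule (L.restrictScalars K)
  let 𝒜 : Submodule K (Dual K (Π i, eP K (ε1 i) N) →ₗ[K] Dual K (Π j, eP K (ε0 j) N)) :=
    (LinearMap.range (phiL K ε0 ε1 N)).map (Dual.transpose (R := K))
  have h𝒜 : ∀ f, (phi K ε0 ε1 f N).dualMap ∈ 𝒜 := fun f => ⟨phiL K ε0 ε1 N f, ⟨f, rfl⟩, rfl⟩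
  obtain ⟨ℓ, i1, i2, Y, hY, hinj⟩ := nc_theorem 𝒜 (by
    intro Z
    let L : Submodule A N :=
      { carrier := {m | ∀ i (a : A), ∀ ζ ∈ Z, ζ (Pi.single i ⟨ε1 i • a • m, ⟨_, rfl⟩⟩) = 0}
        zero_mem' := by
          intro i a ζ _
          convert map_zero ζ
          ext k
          by_cases hk : k = i
          · subst hk; simp
          · simp [Pi.single_eq_of_ne hk]
        add_mem' := by
          intro x y hx hy i a ζ hζ
          convert congrArg₂ (· + ·) (hx i a ζ hζ) (hy i a ζ hζ)
          · rw [← map_add, ← Pi.single_add]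
            congr 2
            ext
            simp
          · simp
        smul_mem' := by
          intro b x hx i a ζ hζ
          convert hx i (a * b) ζ hζ using 4
          rw [smul_smul a b] }
    let U : Submodule K (Π j, eP K (ε0 j) N) := (act 𝒜 Z).dualCoannihilator
    let g0 : U →ₗ[K] (Π j, eP K (ε0 j) L) :=
      { toFun := fun u j => ⟨⟨u.1 j, by
          intro i a ζ hζ
          have h2 := (Submodule.mem_dualCoannihilator _).1 u.2 ((phi K ε0 ε1 (Pi.single i (Pi.single j a)) N).dualMap ζ)
            (Submodule.subset_span ⟨_, h𝒜 _, ζ, hζ, rfl⟩)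
          rw [LinearMap.dualMap_apply, phi_single] at h2
          exact h2⟩,
          (mem_eP K (h0 j) _).2 (Subtype.ext ((mem_eP K (h0 j) _).1 (u.1 j).2))⟩
        map_add' := fun _ _ => rfl
        map_smul' := fun _ _ => rfl }
    have hg0 : Function.Injective g0 := by
      intro x y hxy
      ext j
      have := congrFun hxy j
      exact congrArg (fun t => (t.1.1 : N)) this
    let g1 : (Π i, eP K (ε1 i) L) →ₗ[K] Z.dualCoannihilator :=
      { toFun := fun w => ⟨fun i => ⟨(w i).1.1, (mem_eP K (h1 i) _).2 (congrArg Subtype.val ((mem_eP K (h1 i) _).1 (w i).2))⟩, by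
          have : ∀ z : Π i, eP K (ε1 i) N, (∀ i, (Pi.single i (z i) : Π i, eP K (ε1 i) N) ∈ 
            Z.dualCoannihilator) → z ∈ Z.dualCoannihilator := by
            intro z hz
            rw [← Finset.univ_sum_single z]
            exact Submodule.sum_mem _ fun i _ => hz i
          apply this
          intro i
          rw [Submodule.mem_dualCoannihilator]
          intro ζ hζ
          convert (w i).1.2 i 1 ζ hζ using 3
          rw [one_smul]
          exact Subtype.ext (congrArg Subtype.val ((mem_eP K (h1 i) _).1 (w i).2)).symm⟩
        map_add' := fun _ _ => rfl
        map_smul' := fun _ _ => rfl }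
    have hg1 : Function.Injective g1 := by
      intro x y hxy
      ext i
      have := congrFun (congrArg Subtype.val hxy) i
      exact congrArg (fun t => (t.1 : N)) this
    have e0 := LinearMap.finrank_le_finrank_of_injective hg0
    have e1 := LinearMap.finrank_le_finrank_of_injective hg1
    have e2 := Subspace.finrank_add_finrank_dualCoannihilator_eq Z
    have e3 := Subspace.finrank_add_finrank_dualCoannihilator_eq (act 𝒜 Z)
    rw [finrank_pi_fintype] at e0 e1 e2 e3
    have e4 := h L
    have e5 : ∑ j, finrank K (eP K (ε0 j) N) = ∑ j, finrank K (eP K (ε0 j) L) + ∑ j, finrank K (eP K (ε0 j) (N ⧸ L)) := by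
      rw [← Finset.sum_add_distrib]
      exact Finset.sum_congr rfl fun j _ => finrank_eP_add K (h0 j) L
    have e6 : ∑ j, finrank K (eP K (ε1 j) N) = ∑ j, finrank K (eP K (ε1 j) L) + ∑ j, finrank K (eP K (ε1 j) (N ⧸ L)) := by
      rw [← Finset.sum_add_distrib]
      exact Finset.sum_congr rfl fun j _ => finrank_eP_add K (h1 j) L
    change finrank K U ≤ _ at e0
    change _ + finrank K U = _ at e3
    omega)
  have hY' : ∀ i j, ∃ f, Y i j = (phi K ε0 ε1 f N).dualMap := by
    intro i j
    obtain ⟨_, ⟨f, rfl⟩, hf⟩ := hY i j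
    exact ⟨f, hf.symm⟩
  choose f hf using hY'
  refine ⟨ℓ, i1, i2, fun x y => f y.2 x.2 x.1 y.1, ?_⟩
  rw [← LinearMap.range_eq_top]
  by_contra hne
  obtain ⟨ζ, hζ0, hζ⟩ := Submodule.exists_le_ker_of_lt_top _ (lt_top_iff_ne_top.2 hne)
  have hζ' : ∀ v, ζ (phi K (fun j : I0 × ℓ => ε0 j.1) (fun i : I1 × ℓ => ε1 i.1) (fun x y => f y.2 x.2 x.1 y.1) N v) = 0 :=
    fun v => hζ ⟨v, rfl⟩
  classical
  -- the components of ζ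
  let inc : (k : ℓ) → (Π i, eP K (ε1 i) N) →ₗ[K] (Π i : I1 × ℓ, eP K (ε1 i.1) N) := fun k =>
    LinearMap.pi fun i => if i.2 = k then LinearMap.proj i.1 else 0
  have hsum : ∀ w, ∑ k, inc k (fun i => w (i, k)) = w := by
    intro w
    ext ⟨i, k⟩
    rw [Finset.sum_apply]
    congr 1
    rw [Finset.sum_eq_single k]
    · simp [inc]
    · intro k' _ hk'
      simp [inc, Ne.symm hk']
    · simp
  let Z : ℓ → Dual K (Π i, eP K (ε1 i) N) := fun k => ζ.comp (inc k)
  have hZ : Z = 0 := by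
    apply hinj
    rw [map_zero]
    refine funext fun k => LinearMap.ext fun v => ?_
    rw [blowMap_apply]
    simp only [hf, LinearMap.coe_sum, Finset.sum_apply, LinearMap.dualMap_apply, Pi.zero_apply, LinearMap.zero_apply, Z,
      LinearMap.comp_apply]
    rw [← map_sum]
    rw [← hζ' (fun x => if x.2 = k then v x.1 else 0)]
    congr 1
    rw [← hsum (phi K _ _ _ N _)]
    refine Finset.sum_congr rfl fun k' _ => ?_
    congr 1
    ext i
    rw [phi_apply, phi_apply, Fintype.sum_prod_type]
    congr 1
    refine Finset.sum_congr rfl fun j _ => ?_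
    rw [Finset.sum_eq_single k]
    · simp
    · intro k' _ hk'
      simp [hk']
    · simp
  apply hζ0
  refine LinearMap.ext fun w => ?_
  rw [← hsum w, map_sum, LinearMap.zero_apply]
  refine Finset.sum_eq_zero fun k _ => ?_
  have := congrFun hZ k
  exact congrArg (fun t => t (fun i => w (i, k))) this

end Pres
end TorsPaper

namespace TorsPaper
section Common
open Module

/-- `Hom(f,M)` is surjective -/
def IsS {A : Type} [Ring A] {J0 J1 : Type} [Fintype J0] (ε1 : J1 → A) (f : J1 → J0 → A)
    (M : Type) [AddCommGroup M] [Module A M] : Prop :=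
  ∀ w : J1 → M, ∃ v : J0 → M, ∀ i, ε1 i • w i = ∑ j, f i j • v j

/-- `Hom(f,M)` is injective -/
def IsI {A : Type} [Ring A] {J0 J1 : Type} [Fintype J0] (ε0 : J0 → A) (f : J1 → J0 → A)
    (M : Type) [AddCommGroup M] [Module A M] : Prop :=
  ∀ v : J0 → M, (∀ i, ∑ j, f i j • v j = 0) → ∀ j, ε0 j • v j = 0

/-- the matrix `f` has entries in the right corners -/
structure PF {A : Type} [Ring A] {J0 J1 : Type} (ε0 : J0 → A) (ε1 : J1 → A) (f : J1 → J0 → A) : Prop where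
  i0 : ∀ j, IsIdempotentElem (ε0 j)
  i1 : ∀ i, IsIdempotentElem (ε1 i)
  l : ∀ i j, ε1 i * f i j = f i j
  r : ∀ i j, f i j * ε0 j = f i j

variable {K A : Type} [Field K] [Ring A] [Algebra K A]

lemma isS_of_surj {J0 J1 : Type} [Fintype J0] {ε0 : J0 → A} {ε1 : J1 → A} {f : J1 → J0 → A}
    (hf : PF ε0 ε1 f) {M : Type} [AddCommGroup M] [Module A M] [Module K M] [IsScalarTower K A M] :
    IsS ε1 f M ↔ Function.Surjective (phi K ε0 ε1 f M) := by
  constructor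
  · intro h w
    obtain ⟨v, hv⟩ := h (fun i => w i)
    refine ⟨fun j => ⟨ε0 j • v j, ⟨_, rfl⟩⟩, ?_⟩
    ext i
    rw [phi_apply]
    simp only [smul_smul, hf.r, Finset.smul_sum, hf.l]
    rw [← hv i]
    exact (mem_eP K (hf.i1 i) _).1 (w i).2
  · intro h w
    obtain ⟨v, hv⟩ := h (fun i => ⟨ε1 i • w i, ⟨_, rfl⟩⟩)
    refine ⟨fun j => v j, fun i => ?_⟩
    have := congrArg Subtype.val (congrFun hv i)
    rw [phi_apply] at this
    simp only [Finset.smul_sum, smul_smul, hf.l] at this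
    exact this.symm

lemma isI_of_inj {J0 J1 : Type} [Fintype J0] {ε0 : J0 → A} {ε1 : J1 → A} {f : J1 → J0 → A}
    (hf : PF ε0 ε1 f) {M : Type} [AddCommGroup M] [Module A M] [Module K M] [IsScalarTower K A M] :
    IsI ε0 f M ↔ Function.Injective (phi K ε0 ε1 f M) := by
  rw [← LinearMap.ker_eq_bot, LinearMap.ker_eq_bot']
  constructor
  · intro h v hv
    have := h (fun j => v j) (fun i => by
      have := congrArg Subtype.val (congrFun hv i)
      rw [phi_apply] at this
      simp only [Finset.smul_sum, smul_smul, hf.l] at this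
      exact this)
    ext j
    rw [← (mem_eP K (hf.i0 j) _).1 (v j).2, this j]
    rfl
  · intro h v hv j
    have := h (fun j => ⟨ε0 j • v j, ⟨_, rfl⟩⟩) (by
      ext i
      rw [phi_apply]
      simp only [smul_smul, hf.r, Finset.smul_sum, hf.l]
      exact hv i)
    exact congrArg Subtype.val (congrFun this j)

lemma phi_norm {J0 J1 : Type} [Fintype J0] {ε0 : J0 → A} {ε1 : J1 → A} (f : J1 → J0 → A)
    (h0 : ∀ j, IsIdempotentElem (ε0 j)) (h1 : ∀ i, IsIdempotentElem (ε1 i))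
    (M : Type) [AddCommGroup M] [Module A M] [Module K M] [IsScalarTower K A M] :
    phi K ε0 ε1 (fun i j => ε1 i * f i j * ε0 j) M = phi K ε0 ε1 f M := by
  refine LinearMap.ext fun v => funext fun i => Subtype.ext ?_
  rw [phi_apply, phi_apply]
  simp only [Finset.smul_sum]
  refine Finset.sum_congr rfl fun j _ => ?_
  have := (mem_eP K (h0 j) _).1 (v j).2
  rw [mul_smul, this, smul_smul, ← mul_assoc, (h1 i).eq, mul_smul]

lemma pf_norm {J0 J1 : Type} {ε0 : J0 → A} {ε1 : J1 → A} (f : J1 → J0 → A)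
    (h0 : ∀ j, IsIdempotentElem (ε0 j)) (h1 : ∀ i, IsIdempotentElem (ε1 i)) :
    PF ε0 ε1 (fun i j => ε1 i * f i j * ε0 j) :=
  ⟨h0, h1, fun i j => by rw [← mul_assoc, ← mul_assoc, (h1 i).eq], fun i j => by rw [mul_assoc, (h0 j).eq]⟩

/-- enlargement of a matrix -/
def enl {I0 I1 ℓ ℓ' κ : Type} [DecidableEq κ] (σ : ℓ' ≃ ℓ × κ) (f : I1 × ℓ → I0 × ℓ → A) :
    I1 × ℓ' → I0 × ℓ' → A :=
  fun x y => if (σ x.2).2 = (σ y.2).2 then f (x.1, (σ x.2).1) (y.1, (σ y.2).1) else 0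

lemma phi_enl {I0 I1 ℓ ℓ' κ : Type} [Fintype I0] [Fintype ℓ] [Fintype ℓ'] [Fintype κ] [DecidableEq κ]
    (ε0 : I0 → A) (ε1 : I1 → A) (σ : ℓ' ≃ ℓ × κ) (f : I1 × ℓ → I0 × ℓ → A)
    (M : Type) [AddCommGroup M] [Module A M] [Module K M] [IsScalarTower K A M] (v) (x : I1 × ℓ') :
    phi K (fun j : I0 × ℓ' => ε0 j.1) (fun i : I1 × ℓ' => ε1 i.1) (enl σ f) M v x =
      phi K (fun j : I0 × ℓ => ε0 j.1) (fun i : I1 × ℓ => ε1 i.1) f M (fun z => v (z.1, σ.symm (z.2, (σ x.2).2)))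
        (x.1, (σ x.2).1) := by
  ext
  rw [phi_apply, phi_apply]
  congr 1
  rw [Fintype.sum_prod_type, Fintype.sum_prod_type]
  refine Finset.sum_congr rfl fun j _ => ?_
  rw [← Equiv.sum_comp σ.symm, Fintype.sum_prod_type]
  refine Finset.sum_congr rfl fun k _ => ?_
  rw [Finset.sum_eq_single (σ x.2).2]
  · simp [enl]
  · intro m _ hm
    simp [enl, Ne.symm hm]
  · simp

lemma surj_enl {I0 I1 ℓ ℓ' κ : Type} [Fintype I0] [Fintype ℓ] [Fintype ℓ'] [Fintype κ] [DecidableEq κ]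
    (ε0 : I0 → A) (ε1 : I1 → A) (σ : ℓ' ≃ ℓ × κ) (f : I1 × ℓ → I0 × ℓ → A)
    (M : Type) [AddCommGroup M] [Module A M] [Module K M] [IsScalarTower K A M]
    (h : Function.Surjective (phi K (fun j : I0 × ℓ => ε0 j.1) (fun i : I1 × ℓ => ε1 i.1) f M)) :
    Function.Surjective (phi K (fun j : I0 × ℓ' => ε0 j.1) (fun i : I1 × ℓ' => ε1 i.1) (enl σ f) M) := by
  intro w
  choose v hv using fun m : κ => h (fun z => w (z.1, σ.symm (z.2, m)))
  refine ⟨fun y => v (σ y.2).2 (y.1, (σ y.2).1), ?_⟩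
  refine funext fun x => ?_
  rw [phi_enl]
  have := congrArg Subtype.val (congrFun (hv (σ x.2).2) (x.1, (σ x.2).1))
  refine Subtype.ext ?_
  have hw : ∀ x y, x = y → (w x : M) = (w y : M) := by rintro _ _ rfl; rfl
  have hv' : ∀ m m' x y, m = m' → x = y → (v m x : M) = (v m' y : M) := by rintro _ _ _ _ rfl rfl; rfl
  rw [← hw (x.1, σ.symm ((σ x.2).1, (σ x.2).2)) x (by simp)]
  rw [← this, phi_apply, phi_apply]
  congr 1
  refine Finset.sum_congr rfl fun z _ => ?_
  congr 1
  apply hv'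
  · simp
  · simp

lemma inj_enl {I0 I1 ℓ ℓ' κ : Type} [Fintype I0] [Fintype ℓ] [Fintype ℓ'] [Fintype κ] [DecidableEq κ]
    (ε0 : I0 → A) (ε1 : I1 → A) (σ : ℓ' ≃ ℓ × κ) (f : I1 × ℓ → I0 × ℓ → A)
    (M : Type) [AddCommGroup M] [Module A M] [Module K M] [IsScalarTower K A M]
    (h : Function.Injective (phi K (fun j : I0 × ℓ => ε0 j.1) (fun i : I1 × ℓ => ε1 i.1) f M)) :
    Function.Injective (phi K (fun j : I0 × ℓ' => ε0 j.1) (fun i : I1 × ℓ' => ε1 i.1) (enl σ f) M) := by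
  rw [← LinearMap.ker_eq_bot, LinearMap.ker_eq_bot'] at h ⊢
  intro v hv
  have hv' : ∀ x y, x = y → (v x : M) = (v y : M) := by rintro _ _ rfl; rfl
  refine funext fun y => ?_
  have := h (fun z => v (z.1, σ.symm (z.2, (σ y.2).2))) (by
    refine funext fun x => ?_
    have := congrFun hv (x.1, σ.symm (x.2, (σ y.2).2))
    rw [phi_enl] at this
    have := congrArg Subtype.val this
    refine Subtype.ext ?_
    rw [phi_apply] at this ⊢
    refine Eq.trans ?_ this
    congr 1
    refine Finset.sum_congr rfl fun z _ => ?_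
    congr 1
    · simp
    · apply hv'
      simp)
  have := congrArg Subtype.val (congrFun this (y.1, (σ y.2).1))
  refine Subtype.ext (Eq.trans (hv' _ _ ?_) this)
  simp

lemma generic_surj {V W : Type} [AddCommGroup V] [Module K V] [AddCommGroup W] [Module K W] [FiniteDimensional K W]
    (X Y : V →ₗ[K] W) (hX : Function.Surjective X) :
    {s : K | s ≠ 0 ∧ ¬ Function.Surjective (X + s⁻¹ • Y)}.Finite := by
  obtain ⟨r, hr⟩ := X.exists_rightInverse_of_surjective (LinearMap.range_eq_top.2 hX)
  refine ((Module.End.finite_hasEigenvalue (Y.comp r)).image (fun t => -t)).subset ?_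
  rintro s ⟨hs, hns⟩
  refine ⟨-s, ?_, neg_neg s⟩
  by_contra hev
  apply hns
  have hinj : Function.Injective ((X + s⁻¹ • Y).comp r) := by
    rw [← LinearMap.ker_eq_bot, LinearMap.ker_eq_bot']
    intro w hw
    by_contra hw0
    apply hev
    refine Module.End.hasEigenvalue_of_hasEigenvector (x := w) ⟨?_, hw0⟩
    rw [Module.End.mem_eigenspace_iff]
    have h1 : X (r w) = w := congrArg (fun t => t w) hr
    simp only [LinearMap.comp_apply, LinearMap.add_apply, LinearMap.smul_apply, h1] at hw
    rw [LinearMap.comp_apply]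
    have := congrArg (fun t => s • t) hw
    simp only [smul_add, smul_smul, mul_inv_cancel₀ hs, one_smul, smul_zero] at this
    rw [neg_smul, eq_neg_iff_add_eq_zero, add_comm]
    exact this
  have := LinearMap.injective_iff_surjective.1 hinj
  exact Function.Surjective.of_comp (g := r) (by simpa using this)

lemma generic_inj {V W : Type} [AddCommGroup V] [Module K V] [AddCommGroup W] [Module K W] [FiniteDimensional K V]
    (X Y : V →ₗ[K] W) (hX : Function.Injective X) :
    {s : K | ¬ Function.Injective (Y + s • X)}.Finite := by
  obtain ⟨r, hr⟩ := X.exists_leftInverse_of_injective (LinearMap.ker_eq_bot.2 hX)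
  refine ((Module.End.finite_hasEigenvalue (r.comp Y)).image (fun t => -t)).subset ?_
  rintro s hns
  refine ⟨-s, ?_, neg_neg s⟩
  by_contra hev
  apply hns
  rw [← LinearMap.ker_eq_bot, LinearMap.ker_eq_bot']
  intro w hw
  by_contra hw0
  apply hev
  refine Module.End.hasEigenvalue_of_hasEigenvector (x := w) ⟨?_, hw0⟩
  rw [Module.End.mem_eigenspace_iff]
  have h1 : r (X w) = w := congrArg (fun t => t w) hr
  have := congrArg r hw
  simp only [LinearMap.add_apply, LinearMap.smul_apply, map_add, map_smul, map_zero, h1] at this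
  rw [neg_smul, eq_neg_iff_add_eq_zero]
  exact this

lemma exists_common [Infinite K] {I0 I1 ℓ1 ℓ2 : Type} [Fintype I0] [Fintype I1] [Fintype ℓ1] [Fintype ℓ2]
    [Nonempty ℓ1] [Nonempty ℓ2]
    (ε0 : I0 → A) (ε1 : I1 → A)  (h0 : ∀ j, IsIdempotentElem (ε0 j)) (h1 : ∀ i, IsIdempotentElem (ε1 i))
    (f1 : I1 × ℓ1 → I0 × ℓ1 → A) (f2 : I1 × ℓ2 → I0 × ℓ2 → A)
    (M : Type) [AddCommGroup M] [Module A M] [Module K M] [IsScalarTower K A M] [FiniteDimensional K M]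
    (N : Type) [AddCommGroup N] [Module A N] [Module K N] [IsScalarTower K A N] [FiniteDimensional K N]
    (hM : Function.Surjective (phi K (fun j : I0 × ℓ1 => ε0 j.1) (fun i : I1 × ℓ1 => ε1 i.1) f1 M))
    (hN : Function.Injective (phi K (fun j : I0 × ℓ2 => ε0 j.1) (fun i : I1 × ℓ2 => ε1 i.1) f2 N)) :
    ∃ (ℓ : Type) (_ : Fintype ℓ) (_ : Nonempty ℓ) (f : I1 × ℓ → I0 × ℓ → A),
      PF (fun j : I0 × ℓ => ε0 j.1) (fun i : I1 × ℓ => ε1 i.1) f ∧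
      IsS (fun i : I1 × ℓ => ε1 i.1) f M ∧ IsI (fun j : I0 × ℓ => ε0 j.1) f N := by
  classical
  have hM' := surj_enl ε0 ε1 (Equiv.refl (ℓ1 × ℓ2)) f1 M hM
  have hN' := inj_enl ε0 ε1 (Equiv.prodComm ℓ1 ℓ2) f2 N hN
  set F1 := enl (Equiv.refl (ℓ1 × ℓ2)) f1
  set F2 := enl (Equiv.prodComm ℓ1 ℓ2) f2
  set ε0' := (fun j : I0 × (ℓ1 × ℓ2) => ε0 j.1)
  set ε1' := (fun j : I1 × (ℓ1 × ℓ2) => ε1 j.1)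
  have g1 := generic_surj _ (phi K ε0' ε1' F2 M) hM'
  have g2 := generic_inj _ (phi K ε0' ε1' F1 N) hN'
  -- choose s ≠ 0 with s good for surj with s⁻¹ and s⁻¹ good for inj
  have g3 := ((g1.union (g2.image (fun t => t⁻¹))).union (Set.finite_singleton (0 : K)))
  obtain ⟨s, hs⟩ := g3.exists_notMem
  simp only [Set.mem_union, Set.mem_ofPred_eq, Set.mem_image, Set.mem_singleton_iff, not_or, not_exists, not_and] at hs
  obtain ⟨⟨hs1, hs2⟩, hs0⟩ := hs
  have k1 : Function.Surjective (phi K ε0' ε1' (F1 + s⁻¹ • F2) M) := by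
    have := not_not.1 (hs1 hs0)
    have e : phi K ε0' ε1' (F1 + s⁻¹ • F2) M = phi K ε0' ε1' F1 M + s⁻¹ • phi K ε0' ε1' F2 M := by
      have := (phiL K ε0' ε1' M).map_add F1 (s⁻¹ • F2)
      rw [map_smul] at this
      exact this
    rw [e]; exact this
  have k2 : Function.Injective (phi K ε0' ε1' (F1 + s⁻¹ • F2) N) := by
    have : Function.Injective (phi K ε0' ε1' F1 N + s⁻¹ • phi K ε0' ε1' F2 N) := by
      by_contra hcon
      exact hs2 s⁻¹ hcon (inv_inv s)
    have e : phi K ε0' ε1' (F1 + s⁻¹ • F2) N = phi K ε0' ε1' F1 N + s⁻¹ • phi K ε0' ε1' F2 N := by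
      have := (phiL K ε0' ε1' N).map_add F1 (s⁻¹ • F2)
      rw [map_smul] at this
      exact this
    rw [e]; exact this
  have hpf := pf_norm (ε0 := ε0') (ε1 := ε1') (F1 + s⁻¹ • F2) (fun j => h0 _) (fun j => h1 _)
  refine ⟨ℓ1 × ℓ2, inferInstance, inferInstance, _, hpf, ?_, ?_⟩
  · rw [isS_of_surj (K := K) hpf, phi_norm _ (fun j => h0 _) (fun j => h1 _)]
    exact k1
  · rw [isI_of_inj (K := K) hpf, phi_norm _ (fun j => h0 _) (fun j => h1 _)]
    exact k2

end Common
end TorsPaper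

namespace TorsPaper
section SI
open Module

variable {A : Type} [Ring A] {J0 J1 : Type} [Fintype J0]
  {ε0 : J0 → A} {ε1 : J1 → A} {f : J1 → J0 → A}

lemma IsS.quot {M N : Type} [AddCommGroup M] [Module A M] [AddCommGroup N] [Module A N]
    (h : IsS ε1 f M) (g : M →ₗ[A] N) (hg : Function.Surjective g) : IsS ε1 f N := by
  intro w
  choose w' hw' using fun i => hg (w i)
  obtain ⟨v, hv⟩ := h w'
  refine ⟨fun j => g (v j), fun i => ?_⟩
  rw [← hw', ← map_smul, hv, map_sum]
  simp

lemma IsS.ext (hf : PF ε0 ε1 f) {M : Type} [AddCommGroup M] [Module A M] (N : Submodule A M)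
    (h1 : IsS ε1 f N) (h2 : IsS ε1 f (M ⧸ N)) : IsS ε1 f M := by
  intro w
  obtain ⟨v, hv⟩ := h2 (fun i => N.mkQ (w i))
  choose v' hv' using fun j => N.mkQ_surjective (v j)
  have hn : ∀ i, ε1 i • w i - ∑ j, f i j • v' j ∈ N := by
    intro i
    rw [← Submodule.Quotient.mk_eq_zero, ← Submodule.mkQ_apply, map_sub, map_smul, hv, map_sum, sub_eq_zero]
    refine Finset.sum_congr rfl fun j _ => ?_
    rw [map_smul, hv']
  obtain ⟨u, hu⟩ := h1 (fun i => ⟨_, hn i⟩)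
  refine ⟨fun j => v' j + u j, fun i => ?_⟩
  have := congrArg Subtype.val (hu i)
  simp only [Submodule.coe_smul, AddSubmonoidClass.coe_finsetSum] at this
  simp only [smul_sub, Finset.smul_sum, smul_smul, hf.l, (hf.i1 i).eq] at this
  simp only [smul_add, Finset.sum_add_distrib]
  rw [← this]
  abel

lemma IsI.sub {M N : Type} [AddCommGroup M] [Module A M] [AddCommGroup N] [Module A N]
    (h : IsI ε0 f M) (g : N →ₗ[A] M) (hg : Function.Injective g) : IsI ε0 f N := by
  intro v hv j
  apply hg
  rw [map_smul, map_zero]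
  refine h (fun j => g (v j)) (fun i => ?_) j
  have := congrArg g (hv i)
  simpa [map_sum] using this

lemma IsI.ext (hf : PF ε0 ε1 f) {M : Type} [AddCommGroup M] [Module A M] (N : Submodule A M)
    (h1 : IsI ε0 f N) (h2 : IsI ε0 f (M ⧸ N)) : IsI ε0 f M := by
  intro v hv
  have h3 : ∀ j, ε0 j • v j ∈ N := by
    intro j
    rw [← Submodule.Quotient.mk_eq_zero, ← Submodule.mkQ_apply, map_smul]
    refine h2 (fun j => N.mkQ (v j)) (fun i => ?_) j
    have := congrArg N.mkQ (hv i)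
    simpa [map_sum] using this
  have h4 := h1 (fun j => ⟨_, h3 j⟩) (fun i => by
    apply Subtype.ext
    simp only [AddSubmonoidClass.coe_finsetSum, Submodule.coe_smul, smul_smul, hf.r, hv i]
    rfl)
  intro j
  have := congrArg Subtype.val (h4 j)
  simpa [smul_smul, (hf.i0 j).eq] using this

section Dims
variable {K : Type} [Field K] [Algebra K A] [Fintype J1]

lemma IsS.dim (hf : PF ε0 ε1 f) {M : Type} [AddCommGroup M] [Module A M] [Module K M] [IsScalarTower K A M]
    [FiniteDimensional K M] (h : IsS ε1 f M) :
    ∑ i, finrank K (eP K (ε1 i) M) ≤ ∑ j, finrank K (eP K (ε0 j) M) := by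
  rw [isS_of_surj (K := K) hf] at h
  have := LinearMap.finrank_le_finrank_of_surjective (f := phi K ε0 ε1 f M) h
  rwa [finrank_pi_fintype, finrank_pi_fintype] at this

lemma IsI.dim (hf : PF ε0 ε1 f) {M : Type} [AddCommGroup M] [Module A M] [Module K M] [IsScalarTower K A M]
    [FiniteDimensional K M] (h : IsI ε0 f M) :
    ∑ j, finrank K (eP K (ε0 j) M) ≤ ∑ i, finrank K (eP K (ε1 i) M) := by
  rw [isI_of_inj (K := K) hf] at h
  have := LinearMap.finrank_le_finrank_of_injective (f := phi K ε0 ε1 f M) h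
  rwa [finrank_pi_fintype, finrank_pi_fintype] at this

lemma IsI.isS (hf : PF ε0 ε1 f) {M : Type} [AddCommGroup M] [Module A M] [Module K M] [IsScalarTower K A M]
    [FiniteDimensional K M] (h : IsI ε0 f M)
    (h2 : ∑ i, finrank K (eP K (ε1 i) M) ≤ ∑ j, finrank K (eP K (ε0 j) M)) : IsS ε1 f M := by
  have h3 := le_antisymm (h.dim (K := K) hf) h2
  rw [isI_of_inj (K := K) hf] at h
  rw [isS_of_surj (K := K) hf]
  rw [← finrank_pi_fintype, ← finrank_pi_fintype] at h3
  exact (LinearMap.injective_iff_surjective_of_finrank_eq_finrank h3).1 h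

end Dims

lemma isS_pi {ι : Type} {M : Type} [AddCommGroup M] [Module A M] (h : IsS ε1 f M) : IsS ε1 f (ι → M) := by
  intro w
  choose v hv using fun k : ι => h (fun i => w i k)
  refine ⟨fun j k => v k j, fun i => ?_⟩
  ext k
  simpa using hv k i

variable (ε0 f) in
/-- relations for the cokernel -/
def CfRel [DecidableEq J0] : Submodule A (J0 → A) :=
  Submodule.span A (Set.range f ∪ Set.range (fun j => Pi.single j (1 - ε0 j)))

variable (ε0 f) in
/-- the cokernel of `f` -/
abbrev Cf [DecidableEq J0] : Type := (J0 → A) ⧸ CfRel ε0 f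

variable [DecidableEq J0]

variable (ε0 f) in
/-- generators -/
def cg (j : J0) : Cf ε0 f := (CfRel ε0 f).mkQ (Pi.single j 1)

lemma cg_rep (x : Cf ε0 f) : ∃ a : J0 → A, x = ∑ j, a j • cg ε0 f j := by
  obtain ⟨a, rfl⟩ := (CfRel ε0 f).mkQ_surjective x
  refine ⟨a, ?_⟩
  simp only [cg]
  simp only [← map_smul, ← map_sum]
  congr 1
  ext j
  simp [Finset.sum_apply, Pi.single_apply]

lemma cg_rel (i : J1) : ∑ j, f i j • cg ε0 f j = 0 := by
  simp only [cg, ← map_smul, ← map_sum]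
  rw [Submodule.mkQ_apply, Submodule.Quotient.mk_eq_zero]
  refine Submodule.subset_span (Or.inl ⟨i, ?_⟩)
  ext j
  simp [Finset.sum_apply, Pi.single_apply]

lemma cg_idem (j : J0) : ε0 j • cg ε0 f j = cg ε0 f j := by
  rw [eq_comm, ← sub_eq_zero]
  simp only [cg, ← map_smul, ← map_sub]
  rw [Submodule.mkQ_apply, Submodule.Quotient.mk_eq_zero]
  refine Submodule.subset_span (Or.inr ⟨j, ?_⟩)
  ext k
  by_cases hk : k = j
  · subst hk; simp
  · simp [hk]

lemma cg_lift {M : Type} [AddCommGroup M] [Module A M] (v : J0 → M) (h1 : ∀ i, ∑ j, f i j • v j = 0)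
    (h2 : ∀ j, ε0 j • v j = v j) : ∃ g : Cf ε0 f →ₗ[A] M, ∀ j, g (cg ε0 f j) = v j := by
  have h : CfRel ε0 f ≤ LinearMap.ker (Fintype.linearCombination A v) := by
    refine Submodule.span_le.2 ?_
    rintro x hx
    rcases hx with hx | hx
    · obtain ⟨i, rfl⟩ := hx
      simp [Fintype.linearCombination_apply, h1]
    · obtain ⟨j, rfl⟩ := hx
      simp [Fintype.linearCombination_apply_single, sub_smul, h2]
  refine ⟨(CfRel ε0 f).liftQ (Fintype.linearCombination A v) h, fun j => ?_⟩
  rw [cg, Submodule.mkQ_apply, Submodule.liftQ_apply, Fintype.linearCombination_apply_single, one_smul]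

lemma isI_iff_Cf (hf : PF ε0 ε1 f) {M : Type} [AddCommGroup M] [Module A M] :
    IsI ε0 f M ↔ ∀ g : Cf ε0 f →ₗ[A] M, g = 0 := by
  constructor
  · intro h g
    have h1 : ∀ j, g (cg ε0 f j) = 0 := by
      intro j
      rw [← cg_idem, map_smul]
      refine h (fun j => g (cg ε0 f j)) (fun i => ?_) j
      have := congrArg g (cg_rel (ε0 := ε0) (f := f) i)
      simpa [map_sum] using this
    ext1 
    refine LinearMap.ext fun x => ?_
    obtain ⟨a, ha⟩ := cg_rep ((CfRel ε0 f).mkQ x)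
    rw [LinearMap.comp_apply, ha, map_sum]
    simp [h1]
  · intro h v hv j
    obtain ⟨g, hg⟩ := cg_lift (ε0 := ε0) (f := f) (fun j => ε0 j • v j) (fun i => by simp only [smul_smul, hf.r, hv i])
      (fun j => by rw [smul_smul, (hf.i0 j).eq])
    rw [← hg j, h g]
    rfl

end SI
end TorsPaper

namespace TorsPaper
section KF
open Module

/-- the dual of the regular module -/
def DA (K A : Type) [Field K] [Ring A] [Algebra K A] : Type := A →ₗ[K] K

variable {K A : Type} [Field K] [Ring A] [Algebra K A]

noncomputable instance : AddCommGroup (DA K A) := inferInstanceAs (AddCommGroup (A →ₗ[K] K))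
noncomputable instance : Module K (DA K A) := inferInstanceAs (Module K (A →ₗ[K] K))
instance : FunLike (DA K A) A K := inferInstanceAs (FunLike (A →ₗ[K] K) A K)
instance : LinearMapClass (DA K A) K A K := inferInstanceAs (LinearMapClass (A →ₗ[K] K) K A K)

lemma DA.add_apply (φ ψ : DA K A) (x : A) : (φ + ψ) x = φ x + ψ x := rfl
lemma DA.zero_apply (x : A) : (0 : DA K A) x = 0 := rfl
lemma DA.smul_apply (c : K) (φ : DA K A) (x : A) : (c • φ) x = c * φ x := rfl
lemma DA.ext {φ ψ : DA K A} (h : ∀ x, φ x = ψ x) : φ = ψ := LinearMap.ext h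

noncomputable instance : SMul A (DA K A) := ⟨fun a φ => LinearMap.comp (φ : A →ₗ[K] K) (LinearMap.mulRight K a)⟩

lemma DA.asmul_apply (a : A) (φ : DA K A) (x : A) : (a • φ) x = φ (x * a) := rfl

noncomputable instance : Module A (DA K A) where
  one_smul φ := DA.ext fun x => by rw [DA.asmul_apply, mul_one]
  mul_smul a b φ := DA.ext fun x => by simp only [DA.asmul_apply, mul_assoc]
  smul_zero a := DA.ext fun x => rfl
  smul_add a φ ψ := DA.ext fun x => rfl
  add_smul a b φ := DA.ext fun x => by simp only [DA.asmul_apply, DA.add_apply, mul_add, map_add]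
  zero_smul φ := DA.ext fun x => by simp only [DA.asmul_apply, DA.zero_apply, mul_zero, map_zero]

instance : IsScalarTower K A (DA K A) := ⟨fun c a φ => DA.ext fun x => by
  simp only [DA.asmul_apply, DA.smul_apply, mul_smul_comm, map_smul, smul_eq_mul]⟩

instance [FiniteDimensional K A] : FiniteDimensional K (DA K A) :=
  inferInstanceAs (FiniteDimensional K (A →ₗ[K] K))

variable {J0 J1 : Type} [Fintype J1] 

/-- the kernel of `ν f`. -/
noncomputable def Kf (K : Type) [Field K] [Algebra K A] (ε1 : J1 → A) (f : J1 → J0 → A) : Submodule A (J1 → DA K A) where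
  carrier := {φ | (∀ i a, φ i (ε1 i * a) = φ i a) ∧ ∀ j a, ∑ i, φ i (f i j * a) = 0}
  zero_mem' := ⟨fun i a => rfl, fun j a => by simp [DA.zero_apply]⟩
  add_mem' := by
    rintro φ ψ ⟨h1, h2⟩ ⟨h3, h4⟩
    refine ⟨fun i a => ?_, fun j a => ?_⟩
    · simp only [Pi.add_apply, DA.add_apply, h1, h3]
    · simp only [Pi.add_apply, DA.add_apply, Finset.sum_add_distrib, h2, h4, add_zero]
  smul_mem' := by
    rintro b φ ⟨h1, h2⟩
    refine ⟨fun i a => ?_, fun j a => ?_⟩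
    · simp only [Pi.smul_apply, DA.asmul_apply, mul_assoc, h1]
    · simp only [Pi.smul_apply, DA.asmul_apply, mul_assoc, h2]

instance Kf_finite [FiniteDimensional K A] (ε1 : J1 → A) (f : J1 → J0 → A) : Module.Finite A (Kf K ε1 f) := by
  have : FiniteDimensional K (Kf K ε1 f) :=
    FiniteDimensional.finiteDimensional_submodule ((Kf K ε1 f).restrictScalars K)
  exact Module.Finite.of_restrictScalars_finite K A _

lemma isS_iff_Kf [Fintype J0] {ε0 : J0 → A} {ε1 : J1 → A} {f : J1 → J0 → A} (hf : PF ε0 ε1 f)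
    {M : Type} [AddCommGroup M] [Module A M] [Module K M] [IsScalarTower K A M] :
    IsS ε1 f M ↔ ∀ g : M →ₗ[A] Kf K ε1 f, g = 0 := by
  classical
  constructor
  · intro h Φ
    have hΦ : ∀ m i a, (Φ m).1 i a = (Φ (a • m)).1 i 1 := by
      intro m i a
      rw [map_smul]
      change _ = (a • (Φ m).1 i) 1
      rw [DA.asmul_apply, one_mul]
    have hΦ1 : ∀ i m, (Φ (ε1 i • m)).1 i 1 = (Φ m).1 i 1 := by
      intro i m
      rw [← hΦ, ← mul_one (ε1 i), (Φ m).2.1 i 1]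
    have hΦ2 : ∀ j m, ∑ i, (Φ (f i j • m)).1 i 1 = 0 := by
      intro j m
      have := (Φ m).2.2 j 1
      simp only [mul_one] at this
      simpa only [← hΦ] using this
    have h0 : ∀ m i, (Φ m).1 i 1 = 0 := by
      intro m i
      obtain ⟨v, hv⟩ := h (Pi.single i m)
      have h1 : ∑ i', (Φ (ε1 i' • (Pi.single i m : J1 → M) i')).1 i' 1 = (Φ m).1 i 1 := by
        rw [Finset.sum_eq_single i]
        · rw [Pi.single_eq_same, hΦ1]
        · intro k _ hk
          rw [Pi.single_eq_of_ne hk, smul_zero, map_zero]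
          rfl
        · simp
      rw [← h1]
      have hsum : ∀ (s : Finset J0) (g : J0 → M) i, (Φ (∑ j ∈ s, g j)).1 i 1 = ∑ j ∈ s, (Φ (g j)).1 i 1 := by
        intro s g i
        induction s using Finset.induction_on with
        | empty => simp; rfl
        | insert a s ha ih =>
          rw [Finset.sum_insert ha, Finset.sum_insert ha, ← ih, map_add]
          rfl
      simp only [hv, hsum]
      rw [Finset.sum_comm]
      exact Finset.sum_eq_zero fun j _ => hΦ2 j (v j)
    refine LinearMap.ext fun m => Subtype.ext (funext fun i => DA.ext fun a => ?_)
    rw [hΦ, h0]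
    rfl
  · intro h
    rw [isS_of_surj (K := K) hf, ← LinearMap.range_eq_top]
    by_contra hne
    obtain ⟨ζ, hζ0, hζ⟩ := Submodule.exists_le_ker_of_lt_top _ (lt_top_iff_ne_top.2 hne)
    have hζ' : ∀ v, ζ (phi K ε0 ε1 f M v) = 0 := fun v => hζ ⟨v, rfl⟩
    let lam : (i : J1) → M →ₗ[K] K := fun i => ζ.comp ((LinearMap.single K (fun i => eP K (ε1 i) M) i).comp
      ((Algebra.lsmul K K M (ε1 i)).rangeRestrict))
    have hlam : ∀ i m, lam i m = ζ (Pi.single i ⟨ε1 i • m, ⟨_, rfl⟩⟩) := fun i m => rfl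
    have hlam1 : ∀ i m, lam i (ε1 i • m) = lam i m := by
      intro i m
      rw [hlam, hlam]
      congr 3
      rw [smul_smul, (hf.i1 i).eq]
    have hlam2 : ∀ j m, ∑ i, lam i (f i j • m) = 0 := by
      intro j m
      rw [← hζ' (Pi.single j ⟨ε0 j • m, ⟨_, rfl⟩⟩)]
      simp only [hlam]
      rw [← map_sum]
      congr 1
      refine Eq.trans (Finset.univ_sum_single (fun i => (⟨ε1 i • f i j • m, ⟨_, rfl⟩⟩ : eP K (ε1 i) M))) ?_
      refine funext fun i => Subtype.ext ?_
      rw [phi_apply, Finset.sum_eq_single j]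
      · simp [smul_smul, mul_assoc, hf.r]
      · intro k _ hk
        simp [Pi.single_eq_of_ne hk]
      · simp
    let Φ : M →ₗ[A] Kf K ε1 f :=
      { toFun := fun m => ⟨fun i => (lam i).comp ((LinearMap.toSpanSingleton A M m).restrictScalars K), by
          refine ⟨fun i a => ?_, fun j a => ?_⟩
          · change lam i ((ε1 i * a) • m) = lam i (a • m)
            rw [mul_smul, hlam1]
          · change ∑ i, lam i ((f i j * a) • m) = 0
            simp only [mul_smul]
            exact hlam2 j (a • m)⟩
        map_add' := fun x y => Subtype.ext (funext fun i => DA.ext fun a => by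
          change lam i (a • (x + y)) = lam i (a • x) + lam i (a • y)
          rw [smul_add, map_add])
        map_smul' := fun b x => Subtype.ext (funext fun i => DA.ext fun a => by
          change lam i (a • b • x) = lam i ((a * b) • x)
          rw [mul_smul]) }
    have hΦ := h Φ
    apply hζ0
    refine LinearMap.ext fun w => ?_
    rw [← Finset.univ_sum_single w, map_sum, LinearMap.zero_apply]
    refine Finset.sum_eq_zero fun i _ => ?_
    have h1 : lam i ((1 : A) • (w i : M)) = 0 := by
      have h2 : (Φ (w i)).1 i 1 = 0 := by rw [hΦ]; rfl
      exact h2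
    rw [one_smul, hlam] at h1
    rw [← h1]
    congr 2
    exact Subtype.ext ((mem_eP K (hf.i1 i) _).1 (w i).2).symm

end KF
end TorsPaper

namespace TorsPaper
section Approx
open Module

variable {K A : Type} [Field K] [Ring A] [Algebra K A]

lemma pi_sum2 {κ J : Type} [Fintype κ] [Fintype J] [DecidableEq κ] [DecidableEq J] (a : κ → J → A) :
    a = ∑ k, ∑ j, a k j • (Pi.single k (Pi.single j 1) : κ → J → A) := by
  ext k j
  simp only [Finset.sum_apply, Pi.smul_apply]
  rw [Finset.sum_eq_single k]
  · rw [Finset.sum_eq_single j]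
    · simp
    · intro l _ hl
      simp [Pi.single_eq_of_ne hl.symm]
    · simp
  · intro l _ hl
    simp [Pi.single_eq_of_ne hl.symm]
  · simp

lemma pi_sum1 {κ J : Type} [Fintype J] [DecidableEq κ] [DecidableEq J] (k : κ) (a : J → A) :
    (Pi.single k a : κ → J → A) = ∑ j, a j • (Pi.single k (Pi.single j 1) : κ → J → A) := by
  ext l j
  simp only [Finset.sum_apply, Pi.smul_apply]
  by_cases h : l = k
  · subst h
    rw [Finset.sum_eq_single j]
    · simp
    · intro l _ hl
      simp [Pi.single_eq_of_ne hl.symm]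
    · simp
  · simp [Pi.single_eq_of_ne h]

lemma pi_sub1 {κ J : Type} [DecidableEq κ] [DecidableEq J] (k : κ) (j : J) (e : A) :
    (Pi.single k (Pi.single j (1 - e)) : κ → J → A) =
      Pi.single k (Pi.single j 1) - e • (Pi.single k (Pi.single j 1) : κ → J → A) := by
  rw [← Pi.single_smul, ← Pi.single_smul, ← Pi.single_sub, ← Pi.single_sub, smul_eq_mul, mul_one]

/-- left approximations for `S_f`. -/
lemma left_approx_S {J0 J1 : Type} [Fintype J0] [Fintype J1] [DecidableEq J0] [FiniteDimensional K A]
    {ε0 : J0 → A} {ε1 : J1 → A} {f : J1 → J0 → A} (hf : PF ε0 ε1 f) (hC : IsS ε1 f (Cf ε0 f))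
    (M : Type) [AddCommGroup M] [Module A M] [Module K M] [IsScalarTower K A M] [Module.Finite A M] :
    ∃ (X : Type) (_ : AddCommGroup X) (_ : Module A X) (_ : Module.Finite A X) (ι : M →ₗ[A] X),
      IsS ε1 f X ∧ ∀ (Y : Type) [AddCommGroup Y] [Module A Y], IsS ε1 f Y → ∀ g : M →ₗ[A] Y,
        ∃ h : X →ₗ[A] Y, h.comp ι = g := by
  classical
  have hfd : FiniteDimensional K M := Module.Finite.trans A M
  let κ := Fin (finrank K (J1 → M))
  let w : κ → J1 → M := finBasis K (J1 → M)
  have hw : ∀ u : J1 → M, ∃ c : κ → K, u = ∑ k, c k • w k := fun u =>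
    ⟨fun k => (finBasis K (J1 → M)).repr u k, ((finBasis K (J1 → M)).sum_repr u).symm⟩
  let R : Submodule A (M × (κ → J0 → A)) := Submodule.span A
    (Set.range (fun x : κ × J1 => ((ε1 x.2 • w x.1 x.2, - Pi.single x.1 (f x.2)) : M × (κ → J0 → A))) ∪
      Set.range (fun x : κ × J0 => ((0, Pi.single x.1 (Pi.single x.2 (1 - ε0 x.2))) : M × (κ → J0 → A))))
  let X := (M × (κ → J0 → A)) ⧸ R
  let ι : M →ₗ[A] X := R.mkQ.comp (LinearMap.inl A M (κ → J0 → A))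
  let y : κ → J0 → X := fun k j => R.mkQ (0, Pi.single k (Pi.single j 1))
  have hgen : ∀ x : X, ∃ m : M, ∃ a : κ → J0 → A, x = ι m + ∑ k, ∑ j, a k j • y k j := by
    intro x
    obtain ⟨⟨m, a⟩, rfl⟩ := R.mkQ_surjective x
    refine ⟨m, a, ?_⟩
    simp only [ι, y, LinearMap.comp_apply, ← map_smul, ← map_sum, ← map_add]
    congr 1
    refine Prod.ext ?_ ?_
    · simp [Prod.fst_sum]
    · simp only [LinearMap.inl_apply, Prod.snd_add, Prod.snd_sum, Prod.smul_snd, zero_add]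
      exact pi_sum2 a
  have hrel1 : ∀ k i, ι (ε1 i • w k i) = ∑ j, f i j • y k j := by
    intro k i
    rw [← sub_eq_zero]
    simp only [ι, y, LinearMap.comp_apply, ← map_smul, ← map_sum, ← map_sub]
    rw [Submodule.mkQ_apply, Submodule.Quotient.mk_eq_zero]
    refine Submodule.subset_span (Or.inl ⟨(k, i), ?_⟩)
    refine Prod.ext ?_ ?_
    · simp [Prod.fst_sum]
    · simp only [LinearMap.inl_apply, Prod.snd_sub, Prod.snd_sum, Prod.smul_snd, zero_sub]
      congr 1
      exact pi_sum1 k (f i)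
  have hrel2 : ∀ k j, ε0 j • y k j = y k j := by
    intro k j
    rw [eq_comm, ← sub_eq_zero]
    simp only [y, ← map_smul, ← map_sub]
    rw [Submodule.mkQ_apply, Submodule.Quotient.mk_eq_zero]
    refine Submodule.subset_span (Or.inr ⟨(k, j), ?_⟩)
    refine Prod.ext ?_ ?_
    · simp
    · simp only [Prod.snd_sub, Prod.smul_snd]
      exact pi_sub1 k j (ε0 j)
  have hfinA : Module.Finite A X := inferInstance
  refine ⟨X, inferInstance, inferInstance, hfinA, ι, ?_, ?_⟩
  · -- X is in S_f
    have hq : IsS ε1 f (X ⧸ LinearMap.range ι) := by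
      have hl : ∀ k, ∃ g : Cf ε0 f →ₗ[A] X ⧸ LinearMap.range ι, ∀ j, g (cg ε0 f j) = (LinearMap.range ι).mkQ (y k j) := by
        intro k
        refine cg_lift _ (fun i => ?_) (fun j => ?_)
        · simp only [← map_smul, ← map_sum]
          rw [← hrel1, Submodule.mkQ_apply, Submodule.Quotient.mk_eq_zero]
          exact ⟨_, rfl⟩
        · rw [← map_smul, hrel2]
      choose g hg using hl
      refine (isS_pi (ι := κ) hC).quot (∑ k, (g k).comp (LinearMap.proj k)) ?_
      intro z
      obtain ⟨x, rfl⟩ := (LinearMap.range ι).mkQ_surjective z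
      obtain ⟨m, a, rfl⟩ := hgen x
      refine ⟨fun k => ∑ j, a k j • cg ε0 f j, ?_⟩
      rw [LinearMap.sum_apply]
      simp only [LinearMap.comp_apply, LinearMap.proj_apply, map_sum, map_smul, hg, map_add]
      rw [right_eq_add, Submodule.mkQ_apply, Submodule.Quotient.mk_eq_zero]
      exact ⟨_, rfl⟩
    intro w'
    obtain ⟨v, hv⟩ := hq (fun i => (LinearMap.range ι).mkQ (w' i))
    choose v' hv' using fun j => (LinearMap.range ι).mkQ_surjective (v j)
    have hn : ∀ i, ε1 i • w' i - ∑ j, f i j • v' j ∈ LinearMap.range ι := by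
      intro i
      rw [← Submodule.Quotient.mk_eq_zero, ← Submodule.mkQ_apply, map_sub, map_smul, hv, map_sum, sub_eq_zero]
      refine Finset.sum_congr rfl fun j _ => ?_
      rw [map_smul, hv']
    choose u hu using hn
    obtain ⟨c, hc⟩ := hw u
    refine ⟨fun j => v' j + ∑ k, c k • y k j, fun i => ?_⟩
    have h1 : ε1 i • w' i - ∑ j, f i j • v' j = ∑ k, c k • ∑ j, f i j • y k j := by
      have h2 : ε1 i • ι (u i) = ε1 i • w' i - ∑ j, f i j • v' j := by
        rw [hu]
        simp only [smul_sub, Finset.smul_sum, smul_smul, hf.l, (hf.i1 i).eq]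
      rw [← h2]
      simp only [← hrel1]
      rw [hc, ← map_smul, Finset.sum_apply, Finset.smul_sum, map_sum]
      refine Finset.sum_congr rfl fun k _ => ?_
      rw [Pi.smul_apply, smul_comm_KA]
      exact (ι.restrictScalars K).map_smul (c k) _
    simp only [smul_add, Finset.sum_add_distrib]
    rw [sub_eq_iff_eq_add] at h1
    rw [h1, add_comm]
    congr 1
    simp only [Finset.smul_sum]
    rw [Finset.sum_comm]
    refine Finset.sum_congr rfl fun j _ => Finset.sum_congr rfl fun k _ => ?_
    rw [smul_comm_KA]
  · intro Y _ _ hY g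
    choose v hv using fun k => hY (fun i => g (w k i))
    let h0 : M × (κ → J0 → A) →ₗ[A] Y := LinearMap.coprod g
      (∑ k, (Fintype.linearCombination A (fun j => ε0 j • v k j)).comp (LinearMap.proj k))
    have h0a : ∀ m b, h0 (m, b) = g m + ∑ k, ∑ j, b k j • ε0 j • v k j := by
      intro m b
      simp [h0, Fintype.linearCombination_apply]
    have hker : R ≤ LinearMap.ker h0 := by
      refine Submodule.span_le.2 ?_
      rintro x hx
      rcases hx with hx | hx
      · obtain ⟨⟨k, i⟩, rfl⟩ := hx
        rw [SetLike.mem_coe, LinearMap.mem_ker, h0a]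
        rw [Finset.sum_eq_single k]
        · simp only [Pi.neg_apply, Pi.single_eq_same, map_smul, hv, smul_smul]
          simp
          simp only [hf.r]
          exact add_neg_cancel _
        · intro l _ hl
          simp [Pi.single_eq_of_ne hl]
        · simp
      · obtain ⟨⟨k, j⟩, rfl⟩ := hx
        rw [SetLike.mem_coe, LinearMap.mem_ker, h0a]
        rw [Finset.sum_eq_single k]
        · rw [Finset.sum_eq_single j]
          · simp [smul_smul, sub_mul, (hf.i0 j).eq]
          · intro l _ hl
            simp [Pi.single_eq_of_ne hl]
          · simp
        · intro l _ hl
          simp [Pi.single_eq_of_ne hl]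
        · simp
    refine ⟨R.liftQ h0 hker, ?_⟩
    refine LinearMap.ext fun m => ?_
    simp only [ι, LinearMap.comp_apply]
    rw [Submodule.mkQ_apply, Submodule.liftQ_apply, LinearMap.inl_apply, h0a]
    simp

end Approx
end TorsPaper

namespace TorsPaper
section ApproxFac
open Module

variable {K A : Type} [Field K] [Ring A] [Algebra K A]

/-- left approximations for `Fac C`. -/
lemma left_approx_Fac [FiniteDimensional K A]
    (C : Type) [AddCommGroup C] [Module A C] [Module K C] [IsScalarTower K A C] [Module.Finite A C]
    (M : Type) [AddCommGroup M] [Module A M] [Module.Finite A M] :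
    ∃ (X : Type) (_ : AddCommGroup X) (_ : Module A X) (_ : Module.Finite A X) (ι : M →ₗ[A] X),
      (∃ (m : ℕ) (q : (Fin m → C) →ₗ[A] X), Function.Surjective q) ∧
      ∀ (Y : Type) [AddCommGroup Y] [Module A Y], 
        (∃ (m : ℕ) (q : (Fin m → C) →ₗ[A] Y), Function.Surjective q) → ∀ g : M →ₗ[A] Y,
        ∃ h : X →ₗ[A] Y, h.comp ι = g := by
  classical
  obtain ⟨n, π, hπ⟩ := Module.Finite.exists_fin' A M
  have hfd : FiniteDimensional K C := Module.Finite.trans A C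
  have : SMulCommClass K A C := IsScalarTower.to_smulCommClass
  have : SMulCommClass A K C := SMulCommClass.symm _ _ _
  let κ := Fin (finrank K (Fin n → C))
  let x : κ → Fin n → C := finBasis K (Fin n → C)
  have hx : ∀ u : Fin n → C, ∃ c : κ → K, u = ∑ k, c k • x k := fun u =>
    ⟨fun k => (finBasis K (Fin n → C)).repr u k, ((finBasis K (Fin n → C)).sum_repr u).symm⟩
  let b : (Fin n → A) →ₗ[A] (κ → C) := LinearMap.pi (fun k => Fintype.linearCombination A (x k))
  have hb : ∀ p k, b p k = ∑ r, p r • x k r := by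
    intro p k
    simp [b, Fintype.linearCombination_apply]
  let R : Submodule A (κ → C) := (LinearMap.ker π).map b
  let ι : M →ₗ[A] ((κ → C) ⧸ R) :=
    ((LinearMap.ker π).mapQ R b (Submodule.map_le_iff_le_comap.1 le_rfl)).comp
      (π.quotKerEquivOfSurjective hπ).symm.toLinearMap
  have hι : ∀ p, ι (π p) = R.mkQ (b p) := by
    intro p
    have : (π.quotKerEquivOfSurjective hπ).symm (π p) = (LinearMap.ker π).mkQ p := by
      rw [LinearEquiv.symm_apply_eq]
      rfl
    simp only [ι, LinearMap.comp_apply, LinearEquiv.coe_coe, this]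
    rfl
  refine ⟨(κ → C) ⧸ R, inferInstance, inferInstance, inferInstance, ι, ⟨_, R.mkQ, R.mkQ_surjective⟩, ?_⟩
  rintro Y _ _ ⟨m, q, hq⟩ g
  choose z hz using fun r : Fin n => hq (g (π (Pi.single r 1)))
  choose c hc using fun l : Fin m => hx (fun r => z r l)
  let h0 : (κ → C) →ₗ[A] Y := q.comp (LinearMap.pi (fun l => ∑ k, c l k • LinearMap.proj k))
  have hg : ∀ p, g (π p) = ∑ r, p r • q (z r) := by
    intro p
    conv_lhs => rw [pi_eq_sum_univ' p]
    simp only [map_sum, map_smul, hz]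
  have h0b : ∀ p, h0 (b p) = g (π p) := by
    intro p
    rw [hg]
    simp only [← map_smul, ← map_sum, h0, LinearMap.comp_apply]
    congr 1
    ext l
    simp only [LinearMap.pi_apply, LinearMap.sum_apply, LinearMap.smul_apply, LinearMap.proj_apply, hb,
      Finset.sum_apply, Pi.smul_apply]
    have : ∀ r, z r l = ∑ k, c l k • x k r := fun r => by
      have := congrFun (hc l) r
      simpa using this
    simp only [this, Finset.smul_sum]
    rw [Finset.sum_comm]
    refine Finset.sum_congr rfl fun r _ => Finset.sum_congr rfl fun k _ => ?_
    rw [smul_comm]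
  have hker : R ≤ LinearMap.ker h0 := by
    rintro _ ⟨p, hp, rfl⟩
    rw [LinearMap.mem_ker, h0b, LinearMap.mem_ker.1 hp, map_zero]
  refine ⟨R.liftQ h0 hker, LinearMap.ext fun y => ?_⟩
  obtain ⟨p, rfl⟩ := hπ y
  rw [LinearMap.comp_apply, hι, Submodule.mkQ_apply, Submodule.liftQ_apply, h0b]

end ApproxFac
end TorsPaper

namespace TorsPaper
section Tors
open Module

variable {A : Type} [Ring A]

section ext
variable {T F : ModuleCat.{0} A → Prop}

lemma IsTorsionClass.quot' (hT : IsTorsionClass A T) {M N : Type} [AddCommGroup M] [Module A M]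
    [AddCommGroup N] [Module A N] (h : T (ModuleCat.of A M)) (g : M →ₗ[A] N)
    (hg : Function.Surjective g) : T (ModuleCat.of A N) := by
  have : Module.Finite A M := hT.fin _ h
  have hN : Module.Finite A N := Module.Finite.of_surjective g hg
  exact hT.quot _ _ h hN ⟨g, hg⟩

lemma IsTorsionClass.ext' (hT : IsTorsionClass A T) {M N : Type} [AddCommGroup M] [Module A M]
    [AddCommGroup N] [Module A N] [hM : Module.Finite A M] (g : M →ₗ[A] N)
    (hg : Function.Surjective g) (h1 : T (ModuleCat.of A (LinearMap.ker g)))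
    (h2 : T (ModuleCat.of A N)) : T (ModuleCat.of A M) := by
  refine hT.ext (ModuleCat.of A M) hM (LinearMap.ker g) h1 ?_
  exact hT.quot' h2 (g.quotKerEquivOfSurjective hg).symm.toLinearMap (LinearEquiv.surjective _)

lemma IsTorsionFreeClass.sub' [IsNoetherianRing A] (hF : IsTorsionFreeClass A F) {M N : Type} [AddCommGroup M] [Module A M]
    [AddCommGroup N] [Module A N] (h : F (ModuleCat.of A M)) (g : N →ₗ[A] M)
    (hg : Function.Injective g) : F (ModuleCat.of A N) := by
  have : Module.Finite A M := hF.fin _ h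
  have hN : Module.Finite A N := Module.Finite.of_injective g hg
  exact hF.sub _ _ h hN ⟨g, hg⟩

lemma IsTorsionFreeClass.ext' [IsNoetherianRing A] (hF : IsTorsionFreeClass A F) {M N : Type} [AddCommGroup M] [Module A M]
    [AddCommGroup N] [Module A N] [hM : Module.Finite A M] (g : M →ₗ[A] N)
    (h1 : F (ModuleCat.of A (LinearMap.ker g)))
    (h2 : F (ModuleCat.of A N)) : F (ModuleCat.of A M) := by
  refine hF.ext (ModuleCat.of A M) hM (LinearMap.ker g) h1 ?_
  refine hF.sub' h2 ((LinearMap.ker g).liftQ g le_rfl) ?_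
  rw [← LinearMap.ker_eq_bot]
  exact Submodule.ker_liftQ_eq_bot _ _ _ le_rfl

lemma tors_max [IsNoetherianRing A] (hT : IsTorsionClass A T) (X : Type) [AddCommGroup X] [Module A X]
    [Module.Finite A X] : ∃ X' : Submodule A X, T (ModuleCat.of A X') ∧ 
      (∀ (Y : Type) [AddCommGroup Y] [Module A Y], T (ModuleCat.of A Y) → ∀ g : Y →ₗ[A] X ⧸ X', g = 0) ∧
      (∀ (Y : Type) [AddCommGroup Y] [Module A Y], T (ModuleCat.of A Y) → ∀ g : Y →ₗ[A] X, ∀ y, g y ∈ X') := by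
  obtain ⟨X', hX', hmax⟩ := set_has_maximal_iff_noetherian.2 (inferInstanceAs (IsNoetherian A X))
    {X' : Submodule A X | T (ModuleCat.of A X')}
    ⟨⊥, hT.zero _ (fun x => Subsingleton.elim (α := (⊥ : Submodule A X)) x 0)⟩
  have key : ∀ (Y : Type) [AddCommGroup Y] [Module A Y], T (ModuleCat.of A Y) → ∀ g : Y →ₗ[A] X ⧸ X', g = 0 := by
    intro Y _ _ hY g
    let X'' : Submodule A X := (LinearMap.range g).comap X'.mkQ
    have hle : X' ≤ X'' := by
      intro x hx
      refine ⟨0, ?_⟩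
      rw [map_zero, eq_comm, Submodule.mkQ_apply, Submodule.Quotient.mk_eq_zero]
      exact hx
    have hr : T (ModuleCat.of A (LinearMap.range g)) :=
      hT.quot' hY g.rangeRestrict g.surjective_rangeRestrict
    let q : X'' →ₗ[A] LinearMap.range g := X'.mkQ.restrict (fun x hx => hx)
    have hq : Function.Surjective q := by
      rintro ⟨y, hy⟩
      obtain ⟨x, rfl⟩ := X'.mkQ_surjective y
      exact ⟨⟨x, hy⟩, rfl⟩
    have hk : T (ModuleCat.of A (LinearMap.ker q)) := by
      refine hT.quot' hX' ((Submodule.inclusion hle).codRestrict _ ?_) ?_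
      · rintro ⟨x, hx⟩
        rw [LinearMap.mem_ker]
        refine Subtype.ext ?_
        exact (Submodule.Quotient.mk_eq_zero _).2 hx
      · rintro ⟨⟨x, hx⟩, hx'⟩
        have : x ∈ X' := by
          rw [LinearMap.mem_ker] at hx'
          exact (Submodule.Quotient.mk_eq_zero _).1 (congrArg Subtype.val hx')
        exact ⟨⟨x, this⟩, rfl⟩
    have hT'' : T (ModuleCat.of A X'') := hT.ext' q hq hk hr
    have heq : X'' ≤ X' := by
      by_contra h
      exact hmax X'' hT'' (lt_of_le_not_ge hle h)
    refine LinearMap.ext fun y => ?_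
    obtain ⟨x, hx⟩ := X'.mkQ_surjective (g y)
    rw [← hx]
    refine (Submodule.Quotient.mk_eq_zero _).2 (heq ?_)
    exact ⟨y, hx.symm⟩
  refine ⟨X', hX', key, fun Y _ _ hY g y => ?_⟩
  have := LinearMap.congr_fun (key Y hY (X'.mkQ.comp g)) y
  exact (Submodule.Quotient.mk_eq_zero _).1 this

lemma torf_min [IsNoetherianRing A] [IsArtinianRing A] (hF : IsTorsionFreeClass A F) (X : Type) [AddCommGroup X] [Module A X]
    [Module.Finite A X] : ∃ X' : Submodule A X, F (ModuleCat.of A (X ⧸ X')) ∧ 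
      (∀ (Y : Type) [AddCommGroup Y] [Module A Y], F (ModuleCat.of A Y) → ∀ g : X' →ₗ[A] Y, g = 0) := by
  have : IsArtinian A X := inferInstance
  obtain ⟨X', hX', hmin⟩ := IsArtinian.set_has_minimal
    {X' : Submodule A X | F (ModuleCat.of A (X ⧸ X'))}
    ⟨⊤, hF.zero _ (fun x => Subsingleton.elim (α := (X ⧸ (⊤ : Submodule A X))) x 0)⟩
  refine ⟨X', hX', fun Y _ _ hY g => ?_⟩
  let L : Submodule A X := (LinearMap.ker g).map X'.subtype
  have hle : L ≤ X' := Submodule.map_subtype_le _ _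
  have hker : ∀ x : X', g x = 0 → (x : X) ∈ L := fun x hx => ⟨x, hx, rfl⟩
  have hL : F (ModuleCat.of A (X ⧸ L)) := by
    let q : (X ⧸ L) →ₗ[A] (X ⧸ X') := Submodule.factor hle
    refine hF.ext' q ?_ hX'
    -- the kernel of q embeds into Y
    have hk : F (ModuleCat.of A (X' ⧸ LinearMap.ker g)) := by
      refine hF.sub' hY ((LinearMap.ker g).liftQ g le_rfl) ?_
      rw [← LinearMap.ker_eq_bot]
      exact Submodule.ker_liftQ_eq_bot _ _ _ le_rfl
    let p : (X' ⧸ LinearMap.ker g) →ₗ[A] LinearMap.ker q :=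
      ((LinearMap.ker g).mapQ L X'.subtype (Submodule.map_le_iff_le_comap.1 le_rfl)).codRestrict _ (by
        intro z
        obtain ⟨x, rfl⟩ := (LinearMap.ker g).mkQ_surjective z
        rw [LinearMap.mem_ker]
        exact (Submodule.Quotient.mk_eq_zero _).2 x.2)
    have hp : Function.Bijective p := by
      constructor
      · rw [← LinearMap.ker_eq_bot, eq_bot_iff]
        intro z hz
        obtain ⟨x, rfl⟩ := (LinearMap.ker g).mkQ_surjective z
        rw [LinearMap.mem_ker] at hz
        have h1 : L.mkQ (x : X) = 0 := congrArg Subtype.val hz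
        rw [Submodule.mkQ_apply, Submodule.Quotient.mk_eq_zero] at h1
        obtain ⟨x', hx', h2⟩ := h1
        have : x' = x := Subtype.ext h2
        subst this
        exact (Submodule.Quotient.mk_eq_zero _).2 hx'
      · rintro ⟨z, hz⟩
        obtain ⟨x, rfl⟩ := L.mkQ_surjective z
        have hx : x ∈ X' := (Submodule.Quotient.mk_eq_zero _).1 hz
        exact ⟨(LinearMap.ker g).mkQ ⟨x, hx⟩, Subtype.ext rfl⟩
    exact hF.sub' hk (LinearEquiv.ofBijective p hp).symm.toLinearMap (LinearEquiv.injective _)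
  have heq : X' ≤ L := by
    by_contra h
    exact hmin L hL (lt_of_le_not_ge hle h)
  refine LinearMap.ext fun x => ?_
  obtain ⟨x', hx', h2⟩ := heq x.2
  have : x' = x := Subtype.ext h2
  subst this
  exact hx'

end ext

/-- the torsion class of modules without nonzero maps to `N`. -/
def lp (N : Type) [AddCommGroup N] [Module A N] : ModuleCat.{0} A → Prop :=
  fun X => Module.Finite A X ∧ ∀ g : X →ₗ[A] N, g = 0

/-- the torsion-free class of modules without nonzero maps from `C`. -/
def rp (C : Type) [AddCommGroup C] [Module A C] : ModuleCat.{0} A → Prop :=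
  fun X => Module.Finite A X ∧ ∀ g : C →ₗ[A] X, g = 0

lemma lp_tors (N : Type) [AddCommGroup N] [Module A N] : IsTorsionClass A (lp (A := A) N) where
  fin M h := h.1
  zero M h := by
    have hs : Subsingleton M := ⟨fun a b => by rw [h a, h b]⟩
    exact ⟨inferInstance, fun g => LinearMap.ext fun x => by rw [h x, map_zero]; rfl⟩
  quot := by
    rintro M P h hP ⟨q, hq⟩
    refine ⟨hP, fun g => LinearMap.ext fun x => ?_⟩
    obtain ⟨y, rfl⟩ := hq x
    exact LinearMap.congr_fun (h.2 (g.comp q)) y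
  ext := by
    rintro M hM L h1 h2
    refine ⟨hM, fun g => ?_⟩
    have hk : L ≤ LinearMap.ker g := by
      intro x hx
      exact LinearMap.congr_fun (h1.2 (g.comp L.subtype)) ⟨x, hx⟩
    have := h2.2 (L.liftQ g hk)
    refine LinearMap.ext fun x => ?_
    exact LinearMap.congr_fun this (L.mkQ x)

lemma rp_torf (C : Type) [AddCommGroup C] [Module A C] : IsTorsionFreeClass A (rp (A := A) C) where
  fin M h := h.1
  zero M h := by
    have hs : Subsingleton M := ⟨fun a b => by rw [h a, h b]⟩
    exact ⟨inferInstance, fun g => LinearMap.ext fun x => h _⟩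
  sub := by
    rintro M P h hP ⟨q, hq⟩
    refine ⟨hP, fun g => LinearMap.ext fun x => hq ?_⟩
    rw [LinearMap.zero_apply, map_zero]
    exact LinearMap.congr_fun (h.2 (q.comp g)) x
  ext := by
    rintro M hM L h1 h2
    refine ⟨hM, fun g => ?_⟩
    have hk : ∀ x, g x ∈ L := by
      intro x
      exact (Submodule.Quotient.mk_eq_zero _).1 (LinearMap.congr_fun (h2.2 (L.mkQ.comp g)) x)
    refine LinearMap.ext fun x => ?_
    exact congrArg Subtype.val (LinearMap.congr_fun (h1.2 (g.codRestrict L hk)) x)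

lemma rightPerp_torf (T : ModuleCat.{0} A → Prop) : IsTorsionFreeClass A (rightPerp A T) where
  fin M h := h.1
  zero M h := ⟨((rp_torf A).zero M h).1, fun C _ => ((rp_torf C).zero M h).2⟩
  sub := fun M P h hP hs => ⟨hP, fun C hC => ((rp_torf C).sub M P ⟨h.1, h.2 C hC⟩ hP hs).2⟩
  ext := fun M hM L h1 h2 => ⟨hM, fun C hC => 
    ((rp_torf C).ext M hM L ⟨h1.1, h1.2 C hC⟩ ⟨h2.1, h2.2 C hC⟩).2⟩

lemma cocompact_of_lp [IsNoetherianRing A] [IsArtinianRing A] (N : Type) [AddCommGroup N] [Module A N]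
    [hN : Module.Finite A N] : IsCocompactTors A (lp (A := A) N) := by
  refine ⟨ModuleCat.of A N, hN, funext fun X => propext ⟨?_, ?_⟩⟩
  · intro hX F hF hFN
    have hX1 : Module.Finite A X := hX.1
    obtain ⟨X', h1, h2⟩ := torf_min hF X
    have hz := hX.2 (ModuleCat.of A X') ⟨inferInstanceAs (Module.Finite A X'), fun g => h2 N (hFN _ rfl) g⟩ X'.subtype
    refine hF.sub' (N := X) h1 X'.mkQ ?_
    rw [← LinearMap.ker_eq_bot, Submodule.ker_mkQ, eq_bot_iff]
    intro x hx
    exact LinearMap.congr_fun hz ⟨x, hx⟩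
  · intro hX
    refine hX _ (rightPerp_torf _) ?_
    rintro Y rfl
    exact ⟨hN, fun M hM g => hM.2 g⟩

/-- membership in a torsion class by orthogonality. -/
lemma mem_of_perp [IsNoetherianRing A] {T : ModuleCat.{0} A → Prop} (hT : IsTorsionClass A T)
    (X : Type) [AddCommGroup X] [Module A X] [hX : Module.Finite A X]
    (h : ∀ (Y : Type) [AddCommGroup Y] [Module A Y], rightPerp A T (ModuleCat.of A Y) → ∀ g : X →ₗ[A] Y, g = 0) :
    T (ModuleCat.of A X) := by
  obtain ⟨X', h1, h2, -⟩ := tors_max hT X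
  have := h (X ⧸ X') ⟨inferInstanceAs (Module.Finite A (X ⧸ X')), fun M hM g => h2 M hM g⟩ X'.mkQ
  refine hT.quot' h1 X'.subtype ?_
  intro x
  exact ⟨⟨x, (Submodule.Quotient.mk_eq_zero _).1 (LinearMap.congr_fun this x)⟩, rfl⟩

lemma tors_eq_of_perp [IsNoetherianRing A] {T T' : ModuleCat.{0} A → Prop} (hT : IsTorsionClass A T)
    (hT' : IsTorsionClass A T') (h : rightPerp A T = rightPerp A T') : T = T' := by
  funext X
  refine propext ⟨fun hX => ?_, fun hX => ?_⟩
  · have : Module.Finite A X := hT.fin _ hX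
    refine mem_of_perp hT' X fun Y _ _ hY g => ?_
    rw [← h] at hY
    exact hY.2 X hX g
  · have : Module.Finite A X := hT'.fin _ hX
    refine mem_of_perp hT X fun Y _ _ hY g => ?_
    rw [h] at hY
    exact hY.2 X hX g

lemma compact_of_rp [IsNoetherianRing A] {T : ModuleCat.{0} A → Prop} (hT : IsTorsionClass A T) (C : Type) [AddCommGroup C] [Module A C]
    [hC : Module.Finite A C] (h : rightPerp A T = rp (A := A) C) : IsCompactTors A T := by
  refine ⟨ModuleCat.of A C, hC, funext fun X => propext ⟨?_, ?_⟩⟩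
  · intro hX T' hT' hTC
    have hX1 : Module.Finite A X := hT.fin _ hX
    refine mem_of_perp hT' X fun Y _ _ hY g => ?_
    have : rightPerp A T (ModuleCat.of A Y) := by
      rw [h]
      exact ⟨hY.1, fun g => hY.2 _ (hTC _ rfl) g⟩
    exact this.2 X hX g
  · intro hX
    refine hX T hT ?_
    rintro Y rfl
    refine mem_of_perp hT C fun Y _ _ hY g => ?_
    rw [h] at hY
    exact hY.2 g

/-- functorially finite torsion classes are compact. -/
lemma compact_of_ff [IsNoetherianRing A] {T : ModuleCat.{0} A → Prop} (hT : IsTorsionClass A T)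
    (h : FunctoriallyFinite A T) : IsCompactTors A T := by
  obtain ⟨X, f, hX, hf⟩ := h.1 (ModuleCat.of A A) (inferInstanceAs (Module.Finite A A))
  refine ⟨X, hT.fin _ hX, funext fun Y => propext ⟨?_, ?_⟩⟩
  · intro hY T' hT' hTX
    have hY1 : Module.Finite A Y := hT.fin _ hY
    refine mem_of_perp hT' Y fun Z _ _ hZ g => ?_
    refine LinearMap.ext fun y => ?_
    obtain ⟨k, hk⟩ := hf Y hY (LinearMap.toSpanSingleton A Y y)
    have h1 := LinearMap.congr_fun hk (1 : A)
    have h2 : k (f (1 : A)) = y := by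
      refine h1.trans ?_
      exact one_smul A y
    have := LinearMap.congr_fun (hZ.2 X (hTX X rfl) (g.comp k)) (f (1 : A))
    rw [LinearMap.comp_apply, h2] at this
    exact this
  · intro hY
    refine hY T hT ?_
    rintro Z rfl
    exact hX

/-- right approximations for torsion classes. -/
lemma ff_of_left [IsNoetherianRing A] {T : ModuleCat.{0} A → Prop} (hT : IsTorsionClass A T)
    (h : ∀ (M : Type) [AddCommGroup M] [Module A M] [Module.Finite A M],
    ∃ (X : Type) (_ : AddCommGroup X) (_ : Module A X) (f : M →ₗ[A] X), T (ModuleCat.of A X) ∧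
      ∀ (Y : Type) [AddCommGroup Y] [Module A Y], T (ModuleCat.of A Y) → ∀ g : M →ₗ[A] Y, ∃ h : X →ₗ[A] Y, h.comp f = g) :
    FunctoriallyFinite A T := by
  refine ⟨fun M hM => ?_, fun M hM => ?_⟩
  · obtain ⟨X, i1, i2, f, hX, hf⟩ := h M
    exact ⟨ModuleCat.of A X, f, hX, fun Y hY g => hf Y hY g⟩
  · obtain ⟨X', h1, -, h2⟩ := tors_max hT M
    exact ⟨ModuleCat.of A X', X'.subtype, h1, fun Y hY g => ⟨g.codRestrict X' (h2 Y hY g), rfl⟩⟩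

lemma torsClosure_le {M : ModuleCat.{0} A} {T : ModuleCat.{0} A → Prop} (hT : IsTorsionClass A T) (h : T M) 
    {X : ModuleCat.{0} A} (hX : torsClosure A (fun X => X = M) X) : T X :=
  hX T hT (by rintro Y rfl; exact h)

lemma torfClosure_le {M : ModuleCat.{0} A} {T : ModuleCat.{0} A → Prop} (hT : IsTorsionFreeClass A T) (h : T M) 
    {X : ModuleCat.{0} A} (hX : torfClosure A (fun X => X = M) X) : T X :=
  hX T hT (by rintro Y rfl; exact h)

lemma torsClosure_self (M : ModuleCat.{0} A) : torsClosure A (fun X => X = M) M :=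
  fun _ _ h => h _ rfl

lemma torfClosure_self (M : ModuleCat.{0} A) : torfClosure A (fun X => X = M) M :=
  fun _ _ h => h _ rfl

end Tors
end TorsPaper

namespace TorsPaper
section ThetaTors
open Module

variable {A : Type} [Ring A] {θ : ModuleCat.{0} A → ℝ}

lemma theta_sub' [IsNoetherianRing A] (hθ : IsStability A θ)
    (M : Type) [AddCommGroup M] [Module A M] [Module.Finite A M] (N : Submodule A M) :
    θ (ModuleCat.of A M) = θ (ModuleCat.of A N) + θ (ModuleCat.of A (M ⧸ N)) :=
  theta_sub hθ M N

lemma tTheta_iff (hθ : IsStability A θ) {M : Type} [AddCommGroup M] [Module A M] [hM : Module.Finite A M] :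
    tTheta A θ (ModuleCat.of A M) ↔ ∀ L : Submodule A M, L ≠ ⊤ → 0 < θ (ModuleCat.of A (M ⧸ L)) := by
  constructor
  · intro h L hL
    refine h.2 _ (inferInstanceAs (Module.Finite A (M ⧸ L))) ⟨L.mkQ, L.mkQ_surjective⟩ ?_
    have : Nontrivial (M ⧸ L) := Submodule.Quotient.nontrivial_iff.2 hL
    exact exists_ne (0 : M ⧸ L)
  · intro h
    refine ⟨hM, ?_⟩
    rintro N hN ⟨q, hq⟩ ⟨x, hx⟩
    let q' : M →ₗ[A] N := q
    have hq' : Function.Surjective q' := hq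
    rw [← theta_iso hθ (ModuleCat.of A (M ⧸ LinearMap.ker q')) N (q'.quotKerEquivOfSurjective hq')
      (hM := inferInstanceAs (Module.Finite A (M ⧸ LinearMap.ker q')))]
    refine h _ fun ht => hx ?_
    obtain ⟨y, rfl⟩ := hq' x
    have : y ∈ LinearMap.ker q' := by rw [ht]; trivial
    exact this

lemma tThetaBar_iff (hθ : IsStability A θ) {M : Type} [AddCommGroup M] [Module A M] [hM : Module.Finite A M] :
    tThetaBar A θ (ModuleCat.of A M) ↔ ∀ L : Submodule A M, 0 ≤ θ (ModuleCat.of A (M ⧸ L)) := by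
  constructor
  · intro h L
    exact h.2 _ (inferInstanceAs (Module.Finite A (M ⧸ L))) ⟨L.mkQ, L.mkQ_surjective⟩
  · intro h
    refine ⟨hM, ?_⟩
    rintro N hN ⟨q, hq⟩
    let q' : M →ₗ[A] N := q
    have hq' : Function.Surjective q' := hq
    rw [← theta_iso hθ (ModuleCat.of A (M ⧸ LinearMap.ker q')) N (q'.quotKerEquivOfSurjective hq')
      (hM := inferInstanceAs (Module.Finite A (M ⧸ LinearMap.ker q')))]
    exact h _

lemma fTheta_iff [IsNoetherianRing A] (hθ : IsStability A θ) {M : Type} [AddCommGroup M] [Module A M] [hM : Module.Finite A M] :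
    fTheta A θ (ModuleCat.of A M) ↔ ∀ L : Submodule A M, L ≠ ⊥ → θ (ModuleCat.of A L) < 0 := by
  constructor
  · intro h L hL
    refine h.2 _ (inferInstanceAs (Module.Finite A L)) ⟨L.subtype, L.injective_subtype⟩ ?_
    have : Nontrivial L := Submodule.nontrivial_iff_ne_bot.2 hL
    exact exists_ne (0 : L)
  · intro h
    refine ⟨hM, ?_⟩
    rintro N hN ⟨q, hq⟩ ⟨x, hx⟩
    let q' : N →ₗ[A] M := q
    have hq' : Function.Injective q' := hq
    rw [theta_iso hθ N (ModuleCat.of A (LinearMap.range q')) (LinearEquiv.ofInjective q' hq')]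
    refine h _ fun ht => hx (hq' ?_)
    have : q' x ∈ LinearMap.range q' := ⟨x, rfl⟩
    rw [ht] at this
    rw [map_zero]
    exact this

lemma fThetaBar_iff [IsNoetherianRing A] (hθ : IsStability A θ) {M : Type} [AddCommGroup M] [Module A M] [hM : Module.Finite A M] :
    fThetaBar A θ (ModuleCat.of A M) ↔ ∀ L : Submodule A M, θ (ModuleCat.of A L) ≤ 0 := by
  constructor
  · intro h L
    exact h.2 _ (inferInstanceAs (Module.Finite A L)) ⟨L.subtype, L.injective_subtype⟩
  · intro h
    refine ⟨hM, ?_⟩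
    rintro N hN ⟨q, hq⟩
    let q' : N →ₗ[A] M := q
    have hq' : Function.Injective q' := hq
    rw [theta_iso hθ N (ModuleCat.of A (LinearMap.range q')) (LinearEquiv.ofInjective q' hq')]
    exact h _

lemma IsQuotientOf.trans {L M N : ModuleCat.{0} A} (h : IsQuotientOf A L M) (h' : IsQuotientOf A M N) :
    IsQuotientOf A L N := by
  obtain ⟨f, hf⟩ := h
  obtain ⟨g, hg⟩ := h'
  exact ⟨f.comp g, hf.comp hg⟩

lemma ext_quot [IsNoetherianRing A] (hθ : IsStability A θ) {M : ModuleCat.{0} A} (hM : Module.Finite A M) (N : Submodule A M)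
    (Q : ModuleCat.{0} A) (hQ : Module.Finite A Q) (h : IsQuotientOf A Q M) :
    ∃ P : Submodule A Q, IsQuotientOf A (ModuleCat.of A P) (ModuleCat.of A N) ∧
      IsQuotientOf A (ModuleCat.of A (Q ⧸ P)) (ModuleCat.of A (M ⧸ N)) ∧
      θ Q = θ (ModuleCat.of A P) + θ (ModuleCat.of A (Q ⧸ P)) := by
  obtain ⟨q, hq⟩ := h
  refine ⟨N.map q, ⟨q.submoduleMap N, q.submoduleMap_surjective N⟩,
    ⟨N.mapQ (N.map q) q (Submodule.map_le_iff_le_comap.1 le_rfl), ?_⟩, theta_sub' hθ Q _⟩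
  intro z
  obtain ⟨y, rfl⟩ := (N.map q).mkQ_surjective z
  obtain ⟨x, rfl⟩ := hq y
  exact ⟨N.mkQ x, rfl⟩

lemma zero_of_quot {Q M : ModuleCat.{0} A} (h : IsQuotientOf A Q M) (hM : ∀ x : M, x = 0) (x : Q) : x = 0 := by
  obtain ⟨q, hq⟩ := h
  obtain ⟨y, rfl⟩ := hq x
  rw [hM y, map_zero]

lemma tTheta_tors [IsNoetherianRing A] (hθ : IsStability A θ) : IsTorsionClass A (tTheta A θ) where
  fin M h := h.1
  zero M h := by
    have hs : Subsingleton M := ⟨fun a b => by rw [h a, h b]⟩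
    refine ⟨inferInstance, fun N hN hq ⟨x, hx⟩ => (hx (zero_of_quot hq h x)).elim⟩
  quot M N h hN hq := ⟨hN, fun P hP hPq hPn => h.2 P hP (hPq.trans hq) hPn⟩
  ext M hM N h1 h2 := by
    refine ⟨hM, fun Q hQ hq hn => ?_⟩
    obtain ⟨P, hP1, hP2, hP⟩ := ext_quot hθ hM N Q hQ hq
    rw [hP]
    have f1 : Module.Finite A P := inferInstance
    have f2 : Module.Finite A (Q ⧸ P) := inferInstance
    by_cases z1 : Nonzero A (ModuleCat.of A P)
    · have p1 := h1.2 _ f1 hP1 z1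
      by_cases z2 : Nonzero A (ModuleCat.of A (Q ⧸ P))
      · have p2 := h2.2 _ f2 hP2 z2
        linarith
      · have := theta_zero hθ (ModuleCat.of A (Q ⧸ P)) (by simpa [Nonzero] using z2)
        linarith
    · have e1 := theta_zero hθ (ModuleCat.of A P) (by
        intro x
        by_contra hx
        exact z1 ⟨x, hx⟩)
      have z2 : Nonzero A (ModuleCat.of A (Q ⧸ P)) := by
        obtain ⟨x, hx⟩ := hn
        refine ⟨P.mkQ x, fun h0 => z1 ⟨⟨x, (Submodule.Quotient.mk_eq_zero _).1 h0⟩, fun h => hx ?_⟩⟩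
        exact congrArg Subtype.val h
      have p2 := h2.2 _ f2 hP2 z2
      linarith

lemma tThetaBar_tors [IsNoetherianRing A] (hθ : IsStability A θ) : IsTorsionClass A (tThetaBar A θ) where
  fin M h := h.1
  zero M h := by
    have hs : Subsingleton M := ⟨fun a b => by rw [h a, h b]⟩
    refine ⟨inferInstance, fun N hN hq => (theta_zero hθ N (zero_of_quot hq h)).ge⟩
  quot M N h hN hq := ⟨hN, fun P hP hPq => h.2 P hP (hPq.trans hq)⟩
  ext M hM N h1 h2 := by
    refine ⟨hM, fun Q hQ hq => ?_⟩
    obtain ⟨P, hP1, hP2, hP⟩ := ext_quot hθ hM N Q hQ hq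
    rw [hP]
    have f1 : Module.Finite A P := inferInstance
    have f2 : Module.Finite A (Q ⧸ P) := inferInstance
    exact add_nonneg (h1.2 _ f1 hP1) (h2.2 _ f2 hP2)

/-- submodule of a submodule seen in the ambient module. -/
lemma theta_map_subtype [IsNoetherianRing A] (hθ : IsStability A θ) {M : Type} [AddCommGroup M] [Module A M]
    [Module.Finite A M] (L : Submodule A M) (L' : Submodule A L) :
    θ (ModuleCat.of A L') = θ (ModuleCat.of A (L'.map L.subtype)) :=
  theta_iso hθ (ModuleCat.of A L') (ModuleCat.of A (L'.map L.subtype))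
    (Submodule.equivMapOfInjective L.subtype L.injective_subtype L')
    (hM := inferInstanceAs (Module.Finite A L'))

lemma map_subtype_lt {M : Type} [AddCommGroup M] [Module A M]
    (L : Submodule A M) (L' : Submodule A L) (h : L' ≠ ⊤) : L'.map L.subtype < L := by
  refine lt_of_le_of_ne (Submodule.map_subtype_le _ _) fun he => h ?_
  rw [eq_top_iff]
  rintro ⟨x, hx⟩ -
  have hx' := hx
  rw [← he] at hx'
  obtain ⟨y, hy, h2⟩ := hx'
  have : y = ⟨x, hx⟩ := Subtype.ext h2
  rwa [← this]

lemma perp_tTheta [IsNoetherianRing A] [IsArtinianRing A] (hθ : IsStability A θ) :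
    rightPerp A (tTheta A θ) = fThetaBar A θ := by
  funext X
  refine propext ⟨fun h => ?_, fun h => ⟨h.1, fun M hM g => ?_⟩⟩
  · have hX : Module.Finite A X := h.1
    refine (fThetaBar_iff (M := X) hθ).2 ?_
    by_contra! hL
    obtain ⟨L, hL⟩ := hL
    have : IsArtinian A X := inferInstance
    obtain ⟨L', hL', hmin⟩ := IsArtinian.set_has_minimal
      {L : Submodule A X | 0 < θ (ModuleCat.of A L)} ⟨L, hL⟩
    have ht : tTheta A θ (ModuleCat.of A L') := by
      refine (tTheta_iff hθ).2 fun P hP => ?_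
      have h1 := theta_sub' hθ L' P
      rw [theta_map_subtype hθ L' P] at h1
      have h2 := hmin (P.map L'.subtype)
      have h3 : ¬ 0 < θ (ModuleCat.of A (P.map L'.subtype)) := fun h0 => h2 h0 (map_subtype_lt _ _ hP)
      have h4 : 0 < θ (ModuleCat.of A L') := hL'
      linarith
    have hz := h.2 _ ht L'.subtype
    have := theta_zero hθ (ModuleCat.of A L') (fun x => Subtype.ext (LinearMap.congr_fun hz x))
    exact absurd hL' (by rw [Set.mem_setOf_eq, this]; exact lt_irrefl _)
  · have hX : Module.Finite A X := h.1
    have hM1 := hM.1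
    by_contra hg
    have hn : Nonzero A (ModuleCat.of A (LinearMap.range g)) := by
      by_contra hn
      refine hg (LinearMap.ext fun x => ?_)
      by_contra hx
      exact hn ⟨⟨g x, x, rfl⟩, fun h => hx (congrArg Subtype.val h)⟩
    have h1 := hM.2 (ModuleCat.of A (LinearMap.range g)) (inferInstanceAs (Module.Finite A (LinearMap.range g)))
      ⟨g.rangeRestrict, g.surjective_rangeRestrict⟩ hn
    have h2 := h.2 (ModuleCat.of A (LinearMap.range g)) (inferInstanceAs (Module.Finite A (LinearMap.range g)))
      ⟨(LinearMap.range g).subtype, (LinearMap.range g).injective_subtype⟩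
    linarith

lemma perp_tThetaBar [IsNoetherianRing A] [IsArtinianRing A] (hθ : IsStability A θ) :
    rightPerp A (tThetaBar A θ) = fTheta A θ := by
  funext X
  refine propext ⟨fun h => ?_, fun h => ⟨h.1, fun M hM g => ?_⟩⟩
  · have hX : Module.Finite A X := h.1
    refine (fTheta_iff (M := X) hθ).2 ?_
    by_contra! hL
    obtain ⟨L, hL0, hL⟩ := hL
    have : IsArtinian A X := inferInstance
    obtain ⟨L', ⟨hL0', hL'⟩, hmin⟩ := IsArtinian.set_has_minimal
      {L : Submodule A X | L ≠ ⊥ ∧ 0 ≤ θ (ModuleCat.of A L)} ⟨L, hL0, hL⟩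
    have ht : tThetaBar A θ (ModuleCat.of A L') := by
      refine (tThetaBar_iff hθ).2 fun P => ?_
      have h1 := theta_sub' hθ L' P
      by_cases hP : P = ⊤
      · subst hP
        exact (theta_zero hθ _ (fun x => Subsingleton.elim (α := (L' ⧸ (⊤ : Submodule A L'))) x 0)).ge
      rw [theta_map_subtype hθ L' P] at h1
      have h2 := hmin (P.map L'.subtype)
      by_cases hP0 : P.map L'.subtype = ⊥
      · have := theta_zero hθ (ModuleCat.of A (P.map L'.subtype)) (by
          rw [hP0]
          exact fun x => Subsingleton.elim (α := (⊥ : Submodule A X)) x 0)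
        linarith
      have h3 : ¬ 0 ≤ θ (ModuleCat.of A (P.map L'.subtype)) := fun h0 => h2 ⟨hP0, h0⟩ (map_subtype_lt _ _ hP)
      linarith
    have hz := h.2 _ ht L'.subtype
    refine hL0' (eq_bot_iff.2 fun x hx => ?_)
    exact LinearMap.congr_fun hz ⟨x, hx⟩
  · have hX : Module.Finite A X := h.1
    have hM1 := hM.1
    by_contra hg
    have hn : Nonzero A (ModuleCat.of A (LinearMap.range g)) := by
      by_contra hn
      refine hg (LinearMap.ext fun x => ?_)
      by_contra hx
      exact hn ⟨⟨g x, x, rfl⟩, fun h => hx (congrArg Subtype.val h)⟩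
    have h1 := hM.2 (ModuleCat.of A (LinearMap.range g)) (inferInstanceAs (Module.Finite A (LinearMap.range g)))
      ⟨g.rangeRestrict, g.surjective_rangeRestrict⟩
    have h2 := h.2 (ModuleCat.of A (LinearMap.range g)) (inferInstanceAs (Module.Finite A (LinearMap.range g)))
      ⟨(LinearMap.range g).subtype, (LinearMap.range g).injective_subtype⟩ hn
    linarith

end ThetaTors
end TorsPaper

namespace TorsPaper
section DatumSec
open Module

lemma IsS.isI {K A : Type} [Field K] [Ring A] [Algebra K A] {J0 J1 : Type} [Fintype J0] [Fintype J1]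
    {ε0 : J0 → A} {ε1 : J1 → A} {f : J1 → J0 → A}
    (hf : PF ε0 ε1 f) {M : Type} [AddCommGroup M] [Module A M] [Module K M] [IsScalarTower K A M]
    [FiniteDimensional K M] (h : IsS ε1 f M)
    (h2 : ∑ j, finrank K (eP K (ε0 j) M) ≤ ∑ i, finrank K (eP K (ε1 i) M)) : IsI ε0 f M := by
  have h3 := le_antisymm h2 (h.dim (K := K) hf)
  rw [isS_of_surj (K := K) hf] at h
  rw [isI_of_inj (K := K) hf]
  rw [← finrank_pi_fintype, ← finrank_pi_fintype] at h3
  exact (LinearMap.injective_iff_surjective_of_finrank_eq_finrank h3).2 h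

/-- A matrix `f` adapted to the stability function `θ`. -/
structure Datum {A : Type} [Ring A] (θ : ModuleCat.{0} A → ℝ) {J0 J1 : Type} [Fintype J0] [DecidableEq J0]
    (ε0 : J0 → A) (ε1 : J1 → A) (f : J1 → J0 → A) : Prop where
  pf : PF ε0 ε1 f
  dS : ∀ (X : Type) [AddCommGroup X] [Module A X] [Module.Finite A X], IsS ε1 f X → 0 ≤ θ (ModuleCat.of A X)
  dI : ∀ (X : Type) [AddCommGroup X] [Module A X] [Module.Finite A X], IsI ε0 f X → θ (ModuleCat.of A X) ≤ 0
  dIS : ∀ (X : Type) [AddCommGroup X] [Module A X] [Module.Finite A X], IsI ε0 f X →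
    0 ≤ θ (ModuleCat.of A X) → IsS ε1 f X
  dSI : ∀ (X : Type) [AddCommGroup X] [Module A X] [Module.Finite A X], IsS ε1 f X →
    θ (ModuleCat.of A X) ≤ 0 → IsI ε0 f X
  sK : ∃ (N : Type) (_ : AddCommGroup N) (_ : Module A N) (_ : Module.Finite A N),
    ∀ (X : Type) [AddCommGroup X] [Module A X] [Module.Finite A X], IsS ε1 f X ↔ ∀ g : X →ₗ[A] N, g = 0
  la : IsS ε1 f (Cf ε0 f) → ∀ (M : Type) [AddCommGroup M] [Module A M] [Module.Finite A M],
    ∃ (X : Type) (_ : AddCommGroup X) (_ : Module A X) (_ : Module.Finite A X) (ι : M →ₗ[A] X),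
      IsS ε1 f X ∧ ∀ (Y : Type) [AddCommGroup Y] [Module A Y], IsS ε1 f Y → ∀ g : M →ₗ[A] Y,
        ∃ h : X →ₗ[A] Y, h.comp ι = g

variable {A : Type} [Ring A] {θ : ModuleCat.{0} A → ℝ}

/-- the scalar tower given by restriction of scalars -/
lemma tower_compHom (K : Type) [Field K] [Algebra K A] (M : Type) [AddCommGroup M] [Module A M] :
    letI : Module K M := Module.compHom M (algebraMap K A)
    IsScalarTower K A M := by
  let _ : Module K M := Module.compHom M (algebraMap K A)
  exact ⟨fun k a m => by rw [Algebra.smul_def, mul_smul]; rfl⟩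

lemma datum_mk (K : Type) [Field K] [Algebra K A] [FiniteDimensional K A] 
    {J0 J1 : Type} [Fintype J0] [DecidableEq J0] [Fintype J1]
    {ε0 : J0 → A} {ε1 : J1 → A} {f : J1 → J0 → A} (hf : PF ε0 ε1 f) (n : ℕ) (hn : 0 < n)
    (h : ∀ (M : Type) [AddCommGroup M] [Module A M] [Module K M] [IsScalarTower K A M] [Module.Finite A M],
      n * θ (ModuleCat.of A M) = (∑ j, finrank K (eP K (ε0 j) M) : ℕ) - (∑ i, finrank K (eP K (ε1 i) M) : ℕ)) :
    Datum θ ε0 ε1 f := by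
  have hn' : (0 : ℝ) < n := by exact_mod_cast hn
  refine ⟨hf, ?_, ?_, ?_, ?_, ?_, ?_⟩
  · intro X _ _ _ hX
    let _ : Module K X := Module.compHom X (algebraMap K A)
    have : IsScalarTower K A X := tower_compHom K X
    have : FiniteDimensional K X := Module.Finite.trans A X
    have h1 := h X
    have h2 := hX.dim (K := K) hf
    have h3 : ((∑ i, finrank K (eP K (ε1 i) X) : ℕ) : ℝ) ≤ (∑ j, finrank K (eP K (ε0 j) X) : ℕ) := by
      exact_mod_cast h2
    have : 0 ≤ n * θ (ModuleCat.of A X) := by linarith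
    exact nonneg_of_mul_nonneg_right this hn'
  · intro X _ _ _ hX
    let _ : Module K X := Module.compHom X (algebraMap K A)
    have : IsScalarTower K A X := tower_compHom K X
    have : FiniteDimensional K X := Module.Finite.trans A X
    have h1 := h X
    have h2 := hX.dim (K := K) hf
    have h3 : ((∑ j, finrank K (eP K (ε0 j) X) : ℕ) : ℝ) ≤ (∑ i, finrank K (eP K (ε1 i) X) : ℕ) := by
      exact_mod_cast h2
    have : n * θ (ModuleCat.of A X) ≤ 0 := by linarith
    by_contra! h4
    have := mul_pos hn' h4
    linarith
  · intro X _ _ _ hX h0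
    let _ : Module K X := Module.compHom X (algebraMap K A)
    have : IsScalarTower K A X := tower_compHom K X
    have : FiniteDimensional K X := Module.Finite.trans A X
    have h1 := h X
    refine hX.isS (K := K) hf ?_
    have := mul_nonneg hn'.le h0
    have h3 : ((∑ i, finrank K (eP K (ε1 i) X) : ℕ) : ℝ) ≤ (∑ j, finrank K (eP K (ε0 j) X) : ℕ) := by
      linarith
    exact_mod_cast h3
  · intro X _ _ _ hX h0
    let _ : Module K X := Module.compHom X (algebraMap K A)
    have : IsScalarTower K A X := tower_compHom K X
    have : FiniteDimensional K X := Module.Finite.trans A X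
    have h1 := h X
    refine hX.isI (K := K) hf ?_
    have := mul_nonneg hn'.le (neg_nonneg.2 h0)
    have h3 : ((∑ j, finrank K (eP K (ε0 j) X) : ℕ) : ℝ) ≤ (∑ i, finrank K (eP K (ε1 i) X) : ℕ) := by
      linarith
    exact_mod_cast h3
  · refine ⟨Kf K ε1 f, inferInstance, inferInstance, inferInstance, ?_⟩
    intro X _ _ _
    let _ : Module K X := Module.compHom X (algebraMap K A)
    have : IsScalarTower K A X := tower_compHom K X
    exact isS_iff_Kf (K := K) hf
  · intro hC M _ _ _
    let _ : Module K M := Module.compHom M (algebraMap K A)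
    have : IsScalarTower K A M := tower_compHom K M
    exact left_approx_S (K := K) hf hC M

lemma rep_prod (K : Type) [Field K] [Algebra K A] {I0 I1 : Type} [Fintype I0] [Fintype I1] {ε0 : I0 → A} {ε1 : I1 → A}
    (h : ∀ (M : Type) [AddCommGroup M] [Module A M] [Module K M] [IsScalarTower K A M] [Module.Finite A M],
      θ (ModuleCat.of A M) = (∑ j, finrank K (eP K (ε0 j) M) : ℕ) - (∑ i, finrank K (eP K (ε1 i) M) : ℕ))
    (ℓ : Type) [Fintype ℓ] (M : Type) [AddCommGroup M] [Module A M] [Module K M] [IsScalarTower K A M] [Module.Finite A M] :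
      (Fintype.card ℓ : ℕ) * θ (ModuleCat.of A M) = (∑ j : I0 × ℓ, finrank K (eP K (ε0 j.1) M) : ℕ)
        - (∑ i : I1 × ℓ, finrank K (eP K (ε1 i.1) M) : ℕ) := by
  rw [h M, Fintype.sum_prod_type, Fintype.sum_prod_type]
  push_cast
  rw [mul_sub, Finset.mul_sum, Finset.mul_sum]
  congr 1
  · refine Finset.sum_congr rfl fun j _ => ?_
    exact ((Finset.sum_const ((finrank K (eP K (ε0 j) M) : ℕ) : ℝ)).trans
      (by rw [Finset.card_univ, nsmul_eq_mul])).symm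
  · refine Finset.sum_congr rfl fun j _ => ?_
    exact ((Finset.sum_const ((finrank K (eP K (ε1 j) M) : ℕ) : ℝ)).trans
      (by rw [Finset.card_univ, nsmul_eq_mul])).symm

/-- existence of data -/
lemma exists_datum_both (K : Type) [Field K] [IsAlgClosed K] [Algebra K A] [FiniteDimensional K A]
    (hθ : IsStability A θ)
    (hint : ∀ M : ModuleCat.{0} A, Module.Finite A M → ∃ k : ℤ, θ M = (k : ℝ))
    (M : Type) [AddCommGroup M] [Module A M] [Module.Finite A M] (hM : tThetaBar A θ (ModuleCat.of A M))
    (N : Type) [AddCommGroup N] [Module A N] [Module.Finite A N] (hN : fThetaBar A θ (ModuleCat.of A N)) :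
    ∃ (J0 J1 : Type) (_ : Fintype J0) (_ : DecidableEq J0) (ε0 : J0 → A) (ε1 : J1 → A) (f : J1 → J0 → A),
      Datum θ ε0 ε1 f ∧ IsS ε1 f M ∧ IsI ε0 f N := by
  classical
  have : IsNoetherianRing A := isNoetherian_of_tower K inferInstance
  have : Infinite K := IsAlgClosed.instInfinite
  obtain ⟨I0, I1, _, _, ε0, ε1, h0, h1, hr⟩ := theta_rep' K A θ hθ hint
  let _ : Module K M := Module.compHom M (algebraMap K A)
  have : IsScalarTower K A M := tower_compHom K M
  have : FiniteDimensional K M := Module.Finite.trans A M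
  let _ : Module K N := Module.compHom N (algebraMap K A)
  have : IsScalarTower K A N := tower_compHom K N
  have : FiniteDimensional K N := Module.Finite.trans A N
  obtain ⟨ℓ1, _, _, f1, hf1⟩ := exists_size_surj K ε0 ε1 h0 h1 M (by
    intro L
    have := (tThetaBar_iff hθ).1 hM L
    rw [hr (M ⧸ L), sub_nonneg] at this
    exact_mod_cast this)
  obtain ⟨ℓ2, _, _, f2, hf2⟩ := exists_size_inj K ε0 ε1 h0 h1 N (by
    intro L
    have := (fThetaBar_iff hθ).1 hN L
    rw [hr L, sub_nonpos] at this
    exact_mod_cast this)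
  obtain ⟨ℓ, _, _, f, hf, hS, hI⟩ := exists_common (K := K) ε0 ε1 h0 h1 f1 f2 M N hf1 hf2
  exact ⟨I0 × ℓ, I1 × ℓ, inferInstance, inferInstance, _, _, f,
    datum_mk K hf (Fintype.card ℓ) Fintype.card_pos (fun M _ _ _ _ _ => rep_prod K hr ℓ M), hS, hI⟩

end DatumSec
end TorsPaper

namespace TorsPaper
section Concl
open Module

variable {A : Type} [Ring A] {θ : ModuleCat.{0} A → ℝ}
variable {J0 J1 : Type} [Fintype J0] [DecidableEq J0] {ε0 : J0 → A} {ε1 : J1 → A} {f : J1 → J0 → A}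

lemma Datum.S_le (D : Datum θ ε0 ε1 f) (hθ : IsStability A θ) (X : Type) [AddCommGroup X] [Module A X]
    [Module.Finite A X] (h : IsS ε1 f X) : tThetaBar A θ (ModuleCat.of A X) :=
  (tThetaBar_iff hθ).2 fun L => D.dS _ (h.quot L.mkQ L.mkQ_surjective)

lemma Datum.I_le [IsNoetherianRing A] (D : Datum θ ε0 ε1 f) (hθ : IsStability A θ) (X : Type) [AddCommGroup X] [Module A X]
    [Module.Finite A X] (h : IsI ε0 f X) : fThetaBar A θ (ModuleCat.of A X) :=
  (fThetaBar_iff hθ).2 fun L => D.dI _ (h.sub L.subtype L.injective_subtype)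

lemma tTheta_le (hθ : IsStability A θ) {X : ModuleCat.{0} A} (h : tTheta A θ X) : tThetaBar A θ X := by
  refine ⟨h.1, fun N hN hq => ?_⟩
  by_cases hn : Nonzero A N
  · exact (h.2 N hN hq hn).le
  · refine (theta_zero hθ N fun x => ?_).ge
    by_contra hx
    exact hn ⟨x, hx⟩

lemma fTheta_le (hθ : IsStability A θ) {X : ModuleCat.{0} A} (h : fTheta A θ X) : fThetaBar A θ X := by
  refine ⟨h.1, fun N hN hq => ?_⟩
  by_cases hn : Nonzero A N
  · exact (h.2 N hN hq hn).le
  · refine (theta_zero hθ N fun x => ?_).le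
    by_contra hx
    exact hn ⟨x, hx⟩

section

lemma stepA (K : Type) [Field K] [IsAlgClosed K] [Algebra K A] [FiniteDimensional K A]
    [IsNoetherianRing A] [IsArtinianRing A] (hθ : IsStability A θ)
    (hint : ∀ M : ModuleCat.{0} A, Module.Finite A M → ∃ k : ℤ, θ M = (k : ℝ))
    (h : IsCompactTors A (tThetaBar A θ)) : IsCocompactTors A (tThetaBar A θ) := by
  obtain ⟨M, hM, hT⟩ := h
  have hM' : tThetaBar A θ M := by rw [hT]; exact torsClosure_self M
  have h0 : fThetaBar A θ (ModuleCat.of A PUnit) := (fThetaBar_iff hθ).2 fun L => 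
    (theta_zero hθ _ (fun x => Subsingleton.elim (α := L) x 0)).le
  obtain ⟨J0, J1, _, _, ε0, ε1, f, D, hS, -⟩ := exists_datum_both K hθ hint M hM' PUnit h0
  obtain ⟨N, _, _, hN, hSN⟩ := D.sK
  have : tThetaBar A θ = lp N := by
    funext X
    refine propext ⟨fun hX => ?_, fun hX => ?_⟩
    · rw [hT] at hX
      exact torsClosure_le (lp_tors N) ⟨hM, (hSN M).1 hS⟩ hX
    · have := hX.1
      exact D.S_le hθ X ((hSN X).2 hX.2)
  rw [this]
  exact cocompact_of_lp N

lemma stepB (K : Type) [Field K] [IsAlgClosed K] [Algebra K A] [FiniteDimensional K A]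
    [IsNoetherianRing A] [IsArtinianRing A] (hθ : IsStability A θ)
    (hint : ∀ M : ModuleCat.{0} A, Module.Finite A M → ∃ k : ℤ, θ M = (k : ℝ))
    (h : IsCocompactTors A (tTheta A θ)) : IsCompactTors A (tTheta A θ) := by
  obtain ⟨N, hN, hT⟩ := h
  rw [perp_tTheta hθ] at hT
  have hN' : fThetaBar A θ N := by rw [hT]; exact torfClosure_self N
  have h0 : tThetaBar A θ (ModuleCat.of A PUnit) := (tThetaBar_iff hθ).2 fun L => 
    (theta_zero hθ _ (fun x => Subsingleton.elim (α := PUnit ⧸ L) x 0)).ge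
  obtain ⟨J0, J1, _, _, ε0, ε1, f, D, -, hI⟩ := exists_datum_both K hθ hint PUnit h0 N hN'
  refine compact_of_rp (tTheta_tors hθ) (Cf ε0 f) ?_
  rw [perp_tTheta hθ]
  funext X
  refine propext ⟨fun hX => ?_, fun hX => ?_⟩
  · rw [hT] at hX
    exact torfClosure_le (rp_torf _) ⟨hN, (isI_iff_Cf D.pf).1 hI⟩ hX
  · have := hX.1
    exact D.I_le hθ X ((isI_iff_Cf D.pf).2 hX.2)

end

/-- length as a natural number -/
noncomputable def len (M : ModuleCat.{0} A) : ℕ := (Module.length A M).toNat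

lemma len_add [IsNoetherianRing A] [IsArtinianRing A] (L M N : ModuleCat.{0} A) (hL : Module.Finite A L)
    (hN : Module.Finite A N) (f : L →ₗ[A] M) (g : M →ₗ[A] N) (hf : Function.Injective f)
    (hg : Function.Surjective g) (h : LinearMap.range f = LinearMap.ker g) : len M = len L + len N := by
  have := Module.length_eq_add_of_exact f g hf hg (LinearMap.exact_iff.2 h.symm)
  rw [len, this, ENat.toNat_add Module.length_ne_top Module.length_ne_top]
  rfl

lemma len_pos [IsNoetherianRing A] [IsArtinianRing A] (M : ModuleCat.{0} A) [Module.Finite A M] (h : Nonzero A M) :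
    0 < len M := by
  obtain ⟨x, hx⟩ := h
  have : Nontrivial M := ⟨x, 0, hx⟩
  have h1 : Module.length A M ≠ 0 := (Module.length_pos (R := A) (M := M)).ne'
  have h2 : Module.length A M ≠ ⊤ := Module.length_ne_top
  rw [len, Nat.pos_iff_ne_zero, Ne, ENat.toNat_eq_zero]
  tauto

lemma len_quot [IsNoetherianRing A] [IsArtinianRing A] (M N : ModuleCat.{0} A) [Module.Finite A M] (h : IsQuotientOf A N M) :
    len N ≤ len M := by
  obtain ⟨q, hq⟩ := h
  exact ENat.toNat_le_toNat (Module.length_le_of_surjective q hq) Module.length_ne_top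

lemma len_sub [IsNoetherianRing A] [IsArtinianRing A] (M N : ModuleCat.{0} A) [Module.Finite A M] (h : IsSubmoduleOf A N M) :
    len N ≤ len M := by
  obtain ⟨q, hq⟩ := h
  exact ENat.toNat_le_toNat (Module.length_le_of_injective q hq) Module.length_ne_top

lemma len_stab [IsNoetherianRing A] [IsArtinianRing A] (hθ : IsStability A θ) (a b : ℤ) :
    IsStability A (fun M => a * θ M + b * len M) := by
  intro L M N hL hM hN f g hf hg h
  have h1 := hθ L M N hL hM hN f g hf hg h
  have h2 := len_add L M N hL hN f g hf hg h
  simp only [h1, h2]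
  push_cast
  ring

lemma len_int (hint : ∀ M : ModuleCat.{0} A, Module.Finite A M → ∃ k : ℤ, θ M = (k : ℝ)) (a b : ℤ) :
    ∀ M : ModuleCat.{0} A, Module.Finite A M → ∃ k : ℤ, (fun M => a * θ M + b * len M) M = (k : ℝ) := by
  intro M hM
  obtain ⟨k, hk⟩ := hint M hM
  refine ⟨a * k + b * len M, ?_⟩
  simp only [hk]
  push_cast
  rfl

lemma one_le_of_pos {x : ℝ} (h : ∃ k : ℤ, x = k) (hx : 0 < x) : 1 ≤ x := by
  obtain ⟨k, rfl⟩ := h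
  have : 0 < k := by exact_mod_cast hx
  exact_mod_cast this

section

lemma stepC (K : Type) [Field K] [IsAlgClosed K] [Algebra K A] [FiniteDimensional K A]
    [IsNoetherianRing A] [IsArtinianRing A] (hθ : IsStability A θ)
    (hint : ∀ M : ModuleCat.{0} A, Module.Finite A M → ∃ k : ℤ, θ M = (k : ℝ))
    (h : IsCompactTors A (tTheta A θ)) : IsCocompactTors A (tTheta A θ) := by
  obtain ⟨M, hM, hT⟩ := id h
  have hM' : tTheta A θ M := by rw [hT]; exact torsClosure_self M
  have hθ' := len_stab hθ (len M + 1) (-1)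
  have hi' := len_int hint (len M + 1) (-1)
  set θ' : ModuleCat.{0} A → ℝ := fun X => ((len M + 1 : ℤ) : ℝ) * θ X + ((-1 : ℤ) : ℝ) * len X with hdef
  have hk : (0 : ℝ) < len M + 1 := by positivity
  have he : ∀ X, θ' X = (len M + 1) * θ X - len X := by
    intro X
    simp only [hdef]
    push_cast
    ring
  have heq : tTheta A θ = tThetaBar A θ' := by
    funext X
    refine propext ⟨fun hX => ?_, fun hX => ?_⟩
    · rw [hT] at hX
      refine torsClosure_le (tThetaBar_tors hθ') ⟨hM, fun Q hQ hq => ?_⟩ hX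
      by_cases hn : Nonzero A Q
      · have h1 := one_le_of_pos (hint Q hQ) (hM'.2 Q hQ hq hn)
        have h2 : (len Q : ℝ) ≤ len M := by exact_mod_cast len_quot M Q hq
        rw [he]
        nlinarith
      · refine (theta_zero hθ' Q fun x => ?_).ge
        by_contra hx
        exact hn ⟨x, hx⟩
    · refine ⟨hX.1, fun Q hQ hq hn => ?_⟩
      have h1 := hX.2 Q hQ hq
      have h2 : (0 : ℝ) < len Q := by exact_mod_cast len_pos Q hn
      rw [he] at h1
      by_contra! h3
      nlinarith
  rw [heq] at h ⊢
  exact stepA K hθ' hi' h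

lemma stepD (K : Type) [Field K] [IsAlgClosed K] [Algebra K A] [FiniteDimensional K A]
    [IsNoetherianRing A] [IsArtinianRing A] (hθ : IsStability A θ)
    (hint : ∀ M : ModuleCat.{0} A, Module.Finite A M → ∃ k : ℤ, θ M = (k : ℝ))
    (h : IsCocompactTors A (tThetaBar A θ)) : IsCompactTors A (tThetaBar A θ) := by
  obtain ⟨M, hM, hT⟩ := id h
  rw [perp_tThetaBar hθ] at hT
  have hM' : fTheta A θ M := by rw [hT]; exact torfClosure_self M
  have hθ' := len_stab hθ (len M + 1) 1
  have hi' := len_int hint (len M + 1) 1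
  set θ' : ModuleCat.{0} A → ℝ := fun X => ((len M + 1 : ℤ) : ℝ) * θ X + ((1 : ℤ) : ℝ) * len X with hdef
  have hk : (0 : ℝ) < len M + 1 := by positivity
  have he : ∀ X, θ' X = (len M + 1) * θ X + len X := by
    intro X
    simp only [hdef]
    push_cast
    ring
  have heq : fTheta A θ = fThetaBar A θ' := by
    funext X
    refine propext ⟨fun hX => ?_, fun hX => ?_⟩
    · rw [hT] at hX
      have ht : IsTorsionFreeClass A (fThetaBar A θ') := by
        rw [← perp_tTheta hθ']
        exact rightPerp_torf _
      refine torfClosure_le ht ⟨hM, fun Q hQ hq => ?_⟩ hX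
      by_cases hn : Nonzero A Q
      · have h1 := one_le_of_pos (x := - θ Q) (by
          obtain ⟨k, hk⟩ := hint Q hQ
          exact ⟨-k, by rw [hk]; push_cast; rfl⟩) (neg_pos.2 (hM'.2 Q hQ hq hn))
        have h2 : (len Q : ℝ) ≤ len M := by exact_mod_cast len_sub M Q hq
        rw [he]
        nlinarith
      · refine (theta_zero hθ' Q fun x => ?_).le
        by_contra hx
        exact hn ⟨x, hx⟩
    · refine ⟨hX.1, fun Q hQ hq hn => ?_⟩
      have h1 := hX.2 Q hQ hq
      have h2 : (0 : ℝ) < len Q := by exact_mod_cast len_pos Q hn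
      rw [he] at h1
      by_contra! h3
      nlinarith
  have heq' : tThetaBar A θ = tTheta A θ' := by
    refine tors_eq_of_perp (tThetaBar_tors hθ) (tTheta_tors hθ') ?_
    rw [perp_tThetaBar hθ, perp_tTheta hθ', heq]
  rw [heq'] at h ⊢
  exact stepB K hθ' hi' h

/-- the rigidity condition. -/
def RCond (θ : ModuleCat.{0} A → ℝ) : Prop :=
  ∃ (J0 J1 : Type) (_ : Fintype J0) (_ : DecidableEq J0) (ε0 : J0 → A) (ε1 : J1 → A) (f : J1 → J0 → A),
      Datum θ ε0 ε1 f ∧ IsS ε1 f (Cf ε0 f)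

lemma stepE (K : Type) [Field K] [IsAlgClosed K] [Algebra K A] [FiniteDimensional K A]
    [IsNoetherianRing A] [IsArtinianRing A] (hθ : IsStability A θ)
    (hint : ∀ M : ModuleCat.{0} A, Module.Finite A M → ∃ k : ℤ, θ M = (k : ℝ))
    {T : ModuleCat.{0} A → Prop} (hT : IsTorsionClass A T) (h1 : ∀ X, T X → tThetaBar A θ X)
    (h2 : ∀ X, rightPerp A T X → fThetaBar A θ X) (h : IsBicompactTors A T) : RCond θ := by
  obtain ⟨⟨M, hM, hTM⟩, ⟨N, hN, hTN⟩⟩ := h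
  have hM' : tThetaBar A θ M := h1 _ (by rw [hTM]; exact torsClosure_self M)
  have hN' : fThetaBar A θ N := h2 _ (by rw [hTN]; exact torfClosure_self N)
  obtain ⟨J0, J1, _, _, ε0, ε1, f, D, hS, hI⟩ := exists_datum_both K hθ hint M hM' N hN'
  refine ⟨J0, J1, _, _, ε0, ε1, f, D, ?_⟩
  obtain ⟨P, _, _, hP, hSP⟩ := D.sK
  have hC : T (ModuleCat.of A (Cf ε0 f)) := by
    refine mem_of_perp hT _ fun Y _ _ hY g => ?_
    rw [hTN] at hY
    have := torfClosure_le (rp_torf (Cf ε0 f)) ⟨hN, (isI_iff_Cf D.pf).1 hI⟩ hY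
    exact this.2 g
  rw [hTM] at hC
  exact (hSP _).2 (torsClosure_le (lp_tors P) ⟨hM, (hSP M).1 hS⟩ hC).2

end

lemma stepF1 [IsNoetherianRing A] [IsArtinianRing A] (hθ : IsStability A θ) (h : RCond θ) :
    FunctoriallyFinite A (tThetaBar A θ) := by
  obtain ⟨J0, J1, _, _, ε0, ε1, f, D, hC⟩ := h
  obtain ⟨P, _, _, hP, hSP⟩ := D.sK
  have key : ∀ (X : Type) [AddCommGroup X] [Module A X], tThetaBar A θ (ModuleCat.of A X) → IsS ε1 f X := by
    intro X _ _ hX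
    have : Module.Finite A X := hX.1
    obtain ⟨X', h1, h2, -⟩ := tors_max (lp_tors (A := A) P) X
    have hI : IsI ε0 f (X ⧸ X') := (isI_iff_Cf D.pf).2 fun g =>
      h2 (Cf ε0 f) ⟨inferInstanceAs (Module.Finite A (Cf ε0 f)), (hSP _).1 hC⟩ g
    have hS := D.dIS _ hI ((tThetaBar_iff hθ).1 hX X')
    exact IsS.ext D.pf X' ((hSP X').2 h1.2) hS
  refine ff_of_left (tThetaBar_tors hθ) fun M _ _ _ => ?_
  obtain ⟨X, i1, i2, i3, ι, hX, hι⟩ := D.la hC M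
  exact ⟨X, i1, i2, ι, D.S_le hθ X hX, fun Y _ _ hY g => hι Y (key Y hY) g⟩

lemma stepF2 (K : Type) [Field K] [Algebra K A] [FiniteDimensional K A] [IsNoetherianRing A] [IsArtinianRing A]
    (hθ : IsStability A θ) (h : RCond θ) : FunctoriallyFinite A (tTheta A θ) := by
  obtain ⟨J0, J1, _, _, ε0, ε1, f, D, hC⟩ := h
  have k1 : ∀ (X : Type) [AddCommGroup X] [Module A X], tTheta A θ (ModuleCat.of A X) →
      ∃ (m : ℕ) (q : (Fin m → Cf ε0 f) →ₗ[A] X), Function.Surjective q := by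
    intro X _ _ hX
    have : Module.Finite A X := hX.1
    obtain ⟨X', ⟨m, q, hq⟩, hmax⟩ := set_has_maximal_iff_noetherian.2 (inferInstanceAs (IsNoetherian A X))
      {X' : Submodule A X | ∃ (m : ℕ) (q : (Fin m → Cf ε0 f) →ₗ[A] X), LinearMap.range q = X'} ⟨_, 0, 0, rfl⟩
    have hle : ∀ g : Cf ε0 f →ₗ[A] X, ∀ c, g c ∈ X' := by
      intro g c
      let q' : (Fin (m + 1) → Cf ε0 f) →ₗ[A] X :=
        q.comp (LinearMap.funLeft A _ Fin.succ) + g.comp (LinearMap.proj 0)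
      have hq' : ∀ c y, q' (Fin.cons c y : Fin (m + 1) → Cf ε0 f) = q y + g c := by
        intro c y
        rfl
      have h1 : X' ≤ LinearMap.range q' := by
        rw [← hq]
        rintro _ ⟨y, rfl⟩
        exact ⟨Fin.cons 0 y, by rw [hq', map_zero, add_zero]⟩
      have h2 : LinearMap.range q' ≤ X' := by
        by_contra h
        exact hmax _ ⟨m + 1, q', rfl⟩ (lt_of_le_not_ge h1 h)
      refine h2 ⟨Fin.cons c 0, ?_⟩
      rw [hq', map_zero, zero_add]
    have hS' : IsS ε1 f X' := by
      rw [← hq]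
      exact (isS_pi hC).quot q.rangeRestrict q.surjective_rangeRestrict
    have hI : IsI ε0 f (X ⧸ X') := by
      intro v hv j
      choose x hx using fun j => X'.mkQ_surjective (v j)
      have hw : ∀ i, ∑ j, f i j • x j ∈ X' := by
        intro i
        rw [← Submodule.Quotient.mk_eq_zero, ← Submodule.mkQ_apply, map_sum, ← hv i]
        refine Finset.sum_congr rfl fun j _ => ?_
        rw [map_smul, hx]
      obtain ⟨u, hu⟩ := hS' (fun i => ⟨_, hw i⟩)
      have hu' : ∀ i, ∑ j, f i j • x j = ∑ j, f i j • (u j : X) := by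
        intro i
        have := congrArg Subtype.val (hu i)
        simp only [Submodule.coe_smul, Submodule.coe_sum, Finset.smul_sum, smul_smul, D.pf.l] at this
        exact this
      obtain ⟨g, hg⟩ := cg_lift (ε0 := ε0) (f := f) (fun j => ε0 j • (x j - u j)) (fun i => by
        simp only [smul_smul, D.pf.r, smul_sub, Finset.sum_sub_distrib]
        rw [hu', sub_self]) (fun j => by rw [smul_smul, (D.pf.i0 j).eq])
      have h1 := hle g (cg ε0 f j)
      rw [hg, smul_sub] at h1
      have h2 : ε0 j • x j ∈ X' := by
        have := X'.add_mem h1 (X'.smul_mem (ε0 j) (u j).2)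
        rwa [sub_add_cancel] at this
      rw [← hx, ← map_smul]
      exact (Submodule.Quotient.mk_eq_zero _).2 h2
    have htop : X' = ⊤ := by
      by_contra hne
      have h1 := (tTheta_iff hθ).1 hX X' hne
      have h2 := D.dI _ hI
      linarith
    exact ⟨m, q, LinearMap.range_eq_top.1 (hq.trans htop)⟩
  have k2 : ∀ (X : Type) [AddCommGroup X] [Module A X] [Module.Finite A X] (m : ℕ)
      (q : (Fin m → Cf ε0 f) →ₗ[A] X), Function.Surjective q → tTheta A θ (ModuleCat.of A X) := by
    intro X _ _ _ m q hq
    refine (tTheta_iff hθ).2 fun L hL => ?_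
    by_contra! h0
    have hI : IsI ε0 f (X ⧸ L) :=
      D.dSI _ ((isS_pi hC).quot (L.mkQ.comp q) (L.mkQ_surjective.comp hq)) h0
    rw [isI_iff_Cf D.pf] at hI
    have hz : L.mkQ.comp q = 0 := by
      refine LinearMap.pi_ext' fun i => ?_
      rw [hI (LinearMap.comp _ _), LinearMap.zero_comp]
    refine hL (eq_top_iff.2 fun x _ => ?_)
    obtain ⟨y, rfl⟩ := hq x
    exact (Submodule.Quotient.mk_eq_zero _).1 (LinearMap.congr_fun hz y)
  refine ff_of_left (tTheta_tors hθ) fun M _ _ _ => ?_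
  obtain ⟨X, i1, i2, i3, ι, ⟨m, q, hq⟩, hι⟩ := left_approx_Fac (K := K) (A := A) (Cf ε0 f) M
  exact ⟨X, i1, i2, ι, k2 X m q hq, fun Y _ _ hY g => hι Y (k1 Y hY) g⟩

end Concl
end TorsPaper

namespace TorsPaper

variable (A : Type) [Ring A]

/-- Over an algebraically closed field, for an integer-valued stability
function `θ` (a lattice point), the following are equivalent:
(i) `T_θ` compact; (ii) `T_θ` bicompact; (iii) `T_θ` functorially finite;
(iv) `T_θ` cocompact; (v) `\bar T_θ` compact; (vi) `\bar T_θ` cocompact;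
(vii) `\bar T_θ` bicompact; (viii) `\bar T_θ` functorially finite. -/
theorem stmt3 (K : Type) [Field K] [IsAlgClosed K] [Algebra K A] [FiniteDimensional K A]
    (θ : ModuleCat.{0} A → ℝ) (hθ : IsStability A θ)
    (hint : ∀ M : ModuleCat.{0} A, Module.Finite A M → ∃ k : ℤ, θ M = (k : ℝ)) :
    List.TFAE [IsCompactTors A (tTheta A θ),
      IsBicompactTors A (tTheta A θ),
      FunctoriallyFinite A (tTheta A θ),
      IsCocompactTors A (tTheta A θ),
      IsCompactTors A (tThetaBar A θ),
      IsCocompactTors A (tThetaBar A θ),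
      IsBicompactTors A (tThetaBar A θ),
      FunctoriallyFinite A (tThetaBar A θ)] := by
  have i1 : IsNoetherianRing A := isNoetherian_of_tower K inferInstance
  have i2 : IsArtinianRing A := IsArtinianRing.of_finite K A
  have hR1 : IsBicompactTors A (tTheta A θ) → RCond θ := fun h =>
    stepE K hθ hint (tTheta_tors hθ) (fun X hX => tTheta_le hθ hX)
      (fun X hX => by rwa [perp_tTheta hθ] at hX) h
  have hR2 : IsBicompactTors A (tThetaBar A θ) → RCond θ := fun h =>
    stepE K hθ hint (tThetaBar_tors hθ) (fun X hX => hX)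
      (fun X hX => by rw [perp_tThetaBar hθ] at hX; exact fTheta_le hθ hX) h
  tfae_have 1 → 2 := fun h => ⟨h, stepC K hθ hint h⟩
  tfae_have 2 → 3 := fun h => stepF2 K hθ (hR1 h)
  tfae_have 3 → 1 := fun h => compact_of_ff (tTheta_tors hθ) h
  tfae_have 2 → 4 := fun h => h.2
  tfae_have 4 → 1 := fun h => stepB K hθ hint h
  tfae_have 2 → 8 := fun h => stepF1 hθ (hR1 h)
  tfae_have 8 → 5 := fun h => compact_of_ff (tThetaBar_tors hθ) h
  tfae_have 5 → 6 := fun h => stepA K hθ hint h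
  tfae_have 6 → 7 := fun h => ⟨stepD K hθ hint h, h⟩
  tfae_have 7 → 3 := fun h => stepF2 K hθ (hR2 h)
  tfae_finish
end TorsPaper
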